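/- For every ε > 0 there exists a constant C(ε) such that the following holds: for every integer t ≥ 2 and every two pairs of integers (n,m) and (n',m') with 1 ≤ m ≤ n/2, 1 ≤ m' ≤ n'/2, C(n,m) = C(n',m') = t, and min(m, m') ≥ exp((log(n+n'))^{2/3+ε}), one has |n − n'| ≤ C(ε)·exp((log(n+n'))^{2/3+ε}). -/

import Mathlib

open Finset

/-- Equal power sums up to `k` give equal elementary symmetric functions when `1, …, k` are units. -/
theorem aeval_esymm_eq_of_psum_eq {R : Type*} [CommRing R] {k : ℕ} (x y : Fin k → R)
    (hk : ∀ i : ℕ, 0 < i → i ≤ k → IsUnit (i : R))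
    (h : ∀ r ≤ k, ∑ i, x i ^ r = ∑ i, y i ^ r) (n : ℕ) (hn : n ≤ k) :
    MvPolynomial.aeval x (MvPolynomial.esymm (Fin k) ℤ n) =
      MvPolynomial.aeval y (MvPolynomial.esymm (Fin k) ℤ n) := by
  induction n using Nat.strong_induction_on with
  | _ n ih =>
    rcases Nat.eq_zero_or_pos n with rfl | hpos
    · simp
    · have hx := congrArg (MvPolynomial.aeval x) (MvPolynomial.mul_esymm_eq_sum (Fin k) ℤ n)
      have hy := congrArg (MvPolynomial.aeval y) (MvPolynomial.mul_esymm_eq_sum (Fin k) ℤ n)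
      simp only [map_mul, map_natCast, map_sum, map_pow, map_neg, map_one] at hx hy
      apply (hk n hpos hn).mul_left_cancel
      rw [hx, hy]
      congr 1
      refine Finset.sum_congr rfl fun a ha => ?_
      simp only [mem_filter, HasAntidiagonal.mem_antidiagonal] at ha
      rw [ih a.1 ha.2 (by omega)]
      congr 1
      simp only [MvPolynomial.psum, map_sum, map_pow, MvPolynomial.aeval_X]
      exact h _ (by omega)

theorem prod_add_eq_of_psum_eq {R : Type*} [CommRing R] {k : ℕ} (x y : Fin k → R)
    (hk : ∀ i : ℕ, 0 < i → i ≤ k → IsUnit (i : R))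
    (h : ∀ r ≤ k, ∑ i, x i ^ r = ∑ i, y i ^ r) (T : R) :
    ∏ i, (T + x i) = ∏ i, (T + y i) := by
  have key := MvPolynomial.prod_C_add_X_eq_sum_esymm ℤ (Fin k)
  have ev (z : Fin k → R) := congrArg
    (Polynomial.eval₂ (MvPolynomial.aeval z : MvPolynomial (Fin k) ℤ →ₐ[ℤ] R).toRingHom T) key
  have hx := ev x
  have hy := ev y
  simp [Polynomial.eval₂_finsetProd, Polynomial.eval₂_finsetSum] at hx hy
  rw [hx, hy]
  refine Finset.sum_congr rfl fun n hn => ?_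
  rw [aeval_esymm_eq_of_psum_eq x y hk h n (by simp at hn; omega)]

theorem eq_of_psum_eq {R : Type*} [CommRing R] {k : ℕ} (x y : Fin k → R)
    (hk : ∀ i : ℕ, 0 < i → i ≤ k → IsUnit (i : R))
    (h : ∀ r ≤ k, ∑ i, x i ^ r = ∑ i, y i ^ r)
    (hu : ∀ i j, i ≠ j → IsUnit (x i - y j)) : x = y := by
  funext i
  have h1 := prod_add_eq_of_psum_eq x y hk h (- x i)
  rw [Finset.prod_eq_zero (mem_univ i) (by simp)] at h1
  rw [← Finset.mul_prod_erase _ _ (mem_univ i)] at h1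
  have h2 : IsUnit (∏ j ∈ univ.erase i, (-x i + y j)) := by
    rw [IsUnit.prod_iff]
    intro j hj
    have := (hu i j (by simp at hj; tauto)).neg
    rwa [neg_sub, sub_eq_neg_add] at this
  have h3 := (h2.mul_left_eq_zero).1 h1.symm
  rw [neg_add_eq_zero] at h3
  exact h3

theorem isUnit_intCast_zmod_pow {p n : ℕ} (hp : p.Prime) (z : ℤ) (hz : ¬ (p : ℤ) ∣ z) :
    IsUnit ((z : ZMod (p ^ n))) := by
  have hc : IsCoprime z ((p ^ n : ℕ) : ℤ) := by
    push_cast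
    apply IsCoprime.pow_right
    exact ((Nat.prime_iff_prime_int.1 hp).coprime_iff_not_dvd.2 hz).symm
  exact IsUnit.of_mul_eq_one _ (ZMod.coe_int_mul_inv_eq_one hc)

theorem card_linnik {p k e M : ℕ} (hp : p.Prime) (hkp : k < p) (hM : M ≤ e * k)
    (b : Fin k → ℤ) (hb : ∀ i j, i ≠ j → ¬ (p : ℤ) ∣ b i - b j) (a : ℤ) (c : ℕ → ℤ)
    (S : Finset (Fin k → ℤ))
    (hS : ∀ x ∈ S, (∀ i, 0 ≤ x i ∧ x i < p ^ M ∧ (p : ℤ) ∣ x i - b i) ∧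
      ∀ r ≤ k, (p : ℤ) ^ (e * r) ∣ ∑ i, (x i - a) ^ r - c r) :
    S.card ≤ p ^ (e * (k * (k - 1) / 2)) := by
  classical
  have hp0 : (0 : ℤ) < p := by exact_mod_cast hp.pos
  let T : Finset (Fin k → ℤ) :=
    Fintype.piFinset fun r : Fin k => Finset.Ico (0 : ℤ) ((p : ℤ) ^ (e * (k - 1 - r)))
  have hT : T.card = p ^ (e * (k * (k - 1) / 2)) := by
    have hcard : ∀ r : Fin k, (Finset.Ico (0 : ℤ) ((p : ℤ) ^ (e * (k - 1 - r)))).card =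
        p ^ (e * (k - 1 - r)) := by
      intro r
      rw [Int.card_Ico, sub_zero]
      exact_mod_cast Int.toNat_natCast (p ^ (e * (k - 1 - r)))
    simp only [T, Fintype.card_piFinset, hcard]
    rw [Finset.prod_pow_eq_pow_sum, ← Finset.mul_sum,
      Fin.sum_univ_eq_sum_range (fun r => k - 1 - r) k, Finset.sum_range_reflect (fun i => i) k,
      Finset.sum_range_id]
  rw [← hT]
  let g : (Fin k → ℤ) → (Fin k → ℤ) := fun x r =>
    ((∑ i, (x i - a) ^ ((r : ℕ) + 1) - c (r + 1)) / (p : ℤ) ^ (e * (r + 1))) %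
      (p : ℤ) ^ (e * (k - 1 - r))
  refine Finset.card_le_card_of_injOn g ?_ ?_
  · intro x _
    simp only [T, Finset.mem_coe, Fintype.mem_piFinset, Finset.mem_Ico, g]
    intro r
    exact ⟨Int.emod_nonneg _ (by positivity), Int.emod_lt_of_pos _ (by positivity)⟩
  · intro x hx y hy hxy
    have hx' := hS x hx
    have hy' := hS y hy
    have hpow : ∀ r ≤ k, (p : ℤ) ^ (e * k) ∣ ∑ i, (x i - a) ^ r - ∑ i, (y i - a) ^ r := by
      intro r hr
      rcases Nat.eq_zero_or_pos r with rfl | hr0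
      · simp
      · obtain ⟨s, rfl⟩ : ∃ s, r = s + 1 := ⟨r - 1, by omega⟩
        obtain ⟨u, hu⟩ := hx'.2 _ hr
        obtain ⟨v, hv⟩ := hy'.2 _ hr
        have h1 := congrFun hxy ⟨s, by omega⟩
        simp only [g] at h1
        have hne : (p : ℤ) ^ (e * (s + 1)) ≠ 0 := by positivity
        rw [hu, hv, Int.mul_ediv_cancel_left _ hne, Int.mul_ediv_cancel_left _ hne] at h1
        have h2 : (p : ℤ) ^ (e * (k - 1 - s)) ∣ u - v := Int.ModEq.dvd (Eq.symm h1)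
        have h3 : ∑ i, (x i - a) ^ (s + 1) - ∑ i, (y i - a) ^ (s + 1) =
            (p : ℤ) ^ (e * (s + 1)) * (u - v) := by linear_combination hu - hv
        rw [h3, show e * k = e * (s + 1) + e * (k - 1 - s) by
          rw [← mul_add]; congr 1; omega, pow_add]
        exact mul_dvd_mul_left _ h2
    let R := ZMod (p ^ (e * k))
    have key : (fun i => ((x i - a : ℤ) : R)) = fun i => ((y i - a : ℤ) : R) := by
      apply eq_of_psum_eq
      · intro i hi hik
        have := isUnit_intCast_zmod_pow (n := e * k) hp (i : ℤ) (by
          intro hd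
          have := Nat.le_of_dvd hi (Int.natCast_dvd_natCast.1 hd)
          omega)
        simpa using this
      · intro r hr
        have := (ZMod.intCast_zmod_eq_zero_iff_dvd (∑ i, (x i - a) ^ r - ∑ i, (y i - a) ^ r)
          (p ^ (e * k))).2 (by exact_mod_cast hpow r hr)
        push_cast at this
        rw [sub_eq_zero] at this
        push_cast
        exact this
      · intro i j hij
        have := isUnit_intCast_zmod_pow (n := e * k) hp (x i - y j) (by
          intro hd
          apply hb i j hij
          have h1 := (hx'.1 i).2.2
          have h2 := (hy'.1 j).2.2
          have h3 : b i - b j = (x i - y j) - (x i - b i) + (y j - b j) := by ring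
          rw [h3]
          exact dvd_add (dvd_sub hd h1) h2)
        convert this using 1
        push_cast
        ring
    funext i
    have h1 : ((x i - a : ℤ) : R) = ((y i - a : ℤ) : R) := congrFun key i
    rw [ZMod.intCast_eq_intCast_iff_dvd_sub] at h1
    have h2 : ((p ^ M : ℕ) : ℤ) ∣ y i - x i := by
      refine dvd_trans ?_ (show ((p ^ (e * k) : ℕ) : ℤ) ∣ y i - x i by simpa using h1)
      exact_mod_cast pow_dvd_pow p hM
    obtain ⟨w, hw⟩ := h2
    obtain ⟨hx0, hx1, -⟩ := hx'.1 i
    obtain ⟨hy0, hy1, -⟩ := hy'.1 i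
    push_cast at hw
    have hPp : (0 : ℤ) < (p : ℤ) ^ M := by positivity
    have hw0 : w = 0 := by
      have : w < 1 := by nlinarith
      have : -1 < w := by nlinarith
      omega
    rw [hw0] at hw
    linarith

/-- The number of solutions of the Vinogradov system of degree `k` in `2 * m` variables from `s`. -/
def vinogradovCount (k m : ℕ) (s : Finset ℤ) : ℕ :=
  #{q ∈ Fintype.piFinset (fun _ : Fin m => s) ×ˢ Fintype.piFinset (fun _ : Fin m => s) |
    ∀ r ≤ k, ∑ i, q.1 i ^ r = ∑ i, q.2 i ^ r}

theorem psum_translate {ι R : Type*} [Fintype ι] [CommRing R] {k : ℕ} {x y : ι → R}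
    (h : ∀ r ≤ k, ∑ i, x i ^ r = ∑ i, y i ^ r) (a : R) (r : ℕ) (hr : r ≤ k) :
    ∑ i, (x i + a) ^ r = ∑ i, (y i + a) ^ r := by
  simp only [add_pow]
  rw [Finset.sum_comm, Finset.sum_comm (s := univ)]
  refine Finset.sum_congr rfl fun j hj => ?_
  rw [← Finset.sum_mul, ← Finset.sum_mul, ← Finset.sum_mul, ← Finset.sum_mul,
    h j (by simp at hj; omega)]

theorem vinogradovCount_image_le (k m : ℕ) (s : Finset ℤ) (a d : ℤ) (hd : d ≠ 0) :
    vinogradovCount k m (s.image fun y => d * y + a) ≤ vinogradovCount k m s := by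
  refine Finset.card_le_card_of_surjOn
    (fun q => (fun i => d * q.1 i + a, fun i => d * q.2 i + a)) ?_
  rintro ⟨x, y⟩ hq
  simp only [coe_filter, mem_product, Fintype.mem_piFinset, mem_image, Set.mem_ofPred_eq] at hq
  obtain ⟨⟨hx, hy⟩, h⟩ := hq
  choose x' hx' hxx using hx
  choose y' hy' hyy using hy
  refine ⟨(x', y'), ?_, ?_⟩
  · simp only [coe_filter, mem_product, Fintype.mem_piFinset, Set.mem_ofPred_eq]
    refine ⟨⟨hx', hy'⟩, fun r hr => ?_⟩
    have h1 := psum_translate h (-a) r hr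
    simp only [← hxx, ← hyy, add_neg_cancel_right, mul_pow, ← Finset.mul_sum] at h1
    exact mul_left_cancel₀ (pow_ne_zero r hd) h1
  · simp [hxx, hyy]

theorem vinogradovCount_zero (k : ℕ) (s : Finset ℤ) : vinogradovCount k 0 s = 1 := by
  simp [vinogradovCount]

theorem vinogradovCount_le (k m : ℕ) (s : Finset ℤ) :
    vinogradovCount k m s ≤ s.card ^ (2 * m) := by
  refine (Finset.card_filter_le _ _).trans ?_
  simp [Fintype.card_piFinset, two_mul, pow_add]

/-- The moment vector of `x` in `ZMod Q`. -/
def momentVec (k Q : ℕ) (x : ℤ) : Fin (k + 1) → ZMod Q := fun r => (x : ZMod Q) ^ (r : ℕ)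

theorem sum_momentVec_eq_iff {ι : Type*} [Fintype ι] {k Q Y : ℕ} (hY : 0 < Y)
    (hQ : Fintype.card ι * Y ^ k < Q) (x y : ι → ℤ)
    (hx : ∀ i, x i ∈ Finset.Ico (0 : ℤ) Y) (hy : ∀ i, y i ∈ Finset.Ico (0 : ℤ) Y) :
    ∑ i, momentVec k Q (x i) = ∑ i, momentVec k Q (y i) ↔
      ∀ r ≤ k, ∑ i, x i ^ r = ∑ i, y i ^ r := by
  have bound : ∀ z : ι → ℤ, (∀ i, z i ∈ Finset.Ico (0 : ℤ) Y) → ∀ r ≤ k,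
      0 ≤ ∑ i, z i ^ r ∧ ∑ i, z i ^ r < Q := by
    intro z hz r hr
    have hz' : ∀ i, 0 ≤ z i ∧ z i < Y := fun i => by simpa using hz i
    refine ⟨Finset.sum_nonneg fun i _ => pow_nonneg (hz' i).1 _, ?_⟩
    calc ∑ i, z i ^ r ≤ ∑ _i : ι, (Y : ℤ) ^ k := by
          refine Finset.sum_le_sum fun i _ => ?_
          exact (pow_le_pow_left₀ (hz' i).1 (hz' i).2.le r).trans
            (pow_le_pow_right₀ (by exact_mod_cast hY) hr)
      _ < Q := by simp; exact_mod_cast hQ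
  constructor
  · intro h r hr
    have h1 := congrFun h ⟨r, by omega⟩
    simp only [momentVec, Finset.sum_apply] at h1
    have h2 : ((∑ i, x i ^ r : ℤ) : ZMod Q) = ((∑ i, y i ^ r : ℤ) : ZMod Q) := by
      push_cast; exact h1
    rw [ZMod.intCast_eq_intCast_iff] at h2
    have bx := bound x hx r hr
    have by' := bound y hy r hr
    have := h2.eq
    rwa [Int.emod_eq_of_lt bx.1 bx.2, Int.emod_eq_of_lt by'.1 by'.2] at this
  · intro h
    funext r
    simp only [momentVec, Finset.sum_apply]
    have := congrArg (Int.cast : ℤ → ZMod Q) (h r (by omega))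
    push_cast at this
    exact this

theorem sum_addChar_normSq {G ι : Type*} [AddCommGroup G] [Fintype G] [DecidableEq G]
    (s : Finset ι) (σ : ι → G) :
    ∑ ψ : AddChar G ℂ, ‖∑ i ∈ s, ψ (σ i)‖ ^ 2 =
      (Fintype.card G : ℝ) * #{q ∈ s ×ˢ s | σ q.1 = σ q.2} := by
  have h : ∀ ψ : AddChar G ℂ, ((‖∑ i ∈ s, ψ (σ i)‖ ^ 2 : ℝ) : ℂ) =
      ∑ q ∈ s ×ˢ s, ψ (σ q.1 - σ q.2) := by
    intro ψ
    push_cast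
    rw [← Complex.mul_conj', map_sum, Finset.sum_mul_sum, Finset.sum_product]
    refine Finset.sum_congr rfl fun i _ => Finset.sum_congr rfl fun j _ => ?_
    rw [sub_eq_add_neg, AddChar.map_add_eq_mul, AddChar.map_neg_eq_conj]
  have h2 : ((∑ ψ : AddChar G ℂ, ‖∑ i ∈ s, ψ (σ i)‖ ^ 2 : ℝ) : ℂ) =
      (Fintype.card G : ℂ) * #{q ∈ s ×ˢ s | σ q.1 = σ q.2} := by
    rw [Complex.ofReal_sum, Finset.sum_congr rfl fun ψ _ => h ψ, Finset.sum_comm]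
    simp only [AddChar.sum_apply_eq_ite, sub_eq_zero]
    rw [← Finset.sum_filter, Finset.sum_const, nsmul_eq_mul, mul_comm]
  exact_mod_cast h2

theorem card_shifted_le {G ι : Type*} [AddCommGroup G] [DecidableEq G]
    (s : Finset ι) (σ : ι → G) (h : G) :
    #{q ∈ s ×ˢ s | σ q.1 = σ q.2 + h} ≤ #{q ∈ s ×ˢ s | σ q.1 = σ q.2} := by
  let T := s.image σ
  have key : ∀ h : G, #{q ∈ s ×ˢ s | σ q.1 = σ q.2 + h} =
      ∑ v ∈ T, #{i ∈ s | σ i = v + h} * #{i ∈ s | σ i = v} := by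
    intro h
    rw [Finset.card_eq_sum_card_fiberwise (f := fun q => σ q.2) (t := T)
      (fun q hq => by
        simp only [coe_filter, mem_product, Set.mem_ofPred_eq] at hq
        exact mem_coe.2 (mem_image_of_mem σ hq.1.2))]
    refine Finset.sum_congr rfl fun v _ => ?_
    rw [← Finset.card_product]
    congr 1
    ext q
    simp only [mem_filter, mem_product]
    constructor
    · rintro ⟨⟨⟨h1, h2⟩, h3⟩, rfl⟩; exact ⟨⟨h1, h3⟩, h2, rfl⟩
    · rintro ⟨⟨h1, h3⟩, h2, rfl⟩; exact ⟨⟨⟨h1, h2⟩, h3⟩, rfl⟩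
  have k0 := key 0
  simp only [add_zero] at k0
  rw [key, k0]
  have h1 : ∑ v ∈ T, (#{i ∈ s | σ i = v + h}) ^ 2 ≤ ∑ v ∈ T, (#{i ∈ s | σ i = v}) ^ 2 := by
    rw [← Finset.sum_image (s := T) (g := fun v => v + h) (f := fun v => (#{i ∈ s | σ i = v}) ^ 2)
      (by intro x _ y _ hxy; exact add_right_cancel hxy)]
    refine Finset.sum_le_sum_of_ne_zero fun v _ hv => ?_
    obtain ⟨i, hi⟩ := Finset.card_pos.1 (Nat.pos_of_ne_zero fun h0 => hv (by rw [h0]; rfl))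
    rw [mem_filter] at hi
    exact hi.2 ▸ mem_image_of_mem σ hi.1
  have h2 : 2 * ∑ v ∈ T, #{i ∈ s | σ i = v + h} * #{i ∈ s | σ i = v} ≤
      ∑ v ∈ T, (#{i ∈ s | σ i = v + h}) ^ 2 + ∑ v ∈ T, (#{i ∈ s | σ i = v}) ^ 2 := by
    rw [Finset.mul_sum, ← Finset.sum_add_distrib]
    refine Finset.sum_le_sum fun v _ => ?_
    have := two_mul_le_add_sq (#{i ∈ s | σ i = v + h}) (#{i ∈ s | σ i = v})
    linarith
  simp only [pow_two] at h1 h2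
  linarith

/-- The exponential sum over moment vectors. -/
noncomputable def momentSum (k Q : ℕ) (s : Finset ℤ)
    (ψ : AddChar (Fin (k + 1) → ZMod Q) ℂ) : ℂ :=
  ∑ x ∈ s, ψ (momentVec k Q x)

theorem addChar_map_sum {G ι : Type*} [AddCommGroup G] (ψ : AddChar G ℂ) (f : ι → G)
    (s : Finset ι) : ψ (∑ i ∈ s, f i) = ∏ i ∈ s, ψ (f i) := by
  classical
  induction s using Finset.induction_on with
  | empty => simp
  | insert a s ha ih => rw [Finset.sum_insert ha, Finset.prod_insert ha, AddChar.map_add_eq_mul, ih]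

theorem momentSum_prod {k Q : ℕ} {ι : Type*} [Fintype ι] [DecidableEq ι] (s : ι → Finset ℤ)
    (ψ : AddChar (Fin (k + 1) → ZMod Q) ℂ) :
    ∏ i, momentSum k Q (s i) ψ =
      ∑ x ∈ Fintype.piFinset s, ψ (∑ i, momentVec k Q (x i)) := by
  unfold momentSum
  rw [Finset.prod_univ_sum]
  refine Finset.sum_congr rfl fun x _ => ?_
  exact (addChar_map_sum ψ _ univ).symm

theorem sum_momentSum_pow {k m Q Y : ℕ} [NeZero Q] (hY : 0 < Y) (hQ : m * Y ^ k < Q)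
    (s : Finset ℤ) (hs : s ⊆ Finset.Ico (0 : ℤ) Y) :
    ∑ ψ : AddChar (Fin (k + 1) → ZMod Q) ℂ, ‖momentSum k Q s ψ‖ ^ (2 * m) =
      (Fintype.card (Fin (k + 1) → ZMod Q) : ℝ) * vinogradovCount k m s := by
  classical
  have h := sum_addChar_normSq (Fintype.piFinset fun _ : Fin m => s)
    (fun x => ∑ i, momentVec k Q (x i))
  have h1 : ∀ ψ : AddChar (Fin (k + 1) → ZMod Q) ℂ, ‖momentSum k Q s ψ‖ ^ (2 * m) =
      ‖∑ x ∈ Fintype.piFinset fun _ : Fin m => s, ψ (∑ i, momentVec k Q (x i))‖ ^ 2 := by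
    intro ψ
    rw [← momentSum_prod]
    simp [← pow_mul, mul_comm]
  rw [Finset.sum_congr rfl fun ψ _ => h1 ψ, h, vinogradovCount]
  congr 3
  refine Finset.filter_congr fun q hq => ?_
  simp only [mem_product, Fintype.mem_piFinset] at hq
  exact sum_momentVec_eq_iff hY (by simpa using hQ) _ _ (fun i => hs (hq.1 i)) (fun i => hs (hq.2 i))

theorem norm_pow_le_wellspaced {p k q m : ℕ} (hp : 0 < p) (hq : 0 < q) (f : ℂ)
    (u g : ℕ → ℂ) (hu : f = ∑ b ∈ range p, u b) (hg : f = ∑ a ∈ range q, g a) :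
    ‖f‖ ^ (2 * (k + m)) ≤ (2 * p : ℝ) ^ (2 * k) * (q : ℝ) ^ (2 * m) *
      ∑ b : Fin k → Fin p with Function.Injective b, ∑ a ∈ range q,
        (∏ i, ‖u (b i)‖) ^ 2 * ‖g a‖ ^ (2 * m) +
      (2 * k : ℝ) ^ (2 * (k + m)) * ∑ b ∈ range p, ‖u b‖ ^ (2 * (k + m)) := by
  classical
  have hp' : (0 : ℝ) < p := by exact_mod_cast hp
  have hq' : (0 : ℝ) < q := by exact_mod_cast hq
  let large := {b ∈ range p | ‖f‖ / (2 * p) ≤ ‖u b‖}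
  by_cases hcard : k ≤ large.card
  · refine le_trans ?_ (le_add_of_nonneg_right (by positivity))
    obtain ⟨a, ha, hga⟩ : ∃ a ∈ range q, ‖f‖ / q ≤ ‖g a‖ := by
      apply Finset.exists_le_of_sum_le (by simpa using hq.ne')
      rw [Finset.sum_const, card_range, nsmul_eq_mul, mul_div_cancel₀ _ hq'.ne']
      rw [hg]
      exact norm_sum_le _ _
    let emb := large.orderEmbOfCardLe hcard
    have hmem : ∀ i, emb i ∈ large := fun i => Finset.orderEmbOfCardLe_mem _ _ i
    have hlt : ∀ i, emb i < p := fun i => by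
      have := hmem i
      simp only [large, mem_filter, mem_range] at this
      exact this.1
    let b : Fin k → Fin p := fun i => ⟨emb i, hlt i⟩
    have hb : Function.Injective b := by
      intro i j hij
      have : emb i = emb j := congrArg Fin.val hij
      exact emb.injective this
    have h1 : (‖f‖ / (2 * p)) ^ k ≤ ∏ i, ‖u (b i)‖ := by
      calc (‖f‖ / (2 * p)) ^ k = ∏ _i : Fin k, ‖f‖ / (2 * p) := by
            rw [Finset.prod_const, card_univ, Fintype.card_fin]
        _ ≤ _ := Finset.prod_le_prod (fun _ _ => by positivity) fun i _ => by
          have := hmem i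
          simp only [large, mem_filter] at this
          exact this.2
    have h2 : (∏ i, ‖u (b i)‖) ^ 2 * ‖g a‖ ^ (2 * m) ≤
        ∑ b : Fin k → Fin p with Function.Injective b, ∑ a ∈ range q,
        (∏ i, ‖u (b i)‖) ^ 2 * ‖g a‖ ^ (2 * m) := by
      refine le_trans ?_ (Finset.single_le_sum
        (f := fun b : Fin k → Fin p => ∑ a ∈ range q, (∏ i, ‖u (b i)‖) ^ 2 * ‖g a‖ ^ (2 * m))
        (fun _ _ => by positivity) (show b ∈ _ by simpa using hb))
      exact Finset.single_le_sum
        (f := fun a => (∏ i, ‖u (b i)‖) ^ 2 * ‖g a‖ ^ (2 * m)) (fun _ _ => by positivity) ha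
    calc ‖f‖ ^ (2 * (k + m)) = (2 * p : ℝ) ^ (2 * k) * (q : ℝ) ^ (2 * m) *
          (((‖f‖ / (2 * p)) ^ k) ^ 2 * (‖f‖ / q) ^ (2 * m)) := by
          rw [← pow_mul, div_pow, div_pow, mul_comm k 2, mul_add, pow_add]
          field_simp
      _ ≤ _ := by
          refine mul_le_mul_of_nonneg_left (le_trans ?_ h2) (by positivity)
          gcongr
  · refine le_trans ?_ (le_add_of_nonneg_left (by positivity))
    push Not at hcard
    obtain ⟨b₀, hb₀, hmax⟩ := Finset.exists_max_image (range p) (fun b => ‖u b‖)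
      (by simpa using hp.ne')
    have h1 : ‖f‖ ≤ k * ‖u b₀‖ + ‖f‖ / 2 := by
      calc ‖f‖ ≤ ∑ b ∈ range p, ‖u b‖ := by rw [hu]; exact norm_sum_le _ _
        _ = ∑ b ∈ large, ‖u b‖ + ∑ b ∈ range p with ¬ ‖f‖ / (2 * p) ≤ ‖u b‖, ‖u b‖ :=
          (Finset.sum_filter_add_sum_filter_not _ _ _).symm
        _ ≤ ∑ b ∈ large, ‖u b₀‖ +
            ∑ b ∈ range p with ¬ ‖f‖ / (2 * p) ≤ ‖u b‖, ‖f‖ / (2 * p) := by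
          refine add_le_add (Finset.sum_le_sum fun b hb => hmax b ?_)
            (Finset.sum_le_sum fun b hb => ?_)
          · simp only [large, mem_filter] at hb; exact hb.1
          · simp only [mem_filter, not_le] at hb; exact hb.2.le
        _ ≤ k * ‖u b₀‖ + p * (‖f‖ / (2 * p)) := by
          rw [Finset.sum_const, Finset.sum_const, nsmul_eq_mul, nsmul_eq_mul]
          have h3 : (large.card : ℝ) ≤ k := by exact_mod_cast hcard.le
          have h4 : ((#{b ∈ range p | ¬ ‖f‖ / (2 * p) ≤ ‖u b‖} : ℕ) : ℝ) ≤ p := by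
            have := Finset.card_filter_le (range p) (fun b => ¬ ‖f‖ / (2 * p) ≤ ‖u b‖)
            rw [card_range] at this
            exact_mod_cast this
          gcongr
        _ = _ := by field_simp
    have h2 : ‖f‖ ≤ (2 * k) * ‖u b₀‖ := by linarith
    calc ‖f‖ ^ (2 * (k + m)) ≤ ((2 * k) * ‖u b₀‖) ^ (2 * (k + m)) := by gcongr
      _ = (2 * k : ℝ) ^ (2 * (k + m)) * ‖u b₀‖ ^ (2 * (k + m)) := mul_pow _ _ _
      _ ≤ _ := by
        gcongr
        exact Finset.single_le_sum (f := fun b => ‖u b‖ ^ (2 * (k + m)))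
          (fun _ _ => by positivity) hb₀

/-- The residue class `b` modulo `D` in `[0, N)`. -/
noncomputable def residueClass (D N b : ℕ) : Finset ℤ := {x ∈ Finset.Ico (0 : ℤ) N | x % D = b}

theorem residueClass_subset (D N b : ℕ) (hD : 0 < D) :
    residueClass D (D * N) b ⊆ (Finset.Ico (0 : ℤ) N).image fun y => (D : ℤ) * y + b := by
  intro x hx
  simp only [residueClass, mem_filter, mem_Ico, mem_image] at hx ⊢
  have hD' : (0 : ℤ) < D := by exact_mod_cast hD
  refine ⟨x / D, ⟨Int.ediv_nonneg hx.1.1 hD'.le, ?_⟩, ?_⟩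
  · apply Int.ediv_lt_of_lt_mul hD'
    rw [mul_comm]; exact_mod_cast hx.1.2
  · rw [← hx.2]; exact Int.mul_ediv_add_emod x D

theorem vinogradovCount_mono (k m : ℕ) {s t : Finset ℤ} (h : s ⊆ t) :
    vinogradovCount k m s ≤ vinogradovCount k m t := by
  refine Finset.card_le_card (Finset.filter_subset_filter _ (Finset.product_subset_product ?_ ?_))
    <;> exact Fintype.piFinset_subset _ _ fun _ => h

theorem vinogradovCount_residueClass_le (k m D N b : ℕ) (hD : 0 < D) :
    vinogradovCount k m (residueClass D (D * N) b) ≤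
      vinogradovCount k m (Finset.Ico (0 : ℤ) N) :=
  (vinogradovCount_mono k m (residueClass_subset D N b hD)).trans
    (vinogradovCount_image_le k m _ _ _ (by exact_mod_cast hD.ne'))

theorem card_residueClass_le (D N b : ℕ) (hD : 0 < D) :
    (residueClass D (D * N) b).card ≤ N := by
  refine (Finset.card_le_card (residueClass_subset D N b hD)).trans (Finset.card_image_le.trans ?_)
  simp

theorem momentSum_residueClass {k Q : ℕ} (D N : ℕ) (hD : 0 < D)
    (ψ : AddChar (Fin (k + 1) → ZMod Q) ℂ) :
    momentSum k Q (Finset.Ico (0 : ℤ) N) ψ =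
      ∑ b ∈ range D, momentSum k Q (residueClass D N b) ψ := by
  have hD' : (0 : ℤ) < D := by exact_mod_cast hD
  unfold momentSum
  rw [← Finset.sum_fiberwise_of_maps_to (s := Finset.Ico (0 : ℤ) N) (t := range D)
    (g := fun x => (x % D).toNat)]
  · refine Finset.sum_congr rfl fun b _ => Finset.sum_congr ?_ fun _ _ => rfl
    ext x
    simp only [residueClass, mem_filter]
    have := Int.emod_nonneg x hD'.ne'
    constructor <;> rintro ⟨h1, h2⟩ <;> refine ⟨h1, ?_⟩ <;> omega
  · intro x _
    have := Int.emod_nonneg x hD'.ne'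
    have := Int.emod_lt_of_pos x hD'
    simp only [mem_range]
    omega

theorem dvd_psum_sub {k m : ℕ} {P a : ℤ} {x x' : Fin k → ℤ} {z z' : Fin m → ℤ}
    (h : ∀ r ≤ k, ∑ i, x i ^ r + ∑ i, z i ^ r = ∑ i, x' i ^ r + ∑ i, z' i ^ r)
    (hz : ∀ i, P ∣ z i - a) (hz' : ∀ i, P ∣ z' i - a) (r : ℕ) (hr : r ≤ k) :
    P ^ r ∣ ∑ i, (x i - a) ^ r - ∑ i, (x' i - a) ^ r := by
  have h1 := psum_translate (x := Sum.elim x z) (y := Sum.elim x' z') (k := k)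
    (by simpa [Fintype.sum_sum_type] using h) (-a) r hr
  simp only [Fintype.sum_sum_type, Sum.elim_inl, Sum.elim_inr, ← sub_eq_add_neg] at h1
  have h2 : ∑ i, (x i - a) ^ r - ∑ i, (x' i - a) ^ r =
      ∑ i, (z' i - a) ^ r - ∑ i, (z i - a) ^ r := by linarith
  rw [h2]
  exact dvd_sub (Finset.dvd_sum fun i _ => pow_dvd_pow_of_dvd (hz' i) r)
    (Finset.dvd_sum fun i _ => pow_dvd_pow_of_dvd (hz i) r)

theorem sum_wellspaced_le {p k m M e Q : ℕ} [NeZero Q] (hp : p.Prime) (hkp : k < p)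
    (hM : 1 ≤ M) (heM : e ≤ M) (hMe : M ≤ e * k)
    (hQ : (k + m) * (p ^ M) ^ k < Q) (b : Fin k → Fin p) (hb : Function.Injective b) (a : ℕ) :
    ∑ ψ : AddChar (Fin (k + 1) → ZMod Q) ℂ,
      (∏ i, ‖momentSum k Q (residueClass p (p ^ M) (b i)) ψ‖) ^ 2 *
        ‖momentSum k Q (residueClass (p ^ e) (p ^ M) a) ψ‖ ^ (2 * m) ≤
      (Fintype.card (Fin (k + 1) → ZMod Q) : ℝ) *
        (((p ^ (M - 1)) ^ k * p ^ (e * (k * (k - 1) / 2))) *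
          vinogradovCount k m (Finset.Ico (0 : ℤ) (p ^ (M - e) : ℕ)) : ℕ) := by
  classical
  let A := Fintype.piFinset fun i => residueClass p (p ^ M) (b i)
  let B := Fintype.piFinset fun _ : Fin m => residueClass (p ^ e) (p ^ M) a
  let σ : (Fin k → ℤ) → (Fin (k + 1) → ZMod Q) := fun x => ∑ i, momentVec k Q (x i)
  let ρ : (Fin m → ℤ) → (Fin (k + 1) → ZMod Q) := fun x => ∑ i, momentVec k Q (x i)
  have hmul : ∀ ψ : AddChar (Fin (k + 1) → ZMod Q) ℂ,
      (∏ i, ‖momentSum k Q (residueClass p (p ^ M) (b i)) ψ‖) ^ 2 *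
        ‖momentSum k Q (residueClass (p ^ e) (p ^ M) a) ψ‖ ^ (2 * m) =
      ‖∑ w ∈ A ×ˢ B, ψ (σ w.1 + ρ w.2)‖ ^ 2 := by
    intro ψ
    have h1 := momentSum_prod (fun i => residueClass p (p ^ M) (b i)) ψ
    have h2 := momentSum_prod (fun _ : Fin m => residueClass (p ^ e) (p ^ M) a) ψ
    have h3 : ∑ w ∈ A ×ˢ B, ψ (σ w.1 + ρ w.2) = (∑ x ∈ A, ψ (σ x)) * ∑ z ∈ B, ψ (ρ z) := by
      rw [Finset.sum_mul_sum, Finset.sum_product]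
      simp only [AddChar.map_add_eq_mul]
    rw [h3, ← h1, ← h2, norm_mul, mul_pow, norm_prod, Finset.prod_const, norm_pow, ← pow_mul,
      card_univ, Fintype.card_fin, mul_comm 2 m]
  rw [Finset.sum_congr rfl fun ψ _ => hmul ψ, sum_addChar_normSq]
  refine mul_le_mul_of_nonneg_left ?_ (by positivity)
  have hp0 : 0 < p := hp.pos
  have hpM : p ^ M = p * p ^ (M - 1) := by rw [← pow_succ']; congr 1; omega
  have hpe : p ^ M = p ^ e * p ^ (M - e) := by rw [← pow_add]; congr 1; omega
  have hIco : ∀ D c x, x ∈ residueClass D (p ^ M) c → x ∈ Finset.Ico (0 : ℤ) (p ^ M : ℕ) :=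
    fun D c x hx => (mem_filter.1 hx).1
  have hB : #{q ∈ B ×ˢ B | ρ q.1 = ρ q.2} ≤
      vinogradovCount k m (Finset.Ico (0 : ℤ) (p ^ (M - e) : ℕ)) := by
    refine le_trans ?_ (vinogradovCount_residueClass_le k m (p ^ e) (p ^ (M - e)) a (by positivity))
    rw [← hpe]
    refine le_of_eq ?_
    unfold vinogradovCount
    congr 1
    refine Finset.filter_congr fun q hq => ?_
    simp only [mem_product, Fintype.mem_piFinset, B] at hq
    exact sum_momentVec_eq_iff (Y := p ^ M) (by positivity)
      (lt_of_le_of_lt (Nat.mul_le_mul_right _ (by simp)) hQ) _ _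
      (fun i => hIco _ _ _ (hq.1 i)) (fun i => hIco _ _ _ (hq.2 i))
  let good : Finset ((Fin k → ℤ) × (Fin k → ℤ)) := {q ∈ A ×ˢ A | ∀ r ≤ k,
    (p : ℤ) ^ (e * r) ∣ ∑ i, (q.1 i - a) ^ r - ∑ i, (q.2 i - a) ^ r}
  have hgood : good.card ≤ (p ^ (M - 1)) ^ k * p ^ (e * (k * (k - 1) / 2)) := by
    have hA : A.card ≤ (p ^ (M - 1)) ^ k := by
      simp only [A, Fintype.card_piFinset]
      refine (Finset.prod_le_prod' fun i _ => ?_).trans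
        (le_of_eq (by rw [Finset.prod_const, card_univ, Fintype.card_fin]))
      rw [hpM]
      exact card_residueClass_le _ _ _ hp0
    refine (Finset.card_le_mul_card_image_of_maps_to (f := Prod.snd) (t := A)
      (s := good) ?_ (p ^ (e * (k * (k - 1) / 2))) ?_).trans ?_
    · intro q hq
      simp only [good, mem_filter, mem_product] at hq
      exact hq.1.2
    · intro x' _
      rw [← Finset.card_image_of_injOn (f := Prod.fst)
        (s := {q ∈ good | q.2 = x'})]
      · refine card_linnik hp hkp hMe (fun i => ((b i : ℕ) : ℤ)) ?_ a
          (fun r => ∑ i, (x' i - a) ^ r) _ ?_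
        · intro i j hij hd
          apply hij
          apply hb
          apply Fin.ext
          have h1 := (b i).2
          have h2 := (b j).2
          have h3 := Int.eq_zero_of_abs_lt_dvd hd (by rw [abs_lt]; constructor <;> omega)
          omega
        · intro x hx
          simp only [mem_image, mem_filter, good, mem_product, A, Fintype.mem_piFinset] at hx
          obtain ⟨q, ⟨⟨⟨hq1, -⟩, hq3⟩, rfl⟩, rfl⟩ := hx
          refine ⟨fun i => ?_, hq3⟩
          have := hq1 i
          simp only [residueClass, mem_filter, mem_Ico] at this
          refine ⟨this.1.1, by exact_mod_cast this.1.2, ?_⟩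
          rw [← this.2]
          exact Int.dvd_self_sub_emod
      · rintro ⟨x, y⟩ hq ⟨x2, y2⟩ hq2 h
        simp only [coe_filter, Set.mem_ofPred_eq] at hq hq2 h
        rw [h, hq.2, hq2.2]
    · rw [mul_comm]
      exact Nat.mul_le_mul_right _ hA
  have hcount : #{w ∈ (A ×ˢ B) ×ˢ (A ×ˢ B) | σ w.1.1 + ρ w.1.2 = σ w.2.1 + ρ w.2.2} ≤
      good.card * vinogradovCount k m (Finset.Ico (0 : ℤ) (p ^ (M - e) : ℕ)) := by
    rw [mul_comm]
    refine Finset.card_le_mul_card_image_of_maps_to (f := fun w => (w.1.1, w.2.1)) ?_ _ ?_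
    · rintro ⟨⟨x, z⟩, ⟨x', z'⟩⟩ hw
      simp only [mem_filter, mem_product] at hw
      obtain ⟨⟨⟨hx, hz⟩, ⟨hx', hz'⟩⟩, heq⟩ := hw
      simp only [good, mem_filter, mem_product]
      refine ⟨⟨hx, hx'⟩, fun r hr => ?_⟩
      simp only [A, B, Fintype.mem_piFinset] at hx hz hx' hz'
      rw [pow_mul]
      have hd : ∀ z : Fin m → ℤ, (∀ i, z i ∈ residueClass (p ^ e) (p ^ M) a) →
          ∀ i, ((p : ℤ) ^ e) ∣ z i - a := by
        intro z hz i
        have := hz i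
        simp only [residueClass, mem_filter, mem_Ico] at this
        rw [← this.2]
        push_cast
        exact Int.dvd_self_sub_emod
      refine dvd_psum_sub (z := z) (z' := z') ?_ (hd z hz) (hd z' hz') r hr
      have h1 := (sum_momentVec_eq_iff (ι := Fin k ⊕ Fin m) (k := k) (Q := Q) (Y := p ^ M)
        (by positivity) (by simpa using hQ) (Sum.elim x z) (Sum.elim x' z')
        (by rintro (i | i); exacts [hIco _ _ _ (hx i), hIco _ _ _ (hz i)])
        (by rintro (i | i); exacts [hIco _ _ _ (hx' i), hIco _ _ _ (hz' i)])).1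
        (by simpa [Fintype.sum_sum_type] using heq)
      simpa [Fintype.sum_sum_type] using h1
    · rintro ⟨x, x'⟩ _
      refine le_trans ?_ ((card_shifted_le B ρ (σ x' - σ x)).trans hB)
      refine Finset.card_le_card_of_injOn (fun w => (w.1.2, w.2.2)) ?_ ?_
      · rintro ⟨⟨y, z⟩, ⟨y', z'⟩⟩ hw
        simp only [coe_filter, mem_filter, mem_product, Set.mem_ofPred_eq, Prod.mk.injEq] at hw ⊢
        obtain ⟨⟨⟨⟨_, hz⟩, ⟨_, hz'⟩⟩, heq⟩, rfl, rfl⟩ := hw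
        refine ⟨⟨hz, hz'⟩, ?_⟩
        linear_combination (exp := 1) heq
      · rintro ⟨⟨y, z⟩, ⟨y', z'⟩⟩ hw ⟨⟨y2, z2⟩, ⟨y2', z2'⟩⟩ hw2 h
        simp only [coe_filter, mem_filter, mem_product, Set.mem_ofPred_eq, Prod.mk.injEq]
          at hw hw2 h ⊢
        obtain ⟨_, rfl, rfl⟩ := hw
        obtain ⟨_, rfl, rfl⟩ := hw2
        exact ⟨⟨rfl, h.1⟩, rfl, h.2⟩
  exact_mod_cast hcount.trans (Nat.mul_le_mul_right _ hgood)

theorem vinogradovCount_recursion {p k m M e : ℕ} (hp : p.Prime) (hkp : k < p)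
    (hM : 1 ≤ M) (heM : e ≤ M) (hMe : M ≤ e * k) :
    (vinogradovCount k (k + m) (Finset.Ico (0 : ℤ) (p ^ M : ℕ)) : ℝ) ≤
      (2 * p : ℝ) ^ (2 * k) * ((p : ℝ) ^ e) ^ (2 * m) * ((p : ℝ) ^ k * (p : ℝ) ^ e *
        (((p : ℝ) ^ (M - 1)) ^ k * (p : ℝ) ^ (e * (k * (k - 1) / 2)) *
          vinogradovCount k m (Finset.Ico (0 : ℤ) (p ^ (M - e) : ℕ)))) +
      (2 * k : ℝ) ^ (2 * (k + m)) *
        (p * vinogradovCount k (k + m) (Finset.Ico (0 : ℤ) (p ^ (M - 1) : ℕ))) := by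
  classical
  obtain ⟨Q, hQ⟩ : ∃ Q, (k + m) * (p ^ M) ^ k < Q := ⟨_, Nat.lt_succ_self _⟩
  have : NeZero Q := ⟨by omega⟩
  have hp0 : 0 < p := hp.pos
  have hpM : p ^ M = p * p ^ (M - 1) := by rw [← pow_succ']; congr 1; omega
  set G : ℝ := (Fintype.card (Fin (k + 1) → ZMod Q) : ℝ) with hG
  have hGpos : 0 < G := by rw [hG]; exact_mod_cast Fintype.card_pos
  have hpe0 : 0 < p ^ e := by positivity
  have hY : 0 < p ^ M := by positivity
  have hmain := Finset.sum_le_sum fun (ψ : AddChar (Fin (k + 1) → ZMod Q) ℂ)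
    (_ : ψ ∈ (univ : Finset (AddChar (Fin (k + 1) → ZMod Q) ℂ))) =>
    norm_pow_le_wellspaced (k := k) (m := m) hp0 hpe0
    (momentSum k Q (Finset.Ico (0 : ℤ) (p ^ M : ℕ)) ψ)
    (fun b => momentSum k Q (residueClass p (p ^ M) b) ψ)
    (fun a => momentSum k Q (residueClass (p ^ e) (p ^ M) a) ψ)
    (momentSum_residueClass p _ hp0 ψ) (momentSum_residueClass (p ^ e) _ hpe0 ψ)
  rw [sum_momentSum_pow hY hQ _ subset_rfl, Finset.sum_add_distrib, ← Finset.mul_sum,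
    ← Finset.mul_sum, ← hG, Nat.cast_pow p e] at hmain
  set W : ℝ := ((p : ℝ) ^ (M - 1)) ^ k * (p : ℝ) ^ (e * (k * (k - 1) / 2)) *
          vinogradovCount k m (Finset.Ico (0 : ℤ) (p ^ (M - e) : ℕ)) with hW
  have hW0 : 0 ≤ W := by positivity
  have h1 : ∑ ψ : AddChar (Fin (k + 1) → ZMod Q) ℂ,
      ∑ b : Fin k → Fin p with Function.Injective b, ∑ a ∈ range (p ^ e),
        (∏ i, ‖momentSum k Q (residueClass p (p ^ M) (b i)) ψ‖) ^ 2 *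
        ‖momentSum k Q (residueClass (p ^ e) (p ^ M) a) ψ‖ ^ (2 * m) ≤
      (p : ℝ) ^ k * (p : ℝ) ^ e * (G * W) := by
    rw [Finset.sum_comm]
    calc _ ≤ ∑ b : Fin k → Fin p with Function.Injective b, ∑ a ∈ range (p ^ e), G * W := by
          refine Finset.sum_le_sum fun b hb => ?_
          rw [Finset.sum_comm]
          refine Finset.sum_le_sum fun a _ => ?_
          refine (sum_wellspaced_le hp hkp hM heM hMe hQ b (by simpa using hb) a).trans ?_
          rw [hW]; push_cast; rfl
      _ ≤ ∑ b : Fin k → Fin p, ∑ a ∈ range (p ^ e), G * W :=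
          Finset.sum_le_sum_of_subset_of_nonneg (Finset.filter_subset _ _)
            fun _ _ _ => by positivity
      _ = _ := by simp; ring
  have h2 : ∑ ψ : AddChar (Fin (k + 1) → ZMod Q) ℂ, ∑ b ∈ range p,
      ‖momentSum k Q (residueClass p (p ^ M) b) ψ‖ ^ (2 * (k + m)) ≤
      G * (p * vinogradovCount k (k + m) (Finset.Ico (0 : ℤ) (p ^ (M - 1) : ℕ))) := by
    rw [Finset.sum_comm]
    calc _ ≤ ∑ b ∈ range p, G *
          vinogradovCount k (k + m) (Finset.Ico (0 : ℤ) (p ^ (M - 1) : ℕ)) := by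
          refine Finset.sum_le_sum fun b _ => ?_
          rw [sum_momentSum_pow hY hQ (residueClass p (p ^ M) b) (Finset.filter_subset _ _)]
          refine mul_le_mul_of_nonneg_left ?_ hGpos.le
          rw [hpM]
          exact_mod_cast vinogradovCount_residueClass_le k (k + m) p (p ^ (M - 1)) b hp0
      _ = _ := by simp; ring
  refine le_of_mul_le_mul_left (hmain.trans ?_) hGpos
  refine (add_le_add (mul_le_mul_of_nonneg_left h1 (by positivity))
    (mul_le_mul_of_nonneg_left h2 (by positivity))).trans (le_of_eq ?_)
  ring

theorem vinogradov_exponent_main {k e M l θ θ' : ℝ} (hk : 3 ≤ k) (hθ0 : 0 ≤ θ) (hθ1 : θ ≤ 1)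
    (hθθ : k * θ' = 1 + (k - 1) * θ) (he : k * e ≤ M + k) :
    3 * k + e * (2 * (k * l)) + (k + e + ((M - 1) * k + e * (k * (k - 1) / 2) +
      (2 * k * l * (M - e) - θ * (k * (k + 1) / 2 - 1) * (M - e) + 4 * k ^ 2 * l))) ≤
    2 * k * (l + 1) * M - θ' * (k * (k + 1) / 2 - 1) * M + 4 * k ^ 2 * (l + 1) - 1 := by
  have hk0 : 0 < k := by linarith
  have hD : 0 ≤ k * (k + 1) / 2 - 1 := by nlinarith
  set A := 1 + k * (k - 1) / 2 + θ * (k * (k + 1) / 2 - 1) with hA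
  have hA0 : 0 ≤ A := by
    have := mul_nonneg hθ0 hD
    nlinarith
  have hA1 : A ≤ 4 * k ^ 2 - 1 - 3 * k := by
    have : θ * (k * (k + 1) / 2 - 1) ≤ 1 * (k * (k + 1) / 2 - 1) :=
      mul_le_mul_of_nonneg_right hθ1 hD
    nlinarith
  have h1 : 0 ≤ (M + k - k * e) * A := mul_nonneg (by linarith) hA0
  have h2 : 0 ≤ k * (4 * k ^ 2 - 1 - 3 * k - A) := mul_nonneg hk0.le (by linarith)
  refine le_of_mul_le_mul_left ?_ hk0
  rw [← sub_nonneg]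
  refine (add_nonneg h1 h2).trans (le_of_eq ?_)
  rw [hA]
  linear_combination ((k * (k + 1) / 2 - 1) * M) * hθθ

theorem vinogradov_exponent_ill {k N l θ' D : ℝ} (hk : 3 ≤ k) (hl : 0 ≤ l)
    (h1 : θ' * D ≤ (l + 1) * ((k + 1) / 2)) :
    k * (l + 1) / 2 + (1 + (2 * k * (l + 1) * N - θ' * D * N + 4 * k ^ 2 * (l + 1))) ≤
      2 * k * (l + 1) * (N + 1) - θ' * D * (N + 1) + 4 * k ^ 2 * (l + 1) - 1 := by
  nlinarith

/-- The Vinogradov mean value bound. -/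
theorem vinogradovCount_bound {p k : ℕ} (hp : p.Prime) (hk : 3 ≤ k) (hkp : (2 * k) ^ 4 ≤ p)
    (l M : ℕ) :
    (vinogradovCount k (k * l) (Finset.Ico (0 : ℤ) (p ^ M : ℕ)) : ℝ) ≤
      (p : ℝ) ^ (2 * k * l * M - (1 - (1 - 1 / (k : ℝ)) ^ l) * (k * (k + 1) / 2 - 1) * M +
        4 * k ^ 2 * l : ℝ) := by
  have hk' : (3 : ℝ) ≤ k := by exact_mod_cast hk
  have hk0 : (0 : ℝ) < k := by linarith
  have hkp' : (2 * k : ℝ) ^ 4 ≤ p := by exact_mod_cast hkp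
  have hp4 : (4 : ℝ) ≤ p := by
    refine le_trans ?_ hkp'
    have : (6 : ℝ) ^ 4 ≤ (2 * k : ℝ) ^ 4 := by gcongr; linarith
    linarith
  have hp0 : (0 : ℝ) < p := by linarith
  have hp1 : (1 : ℝ) ≤ p := by linarith
  have hkp1 : k < p := by
    have : k ≤ (2 * k) ^ 4 := by nlinarith [Nat.one_le_pow 3 (2 * k) (by omega)]
    have h2 : k ≠ (2 * k) ^ 4 := by
      intro h
      nlinarith [Nat.one_le_pow 3 (2 * k) (by omega)]
    omega
  set D : ℝ := k * (k + 1) / 2 - 1 with hD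
  induction l generalizing M with
  | zero => simp [vinogradovCount_zero]
  | succ l ihl =>
    set θ : ℝ := 1 - (1 - 1 / (k : ℝ)) ^ l with hθ
    set θ' : ℝ := 1 - (1 - 1 / (k : ℝ)) ^ (l + 1) with hθ'
    have hθθ : k * θ' = 1 + (k - 1) * θ := by
      rw [hθ, hθ', pow_succ]; field_simp; ring
    have hq0 : 0 ≤ 1 - 1 / (k : ℝ) := by
      rw [sub_nonneg, div_le_one hk0]; linarith
    have hq1 : 1 - 1 / (k : ℝ) ≤ 1 := by
      have : 0 ≤ 1 / (k : ℝ) := by positivity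
      linarith
    have hθ1 : θ ≤ 1 := by rw [hθ]; have := pow_nonneg hq0 l; linarith
    have hθ'k : k * θ' ≤ l + 1 := by
      have := one_add_mul_le_pow (a := -(1 / (k : ℝ))) (by linarith) (l + 1)
      rw [hθ', sub_eq_add_neg 1 (1 / (k : ℝ))]
      have h2 : (k : ℝ) * (1 - (1 + ((l + 1 : ℕ) : ℝ) * -(1 / (k : ℝ)))) = l + 1 := by
        push_cast; field_simp; ring
      nlinarith
    have hD0 : 0 ≤ D := by rw [hD]; nlinarith
    induction M with
    | zero =>
      have h1 := vinogradovCount_le k (k * (l + 1)) (Finset.Ico (0 : ℤ) (p ^ 0 : ℕ))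
      simp only [pow_zero, Nat.cast_one, Int.card_Ico, sub_zero, Int.toNat_one, one_pow] at h1
      refine le_trans (by exact_mod_cast h1) (Real.one_le_rpow hp1 ?_)
      push_cast
      simp only [mul_zero, sub_zero, zero_add]
      positivity
    | succ N ihN =>
      obtain ⟨M, hMN⟩ : ∃ M, M = N + 1 := ⟨_, rfl⟩
      let e := (M + k - 1) / k
      have he1 : k * e ≤ M + k - 1 := Nat.mul_div_le _ _
      have he2 : M ≤ e * k := by
        have := Nat.lt_div_mul_add (a := M + k - 1) (b := k) (by omega)
        simp only [e]; omega
      have heM : e ≤ M := by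
        by_contra h
        push Not at h
        have h4 : k * (M + 1) ≤ k * e := Nat.mul_le_mul_left k h
        have h5 : k * (M + 1) = (k - 1) * M + M + k := by
          obtain ⟨k', rfl⟩ : ∃ k', k = k' + 1 := ⟨k - 1, by omega⟩
          simp; ring
        omega
      have he1' : (k : ℝ) * e ≤ M + k := by
        have : k * e ≤ M + k := by omega
        exact_mod_cast this
      have hrec := vinogradovCount_recursion (m := k * l) hp hkp1 (show 1 ≤ M by omega) heM he2
      have hml : k * (l + 1) = k + k * l := by ring
      rw [← hml] at hrec
      rw [← hMN]
      have hM1 : M - 1 = N := by omega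
      refine hrec.trans ?_
      rw [hM1]
      have hMr : (M : ℝ) = N + 1 := by rw [hMN]; push_cast; ring
      have hkk : (((k * (k - 1) / 2 : ℕ) : ℝ)) = k * (k - 1) / 2 := by
        rw [Nat.cast_div (Nat.even_mul_pred_self k).two_dvd (by norm_num), Nat.cast_mul,
          Nat.cast_sub (by omega)]
        push_cast; ring
      set E : ℝ := 2 * k * (l + 1 : ℕ) * M - θ' * D * M + 4 * k ^ 2 * (l + 1 : ℕ) with hE
      have half : (p : ℝ) ^ (E - 1) ≤ (p : ℝ) ^ E / 2 := by
        rw [Real.rpow_sub hp0, Real.rpow_one]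
        gcongr; linarith
      have t1 : (2 * p : ℝ) ^ (2 * k) * ((p : ℝ) ^ e) ^ (2 * (k * l)) * ((p : ℝ) ^ k * (p : ℝ) ^ e *
          (((p : ℝ) ^ N) ^ k * (p : ℝ) ^ (e * (k * (k - 1) / 2)) *
          vinogradovCount k (k * l) (Finset.Ico (0 : ℤ) (p ^ (M - e) : ℕ)))) ≤ (p : ℝ) ^ E / 2 := by
        refine le_trans ?_ half
        have hi := ihl (M - e)
        have h2p : (2 * p : ℝ) ^ (2 * k) ≤ (p : ℝ) ^ (3 * k) := by
          rw [mul_pow, pow_mul 2 2 k]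
          calc ((2 : ℝ) ^ 2) ^ k * (p : ℝ) ^ (2 * k) ≤ (p : ℝ) ^ k * (p : ℝ) ^ (2 * k) := by
                gcongr; linarith
            _ = _ := by rw [← pow_add]; congr 1; ring
        calc _ ≤ (p : ℝ) ^ (3 * k) * ((p : ℝ) ^ e) ^ (2 * (k * l)) * ((p : ℝ) ^ k * (p : ℝ) ^ e *
          (((p : ℝ) ^ N) ^ k * (p : ℝ) ^ (e * (k * (k - 1) / 2)) *
            (p : ℝ) ^ (2 * k * l * (M - e : ℕ) - θ * D * (M - e : ℕ) + 4 * k ^ 2 * l : ℝ))) := by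
              gcongr
          _ = (p : ℝ) ^ ((3 * k + e * (2 * (k * l)) + (k + e + (N * k + e * (k * (k - 1) / 2) +
            (2 * k * l * (M - e) - θ * D * (M - e) + 4 * k ^ 2 * l))) : ℝ)) := by
              rw [← pow_mul, ← pow_mul, Nat.cast_sub heM, ← hkk]
              simp only [Real.rpow_add hp0, ← Real.rpow_natCast]
              push_cast
              rfl
          _ ≤ _ := by
              apply Real.rpow_le_rpow_of_exponent_le hp1
              rw [hE]
              push_cast
              have hNr : (N : ℝ) = M - 1 := by linarith
              rw [hNr]
              have h0 : 0 ≤ θ := by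
                rw [hθ]; have := pow_le_one₀ (n := l) hq0 hq1; linarith
              exact vinogradov_exponent_main hk' h0 hθ1 hθθ he1'
      have t2 : (2 * k : ℝ) ^ (2 * (k * (l + 1))) *
          (p * vinogradovCount k (k * (l + 1)) (Finset.Ico (0 : ℤ) (p ^ N : ℕ))) ≤
          (p : ℝ) ^ E / 2 := by
        refine le_trans ?_ half
        have h2k : (2 * k : ℝ) ^ (2 * (k * (l + 1))) ≤ (p : ℝ) ^ ((k * (l + 1) / 2 : ℝ)) := by
          have h4 : (2 * k : ℝ) ≤ (p : ℝ) ^ ((1 : ℝ) / 4) := by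
            rw [← Real.rpow_natCast] at hkp'
            calc (2 * k : ℝ) = ((2 * k : ℝ) ^ ((4 : ℕ) : ℝ)) ^ ((1 : ℝ) / 4) := by
                  rw [← Real.rpow_mul (by positivity)]; norm_num
              _ ≤ _ := by gcongr
          calc (2 * k : ℝ) ^ (2 * (k * (l + 1))) ≤ ((p : ℝ) ^ ((1 : ℝ) / 4)) ^ (2 * (k * (l + 1))) := by
                gcongr
            _ = _ := by
              rw [← Real.rpow_natCast, ← Real.rpow_mul hp0.le]
              congr 1; push_cast; ring
        calc _ ≤ (p : ℝ) ^ ((k * (l + 1) / 2 : ℝ)) * (p * (p : ℝ) ^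
              (2 * k * (l + 1 : ℕ) * N - θ' * D * N + 4 * k ^ 2 * (l + 1 : ℕ) : ℝ)) := by
              gcongr
          _ = (p : ℝ) ^ (k * (l + 1) / 2 + (1 +
              (2 * k * (l + 1 : ℕ) * N - θ' * D * N + 4 * k ^ 2 * (l + 1 : ℕ))) : ℝ) := by
              rw [Real.rpow_add hp0 (k * (l + 1) / 2 : ℝ), Real.rpow_add hp0 1, Real.rpow_one]
          _ ≤ _ := by
              apply Real.rpow_le_rpow_of_exponent_le hp1
              rw [hE, hMr]
              push_cast
              have hl : (0 : ℝ) ≤ l := by positivity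
              have h1 : θ' * D ≤ (l + 1) * ((k + 1) / 2) := by
                refine le_of_mul_le_mul_left ?_ hk0
                calc k * (θ' * D) = (k * θ') * D := by ring
                  _ ≤ (l + 1) * D := mul_le_mul_of_nonneg_right hθ'k hD0
                  _ ≤ (l + 1) * (k * ((k + 1) / 2)) := by
                    apply mul_le_mul_of_nonneg_left _ (by positivity)
                    rw [hD]; linarith
                  _ = _ := by ring
              exact vinogradov_exponent_ill hk' hl h1
      linarith

/-- `ee x = exp (2 π i x)`. -/
noncomputable def ee (x : ℝ) : ℂ := Complex.exp ((2 * Real.pi * x : ℝ) * Complex.I)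

theorem ee_add (x y : ℝ) : ee (x + y) = ee x * ee y := by
  unfold ee; rw [← Complex.exp_add]; congr 1; push_cast; ring

@[simp] theorem ee_zero : ee 0 = 1 := by simp [ee]

@[simp] theorem norm_ee (x : ℝ) : ‖ee x‖ = 1 := by
  unfold ee; exact Complex.norm_exp_ofReal_mul_I _

theorem ee_neg (x : ℝ) : ee (-x) = (starRingEnd ℂ) (ee x) := by
  unfold ee
  rw [← Complex.exp_conj]
  congr 1
  rw [map_mul, Complex.conj_ofReal, Complex.conj_I, mul_neg]
  push_cast; ring

theorem ee_sub (x y : ℝ) : ee (x - y) = ee x * (starRingEnd ℂ) (ee y) := by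
  rw [sub_eq_add_neg, ee_add, ee_neg]

theorem ee_sum {ι : Type*} (s : Finset ι) (f : ι → ℝ) : ee (∑ i ∈ s, f i) = ∏ i ∈ s, ee (f i) := by
  classical
  induction s using Finset.induction_on with
  | empty => simp
  | insert a s ha ih => rw [sum_insert ha, prod_insert ha, ee_add, ih]

@[simp] theorem ee_intCast (n : ℤ) : ee n = 1 := by
  unfold ee
  rw [Complex.exp_eq_one_iff]
  exact ⟨n, by push_cast; ring⟩

theorem ee_add_intCast (x : ℝ) (n : ℤ) : ee (x + n) = ee x := by rw [ee_add]; simp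

theorem norm_ee_sub_ee_le (x y : ℝ) : ‖ee x - ee y‖ ≤ 2 * Real.pi * |x - y| := by
  have h : ee x - ee y = ee y * (ee (x - y) - 1) := by
    rw [mul_sub, ← ee_add]; simp
  rw [h, norm_mul, norm_ee, one_mul]
  unfold ee
  rw [mul_comm _ Complex.I]
  refine (Real.norm_exp_I_mul_ofReal_sub_one_le).trans (le_of_eq ?_)
  rw [Real.norm_eq_abs, abs_mul, abs_of_pos (by positivity : 0 < 2 * Real.pi)]

section bilinear

/-- Pairs of `m`-tuples. -/
def tuplePairs (m : ℕ) (s : Finset ℤ) : Finset ((Fin m → ℤ) × (Fin m → ℤ)) :=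
  Fintype.piFinset (fun _ => s) ×ˢ Fintype.piFinset (fun _ => s)

/-- Differences of power sums. -/
def psumDiff (k : ℕ) {m : ℕ} (q : (Fin m → ℤ) × (Fin m → ℤ)) : Fin k → ℤ :=
  fun r => ∑ i, q.1 i ^ ((r : ℕ) + 1) - ∑ i, q.2 i ^ ((r : ℕ) + 1)

theorem card_tuplePairs (m : ℕ) (s : Finset ℤ) : (tuplePairs m s).card = s.card ^ (2 * m) := by
  simp [tuplePairs, Fintype.card_piFinset, two_mul, pow_add]

theorem normPow_sum_ee (m : ℕ) (s : Finset ℤ) (θ : ℤ → ℝ) :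
    ((‖∑ y ∈ s, ee (θ y)‖ ^ (2 * m) : ℝ) : ℂ) =
      ∑ q ∈ tuplePairs m s, ee (∑ i, θ (q.1 i) - ∑ i, θ (q.2 i)) := by
  have h : (∑ y ∈ s, ee (θ y)) ^ m =
      ∑ x ∈ Fintype.piFinset (fun _ : Fin m => s), ee (∑ i, θ (x i)) := by
    have := Finset.prod_univ_sum (fun _ : Fin m => s) (fun _ y => ee (θ y))
    simp only [prod_const, card_univ, Fintype.card_fin] at this
    rw [this]
    simp only [ee_sum]
  rw [mul_comm 2 m, pow_mul, ← norm_pow, h]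
  push_cast
  rw [← Complex.mul_conj', map_sum, Finset.sum_mul_sum, tuplePairs, Finset.sum_product]
  simp only [ee_sub]

theorem normPow_sum_ee_poly (k m : ℕ) (s : Finset ℤ) (β : Fin k → ℝ) :
    ((‖∑ y ∈ s, ee (∑ r, β r * (y : ℝ) ^ ((r : ℕ) + 1))‖ ^ (2 * m) : ℝ) : ℂ) =
      ∑ q ∈ tuplePairs m s, ee (∑ r, β r * (psumDiff k q r : ℤ)) := by
  rw [normPow_sum_ee m s (fun y => ∑ r, β r * (y : ℝ) ^ ((r : ℕ) + 1))]
  refine Finset.sum_congr rfl fun q _ => ?_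
  congr 1
  rw [Finset.sum_comm, Finset.sum_comm (s := univ) (t := univ)
    (f := fun i r => β r * ((q.2 i : ℤ) : ℝ) ^ ((r : ℕ) + 1)), ← Finset.sum_sub_distrib]
  refine Finset.sum_congr rfl fun r _ => ?_
  rw [← Finset.mul_sum, ← Finset.mul_sum, ← mul_sub]
  congr 1
  simp [psumDiff]

/-- The box containing all differences of power sums. -/
noncomputable def psumBox (k m Y : ℕ) : Finset (Fin k → ℤ) :=
  Fintype.piFinset fun r => Finset.Icc (-(m * Y ^ ((r : ℕ) + 1) : ℤ)) (m * Y ^ ((r : ℕ) + 1))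

theorem psumDiff_mem_box (k : ℕ) {m Y : ℕ} (q : (Fin m → ℤ) × (Fin m → ℤ))
    (hq : q ∈ tuplePairs m (Finset.Ico (0 : ℤ) Y)) : psumDiff k q ∈ psumBox k m Y := by
  have bound : ∀ z : Fin m → ℤ, (∀ i, z i ∈ Finset.Ico (0 : ℤ) Y) → ∀ r : ℕ,
      0 ≤ ∑ i, z i ^ r ∧ ∑ i, z i ^ r ≤ m * Y ^ r := by
    intro z hz r
    have hz' : ∀ i, 0 ≤ z i ∧ z i < Y := fun i => by simpa using hz i
    refine ⟨Finset.sum_nonneg fun i _ => pow_nonneg (hz' i).1 _, ?_⟩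
    calc ∑ i, z i ^ r ≤ ∑ _i : Fin m, (Y : ℤ) ^ r := Finset.sum_le_sum fun i _ =>
          pow_le_pow_left₀ (hz' i).1 (hz' i).2.le r
      _ = _ := by simp
  simp only [tuplePairs, mem_product, Fintype.mem_piFinset] at hq
  simp only [psumBox, Fintype.mem_piFinset, mem_Icc, psumDiff]
  intro r
  have h1 := bound _ hq.1 (r + 1)
  have h2 := bound _ hq.2 (r + 1)
  constructor <;> linarith

theorem sum_tuplePairs_le (k m Y : ℕ) (g : (Fin k → ℤ) → ℝ) (hg : ∀ v, 0 ≤ g v) :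
    ∑ q ∈ tuplePairs m (Finset.Ico (0 : ℤ) Y), g (psumDiff k q) ≤
      vinogradovCount k m (Finset.Ico (0 : ℤ) Y) * ∑ v ∈ psumBox k m Y, g v := by
  classical
  rw [← Finset.sum_fiberwise_of_maps_to (t := psumBox k m Y) (g := fun q => psumDiff k q)
    (fun q hq => psumDiff_mem_box k q hq), Finset.mul_sum]
  refine Finset.sum_le_sum fun v _ => ?_
  rw [Finset.sum_congr rfl (g := fun _ => g v)
    (fun q hq => by rw [(mem_filter.1 hq).2]), Finset.sum_const, nsmul_eq_mul]
  refine mul_le_mul_of_nonneg_right ?_ (hg v)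
  norm_cast
  let σ : (Fin m → ℤ) → (Fin k → ℤ) := fun x r => ∑ i, x i ^ ((r : ℕ) + 1)
  have h := card_shifted_le (Fintype.piFinset fun _ : Fin m => Finset.Ico (0 : ℤ) Y) σ v
  refine le_trans (le_of_eq ?_) (h.trans (le_of_eq ?_))
  · rw [tuplePairs]
    congr 1
    refine Finset.filter_congr fun q _ => ?_
    rw [← sub_eq_iff_eq_add']
    rfl
  · unfold vinogradovCount
    congr 1
    refine Finset.filter_congr fun q _ => ?_
    constructor
    · intro h r hr
      rcases Nat.eq_zero_or_pos r with rfl | hr0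
      · simp
      · have := congrFun h ⟨r - 1, by omega⟩
        simp only [σ] at this
        rwa [Nat.sub_add_cancel hr0] at this
    · intro h
      funext r
      exact h (r + 1) r.2

theorem bilinear_vinogradov (k m Y : ℕ) (hm : 0 < m) (φ : Fin k → ℝ) :
    ‖∑ z ∈ Finset.Ico (0 : ℤ) Y, ∑ y ∈ Finset.Ico (0 : ℤ) Y,
      ee (∑ r, φ r * (y : ℝ) ^ ((r : ℕ) + 1) * (z : ℝ) ^ ((r : ℕ) + 1))‖ ^ (4 * m ^ 2) ≤
    (Y : ℝ) ^ (8 * m ^ 2 - 4 * m) * (vinogradovCount k m (Finset.Ico (0 : ℤ) Y) : ℝ) ^ 2 *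
      ∏ r : Fin k, ∑ μ ∈ Finset.Icc (-(m * Y ^ ((r : ℕ) + 1) : ℤ)) (m * Y ^ ((r : ℕ) + 1)),
        ‖∑ l ∈ Finset.Icc (-(m * Y ^ ((r : ℕ) + 1) : ℤ)) (m * Y ^ ((r : ℕ) + 1)),
          ee (φ r * μ * l)‖ := by
  classical
  set s := Finset.Ico (0 : ℤ) Y with hs
  have hcard : (s.card : ℝ) = Y := by simp [hs]
  set J : ℝ := ((vinogradovCount k m s : ℕ) : ℝ) with hJ
  have hJ0 : 0 ≤ J := by positivity
  set f : (Fin k → ℝ) → ℝ := fun β => ‖∑ z ∈ s, ee (∑ r, β r * (z : ℝ) ^ ((r : ℕ) + 1))‖ with hf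
  obtain ⟨n, hn⟩ : ∃ n, 2 * m = n + 1 := ⟨2 * m - 1, by omega⟩
  have h1 : ‖∑ z ∈ s, ∑ y ∈ s,
      ee (∑ r, φ r * (y : ℝ) ^ ((r : ℕ) + 1) * (z : ℝ) ^ ((r : ℕ) + 1))‖ ^ (2 * m) ≤
      (Y : ℝ) ^ n * ∑ q ∈ tuplePairs m s, f (fun r => φ r * psumDiff k q r) := by
    calc _ ≤ (∑ z ∈ s, ‖∑ y ∈ s,
          ee (∑ r, φ r * (y : ℝ) ^ ((r : ℕ) + 1) * (z : ℝ) ^ ((r : ℕ) + 1))‖) ^ (2 * m) := by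
          gcongr; exact norm_sum_le _ _
      _ ≤ (Y : ℝ) ^ n * ∑ z ∈ s, ‖∑ y ∈ s,
          ee (∑ r, φ r * (y : ℝ) ^ ((r : ℕ) + 1) * (z : ℝ) ^ ((r : ℕ) + 1))‖ ^ (2 * m) := by
          rw [hn, ← hcard]
          exact pow_sum_le_card_mul_sum_pow (fun _ _ => norm_nonneg _) n
      _ ≤ _ := by
        refine mul_le_mul_of_nonneg_left ?_ (by positivity)
        have h2 : ((∑ z ∈ s, ‖∑ y ∈ s,
            ee (∑ r, φ r * (y : ℝ) ^ ((r : ℕ) + 1) * (z : ℝ) ^ ((r : ℕ) + 1))‖ ^ (2 * m) : ℝ) : ℂ) =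
            ∑ q ∈ tuplePairs m s, ∑ z ∈ s,
              ee (∑ r, (φ r * psumDiff k q r) * (z : ℝ) ^ ((r : ℕ) + 1)) := by
          rw [Finset.sum_comm, Complex.ofReal_sum]
          refine Finset.sum_congr rfl fun z _ => ?_
          have := normPow_sum_ee_poly k m s (fun r => φ r * (z : ℝ) ^ ((r : ℕ) + 1))
          simp only [mul_right_comm] at this ⊢
          exact this
        calc _ ≤ ‖((∑ z ∈ s, ‖∑ y ∈ s,
            ee (∑ r, φ r * (y : ℝ) ^ ((r : ℕ) + 1) * (z : ℝ) ^ ((r : ℕ) + 1))‖ ^ (2 * m) : ℝ) : ℂ)‖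
            := by rw [Complex.norm_real]; exact Real.le_norm_self _
          _ ≤ _ := by rw [h2]; exact norm_sum_le _ _
  have h3 : (∑ q ∈ tuplePairs m s, f (fun r => φ r * psumDiff k q r)) ^ (2 * m) ≤
      ((Y : ℝ) ^ (2 * m)) ^ n * (J * ∑ v ∈ psumBox k m Y, f (fun r => φ r * v r) ^ (2 * m)) := by
    calc _ ≤ ((Y : ℝ) ^ (2 * m)) ^ n *
          ∑ q ∈ tuplePairs m s, f (fun r => φ r * psumDiff k q r) ^ (2 * m) := by
          rw [hn, ← hn, ← hcard, ← Nat.cast_pow, ← card_tuplePairs, hn]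
          exact pow_sum_le_card_mul_sum_pow (fun _ _ => norm_nonneg _) n
      _ ≤ _ := by
        refine mul_le_mul_of_nonneg_left ?_ (by positivity)
        exact sum_tuplePairs_le k m Y (fun v => f (fun r => φ r * v r) ^ (2 * m))
          fun _ => by positivity
  have h4 : ∑ v ∈ psumBox k m Y, f (fun r => φ r * v r) ^ (2 * m) ≤
      J * ∏ r : Fin k, ∑ μ ∈ Finset.Icc (-(m * Y ^ ((r : ℕ) + 1) : ℤ)) (m * Y ^ ((r : ℕ) + 1)),
        ‖∑ l ∈ Finset.Icc (-(m * Y ^ ((r : ℕ) + 1) : ℤ)) (m * Y ^ ((r : ℕ) + 1)),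
          ee (φ r * μ * l)‖ := by
    have h5 : ((∑ v ∈ psumBox k m Y, f (fun r => φ r * v r) ^ (2 * m) : ℝ) : ℂ) =
        ∑ q ∈ tuplePairs m s, ∏ r : Fin k,
          ∑ l ∈ Finset.Icc (-(m * Y ^ ((r : ℕ) + 1) : ℤ)) (m * Y ^ ((r : ℕ) + 1)),
            ee (φ r * psumDiff k q r * l) := by
      rw [Complex.ofReal_sum]
      rw [Finset.sum_congr rfl fun v _ => normPow_sum_ee_poly k m s (fun r => φ r * v r),
        Finset.sum_comm]
      refine Finset.sum_congr rfl fun q _ => ?_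
      rw [Finset.prod_univ_sum]
      refine Finset.sum_congr rfl fun v _ => ?_
      rw [ee_sum]
      simp only [mul_right_comm]
    calc _ ≤ ‖((∑ v ∈ psumBox k m Y, f (fun r => φ r * v r) ^ (2 * m) : ℝ) : ℂ)‖ := by
          rw [Complex.norm_real]; exact Real.le_norm_self _
      _ ≤ ∑ q ∈ tuplePairs m s, ∏ r : Fin k,
          ‖∑ l ∈ Finset.Icc (-(m * Y ^ ((r : ℕ) + 1) : ℤ)) (m * Y ^ ((r : ℕ) + 1)),
            ee (φ r * psumDiff k q r * l)‖ := by
          rw [h5]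
          refine (norm_sum_le _ _).trans (le_of_eq ?_)
          simp only [norm_prod]
      _ ≤ J * ∑ v ∈ psumBox k m Y, ∏ r : Fin k,
          ‖∑ l ∈ Finset.Icc (-(m * Y ^ ((r : ℕ) + 1) : ℤ)) (m * Y ^ ((r : ℕ) + 1)),
            ee (φ r * v r * l)‖ :=
          sum_tuplePairs_le k m Y (fun v => ∏ r : Fin k,
          ‖∑ l ∈ Finset.Icc (-(m * Y ^ ((r : ℕ) + 1) : ℤ)) (m * Y ^ ((r : ℕ) + 1)),
            ee (φ r * v r * l)‖) fun _ => by positivity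
      _ = _ := by rw [psumBox, Finset.prod_univ_sum]
  have e1 : 4 * m ^ 2 = (2 * m) * (2 * m) := by ring
  rw [e1, pow_mul]
  refine (pow_le_pow_left₀ (by positivity) h1 _).trans ?_
  rw [mul_pow]
  refine (mul_le_mul_of_nonneg_left (h3.trans (mul_le_mul_of_nonneg_left
    (mul_le_mul_of_nonneg_left h4 hJ0) (by positivity))) (by positivity)).trans (le_of_eq ?_)
  rw [show 8 * m ^ 2 - 4 * m = n * (2 * m) + 2 * m * n by
    have : 8 * m ^ 2 = 2 * (2 * m) * (n + 1) := by rw [← hn]; ring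
    rw [this]
    have : 2 * (2 * m) * (n + 1) = n * (2 * m) + 2 * m * n + 4 * m := by ring
    omega]
  rw [pow_add, pow_mul, pow_mul]
  ring

end bilinear

theorem card_int_le_of_diam (s : Finset ℤ) {D : ℝ} (hD : 0 ≤ D)
    (h : ∀ a ∈ s, ∀ b ∈ s, (b : ℝ) - a ≤ D) : (s.card : ℝ) ≤ D + 1 := by
  rcases s.eq_empty_or_nonempty with rfl | hs
  · simp; linarith
  have hsub : s ⊆ Finset.Icc (s.min' hs) (s.min' hs + ⌊D⌋) := by
    intro b hb
    rw [mem_Icc]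
    refine ⟨s.min'_le b hb, ?_⟩
    have := Int.le_floor.2 (show (((b - s.min' hs : ℤ)) : ℝ) ≤ D by
      push_cast; exact h _ (s.min'_mem hs) _ hb)
    linarith
  have h1 := Finset.card_le_card hsub
  rw [Int.card_Icc] at h1
  have h0 := Int.floor_nonneg.2 hD
  have h2 : ((s.card : ℕ) : ℤ) ≤ ⌊D⌋ + 1 := by omega
  have h3 : (s.card : ℝ) ≤ ⌊D⌋ + 1 := by exact_mod_cast h2
  linarith [Int.floor_le D]

theorem norm_ee_sub_one_ge {t : ℝ} (ht : |t| ≤ 1 / 2) : 4 * |t| ≤ ‖ee t - 1‖ := by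
  unfold ee
  rw [mul_comm _ Complex.I, Complex.norm_exp_I_mul_ofReal_sub_one, norm_mul, Real.norm_eq_abs,
    Real.norm_eq_abs, abs_two]
  have h := Real.mul_abs_le_abs_sin (x := 2 * Real.pi * t / 2) (by
    rw [show 2 * Real.pi * t / 2 = Real.pi * t by ring, abs_mul, abs_of_pos Real.pi_pos]
    nlinarith [Real.pi_pos])
  rw [show 2 * Real.pi * t / 2 = Real.pi * t by ring] at h ⊢
  rw [abs_mul, abs_of_pos Real.pi_pos] at h
  have : 2 / Real.pi * (Real.pi * |t|) = 2 * |t| := by field_simp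
  linarith

theorem norm_sum_ee_Icc_le (H : ℕ) (θ : ℝ) :
    ‖∑ l ∈ Finset.Icc (-(H : ℤ)) H, ee (θ * l)‖ * |θ - round θ| ≤ 1 / 2 := by
  set t := θ - round θ with ht
  have h1 : ∀ l : ℤ, ee (θ * l) = ee (t * l) := by
    intro l
    rw [show θ * l = t * l + ((round θ * l : ℤ) : ℝ) by push_cast; rw [ht]; ring, ee_add_intCast]
  simp only [h1]
  have h2 : ∀ n : ℕ, (∑ l ∈ Finset.Icc (-(n : ℤ)) n, ee (t * l)) * (ee t - 1) =
      ee (t * (n + 1)) - ee (-(t * n)) := by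
    intro n
    induction n with
    | zero => simp
    | succ n ih =>
      have e : Finset.Icc (-((n + 1 : ℕ) : ℤ)) ((n + 1 : ℕ) : ℤ) =
          insert (-((n + 1 : ℕ) : ℤ)) (insert ((n + 1 : ℕ) : ℤ) (Finset.Icc (-(n : ℤ)) n)) := by
        ext x; simp only [mem_Icc, mem_insert]; omega
      rw [e, sum_insert, sum_insert, add_mul, add_mul, ih]
      · push_cast
        rw [mul_sub, mul_sub, ← ee_add, ← ee_add]
        ring_nf
      · simp
      · simp only [mem_insert, mem_Icc]; omega
  have h3 := norm_ee_sub_one_ge (t := t) (abs_sub_round θ)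
  have h4 : ‖∑ l ∈ Finset.Icc (-(H : ℤ)) H, ee (t * l)‖ * ‖ee t - 1‖ ≤ 2 := by
    rw [← norm_mul, h2]
    refine (norm_sub_le _ _).trans ?_
    simp; norm_num
  have h5 := mul_le_mul_of_nonneg_left h3
    (norm_nonneg (∑ l ∈ Finset.Icc (-(H : ℤ)) H, ee (t * l)))
  linarith

theorem norm_sum_ee_Icc_le_card (H : ℕ) (hH : 1 ≤ H) (θ : ℝ) :
    ‖∑ l ∈ Finset.Icc (-(H : ℤ)) H, ee (θ * l)‖ ≤ 3 * H := by
  refine (norm_sum_le _ _).trans ?_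
  simp only [norm_ee, sum_const, Int.card_Icc, nsmul_eq_mul, mul_one]
  have : ((H : ℤ) + 1 - -(H : ℤ)).toNat ≤ 3 * H := by omega
  exact_mod_cast this

theorem kernel_trivial (H : ℕ) (hH : 1 ≤ H) (φ : ℝ) :
    ∑ μ ∈ Finset.Icc (-(H : ℤ)) H, ‖∑ l ∈ Finset.Icc (-(H : ℤ)) H, ee (φ * μ * l)‖ ≤
      9 * (H : ℝ) ^ 2 := by
  refine (Finset.sum_le_sum fun (μ : ℤ) _ => norm_sum_ee_Icc_le_card H hH (φ * μ)).trans ?_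
  simp only [sum_const, Int.card_Icc, nsmul_eq_mul]
  have : ((H : ℤ) + 1 - -(H : ℤ)).toNat ≤ 3 * H := by omega
  have h : ((((H : ℤ) + 1 - -(H : ℤ)).toNat : ℕ) : ℝ) ≤ 3 * H := by exact_mod_cast this
  nlinarith

theorem card_near_integer (H : ℕ) {φ η : ℝ} (hφ : φ ≠ 0) (hη : 0 < η) :
    (((Finset.Icc (-(H : ℤ)) H).filter fun μ : ℤ => |φ * μ - round (φ * μ)| ≤ η).card : ℝ) ≤
      (2 * H * |φ| + 2) * (2 * η / |φ| + 1) := by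
  classical
  set s := (Finset.Icc (-(H : ℤ)) H).filter fun μ : ℤ => |φ * μ - round (φ * μ)| ≤ η with hs
  have hφ' := abs_pos.2 hφ
  have hmem : ∀ μ ∈ s, |(μ : ℝ)| ≤ H ∧ |φ * μ - round (φ * μ)| ≤ η := by
    intro μ hμ
    rw [hs, mem_filter, mem_Icc] at hμ
    refine ⟨?_, hμ.2⟩
    rw [abs_le]; exact_mod_cast hμ.1
  have h1 : ((s.image fun μ : ℤ => round (φ * (μ : ℝ))).card : ℝ) ≤ (2 * H * |φ| + 1) + 1 := by
    apply card_int_le_of_diam _ (by positivity)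
    intro a ha b hb
    obtain ⟨μ, hμ, rfl⟩ := mem_image.1 ha
    obtain ⟨ν, hν, rfl⟩ := mem_image.1 hb
    have hb1 : ∀ x : ℤ, |(x : ℝ)| ≤ H → |φ * x| ≤ |φ| * H := fun x hx => by
      rw [abs_mul]; exact mul_le_mul_of_nonneg_left hx hφ'.le
    have a1 := abs_le.1 (hb1 μ (hmem μ hμ).1)
    have a2 := abs_le.1 (hb1 ν (hmem ν hν).1)
    have a3 := abs_le.1 (abs_sub_round (φ * μ))
    have a4 := abs_le.1 (abs_sub_round (φ * ν))
    nlinarith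
  have h2 : s.card ≤ ⌊2 * η / |φ| + 1⌋₊ * (s.image fun μ : ℤ => round (φ * (μ : ℝ))).card := by
    refine Finset.card_le_mul_card_image s _ fun n _ => ?_
    apply Nat.le_floor
    apply card_int_le_of_diam _ (by positivity)
    intro a ha b hb
    rw [mem_filter] at ha hb
    have a1 := (hmem a ha.1).2
    have a2 := (hmem b hb.1).2
    rw [ha.2] at a1
    rw [hb.2] at a2
    have a3 : |φ| * |(b : ℝ) - a| ≤ 2 * η := by
      rw [← abs_mul, show φ * (b - a) = (φ * b - n) - (φ * a - n) by ring]
      exact (abs_sub _ _).trans (by linarith)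
    rw [le_div_iff₀ hφ']
    nlinarith [le_abs_self ((b : ℝ) - a)]
  have h3 : (s.card : ℝ) ≤ (⌊2 * η / |φ| + 1⌋₊ : ℝ) *
      ((s.image fun μ : ℤ => round (φ * (μ : ℝ))).card : ℝ) := by exact_mod_cast h2
  have h4 := Nat.floor_le (show 0 ≤ 2 * η / |φ| + 1 by positivity)
  calc (s.card : ℝ) ≤ _ := h3
    _ ≤ (2 * η / |φ| + 1) * (2 * H * |φ| + 2) := by
      refine mul_le_mul h4 (by linarith) (by positivity) (by positivity)
    _ = _ := by ring

theorem kernel_bound (H : ℕ) (hH : 1 ≤ H) {φ : ℝ} (hφ : φ ≠ 0) (hφ1 : |φ| ≤ 1) :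
    ∑ μ ∈ Finset.Icc (-(H : ℤ)) H, ‖∑ l ∈ Finset.Icc (-(H : ℤ)) H, ee (φ * μ * l)‖ ≤
      9 * (H : ℝ) ^ 2 * (4 * (√|φ| + 1 / (H * √|φ|))) := by
  classical
  set s := √|φ| with hs
  have hφ' := abs_pos.2 hφ
  have hs0 : 0 < s := Real.sqrt_pos.2 hφ'
  have hs1 : s ≤ 1 := by rw [hs, Real.sqrt_le_left (by norm_num)]; simpa using hφ1
  have hss : |φ| = s ^ 2 := (Real.sq_sqrt hφ'.le).symm
  have hH0 : (0 : ℝ) < H := by exact_mod_cast hH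
  have hH1 : (1 : ℝ) ≤ H := by exact_mod_cast hH
  have hc := card_near_integer H hφ hs0
  rw [← Finset.sum_filter_add_sum_filter_not _ (fun μ : ℤ => |φ * μ - round (φ * μ)| ≤ s)]
  have h1 : ∑ μ ∈ (Finset.Icc (-(H : ℤ)) H).filter (fun μ : ℤ => |φ * μ - round (φ * μ)| ≤ s),
      ‖∑ l ∈ Finset.Icc (-(H : ℤ)) H, ee (φ * μ * l)‖ ≤
      ((2 * H * |φ| + 2) * (2 * s / |φ| + 1)) * (3 * H) := by
    refine (Finset.sum_le_sum fun (μ : ℤ) _ => norm_sum_ee_Icc_le_card H hH (φ * μ)).trans ?_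
    rw [sum_const, nsmul_eq_mul]
    exact mul_le_mul_of_nonneg_right hc (by positivity)
  have h2 : ∑ μ ∈ (Finset.Icc (-(H : ℤ)) H).filter (fun μ : ℤ => ¬|φ * μ - round (φ * μ)| ≤ s),
      ‖∑ l ∈ Finset.Icc (-(H : ℤ)) H, ee (φ * μ * l)‖ ≤ (3 * H) * (1 / (2 * s)) := by
    calc _ ≤ ∑ μ ∈ (Finset.Icc (-(H : ℤ)) H).filter
          (fun μ : ℤ => ¬|φ * μ - round (φ * μ)| ≤ s), 1 / (2 * s) := by
          refine Finset.sum_le_sum fun μ hμ => ?_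
          have hμ' := not_le.1 (mem_filter.1 hμ).2
          have := norm_sum_ee_Icc_le H (φ * μ)
          rw [le_div_iff₀ (by positivity)]
          nlinarith [norm_nonneg (∑ l ∈ Finset.Icc (-(H : ℤ)) H, ee (φ * μ * l))]
      _ ≤ _ := by
        rw [sum_const, nsmul_eq_mul]
        refine mul_le_mul_of_nonneg_right ?_ (by positivity)
        have h3 := Finset.card_le_card (Finset.filter_subset
          (fun μ : ℤ => ¬|φ * μ - round (φ * μ)| ≤ s) (Finset.Icc (-(H : ℤ)) H))
        rw [Int.card_Icc] at h3
        have : ((H : ℤ) + 1 - -(H : ℤ)).toNat ≤ 3 * H := by omega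
        exact_mod_cast h3.trans this
  refine (add_le_add h1 h2).trans ?_
  rw [hss]
  have e1 : (2 * H * s ^ 2 + 2) * (2 * s / s ^ 2 + 1) * (3 * H) + 3 * H * (1 / (2 * s)) =
      3 * H * ((2 * H * s ^ 2 + 2) * (2 + s) + 1 / 2) / s := by field_simp
  have e2 : 9 * (H : ℝ) ^ 2 * (4 * (s + 1 / (H * s))) = 36 * H * (H * s ^ 2 + 1) / s := by
    field_simp; ring
  rw [e1, e2]
  refine div_le_div_of_nonneg_right ?_ hs0.le
  have : (2 * H * s ^ 2 + 2) * (2 + s) ≤ (2 * H * s ^ 2 + 2) * 3 := by gcongr; linarith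
  nlinarith [mul_pos hH0 (pow_pos hs0 2), mul_pos hH0 (mul_pos hH0 (pow_pos hs0 2))]

theorem prod_pow_succ_fin (Y : ℝ) (k : ℕ) :
    ∏ r : Fin k, (Y ^ ((r : ℕ) + 1)) ^ 2 = Y ^ (k * (k + 1)) := by
  induction k with
  | zero => simp
  | succ k ih =>
    rw [Fin.prod_univ_castSucc]
    simp only [Fin.val_castSucc, Fin.val_last]
    rw [ih, ← pow_mul, ← pow_add]
    congr 1; ring

/-- The bilinear form of Vinogradov's method, with the mean value theorem inserted: every index in
`G` contributes a factor `4 s`. -/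
theorem bilinear_saving {p k : ℕ} (hp : p.Prime) (hk : 3 ≤ k) (hkp : (2 * k) ^ 4 ≤ p) {l : ℕ}
    (hl : 1 ≤ l) (M : ℕ) (φ : Fin k → ℝ) (G : Finset (Fin k)) {s : ℝ}
    (hG : ∀ r ∈ G, φ r ≠ 0 ∧ |φ r| ≤ 1 ∧
      √|φ r| + 1 / (((k * l : ℕ) * ((p ^ M : ℕ) : ℝ) ^ ((r : ℕ) + 1)) * √|φ r|) ≤ s) :
    ‖∑ z ∈ Finset.Ico (0 : ℤ) (p ^ M : ℕ), ∑ y ∈ Finset.Ico (0 : ℤ) (p ^ M : ℕ),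
      ee (∑ r, φ r * (y : ℝ) ^ ((r : ℕ) + 1) * (z : ℝ) ^ ((r : ℕ) + 1))‖ ^ (4 * (k * l) ^ 2) ≤
    (9 * (k * l : ℝ) ^ 2) ^ k * (p : ℝ) ^ (8 * (k * l : ℝ) ^ 2 * M +
      (2 * (k : ℝ) ^ 2 * (1 - 1 / (k : ℝ)) ^ l + 2) * M + 8 * k ^ 2 * l) * (4 * s) ^ G.card := by
  classical
  set m := k * l with hm
  have hm1 : 1 ≤ m := Nat.one_le_iff_ne_zero.2 (by positivity)
  have hp0 : (0 : ℝ) < p := by exact_mod_cast hp.pos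
  have hp1 : (1 : ℝ) ≤ p := by exact_mod_cast hp.one_lt.le
  set Y := p ^ M with hY
  have hY1 : 1 ≤ Y := Nat.one_le_pow _ _ hp.pos
  have hYp : (Y : ℝ) = (p : ℝ) ^ M := by rw [hY]; push_cast; rfl
  have h1 := bilinear_vinogradov k m Y hm1 φ
  have h2 := vinogradovCount_bound hp hk hkp l M
  rw [← hm] at h2
  set J : ℝ := ((vinogradovCount k m (Finset.Ico (0:ℤ) (p ^ M : ℕ)) : ℕ) : ℝ) with hJ
  have hprod : ∏ r : Fin k, ∑ μ ∈ Finset.Icc (-(m * Y ^ ((r : ℕ) + 1) : ℤ)) (m * Y ^ ((r : ℕ) + 1)),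
        ‖∑ l ∈ Finset.Icc (-(m * Y ^ ((r : ℕ) + 1) : ℤ)) (m * Y ^ ((r : ℕ) + 1)),
          ee (φ r * μ * l)‖ ≤
      (9 * (m : ℝ) ^ 2) ^ k * (Y : ℝ) ^ (k * (k + 1)) * (4 * s) ^ G.card := by
    calc _ ≤ ∏ r : Fin k, (9 * (m : ℝ) ^ 2 * ((Y : ℝ) ^ ((r : ℕ) + 1)) ^ 2) *
          (if r ∈ G then 4 * s else 1) := by
          refine Finset.prod_le_prod (fun _ _ => by positivity) fun r _ => ?_
          have hH : 1 ≤ m * Y ^ ((r : ℕ) + 1) := Nat.one_le_iff_ne_zero.2 (by positivity)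
          have e : ((m * Y ^ ((r : ℕ) + 1) : ℕ) : ℤ) = (m : ℤ) * (Y : ℤ) ^ ((r : ℕ) + 1) := by
            push_cast; rfl
          have e' : 9 * (m : ℝ) ^ 2 * ((Y : ℝ) ^ ((r : ℕ) + 1)) ^ 2 =
              9 * ((m * Y ^ ((r : ℕ) + 1) : ℕ) : ℝ) ^ 2 := by push_cast; ring
          rw [← e, e']
          split_ifs with hr
          · obtain ⟨g1, g2, g3⟩ := hG r hr
            refine (kernel_bound _ hH g1 g2).trans ?_
            refine mul_le_mul_of_nonneg_left ?_ (by positivity)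
            refine mul_le_mul_of_nonneg_left ?_ (by norm_num)
            refine le_trans (le_of_eq ?_) g3
            push_cast; rfl
          · rw [mul_one]; exact kernel_trivial _ hH _
      _ = _ := by
        rw [Finset.prod_mul_distrib, Finset.prod_mul_distrib, prod_pow_succ_fin,
          Finset.prod_ite_mem, Finset.univ_inter]
        simp
  have hs : 0 ≤ (4 * s) ^ G.card := by
    rcases G.eq_empty_or_nonempty with rfl | ⟨r, hr⟩
    · simp
    · have := (hG r hr).2.2
      have h0 : 0 ≤ s := le_trans (by positivity) this
      positivity
  have hJ2 : J ^ 2 ≤ (p : ℝ) ^ (2 * (2 * k * l * M - (1-(1-1/(k:ℝ))^l)*(k*(k+1)/2-1)*M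
      + 4*k^2*l) : ℝ) := by
    calc J ^ 2 ≤ _ := pow_le_pow_left₀ (by positivity) h2 2
      _ = _ := by rw [← Real.rpow_natCast, ← Real.rpow_mul hp0.le]; congr 1; push_cast; ring
  refine h1.trans ?_
  calc _ ≤ (Y : ℝ) ^ (8 * m ^ 2 - 4 * m) *
        (p : ℝ) ^ (2 * (2 * k * l * M - (1-(1-1/(k:ℝ))^l)*(k*(k+1)/2-1)*M + 4*k^2*l) : ℝ) *
        ((9 * (m : ℝ) ^ 2) ^ k * (Y : ℝ) ^ (k * (k + 1)) * (4 * s) ^ G.card) := by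
        gcongr
    _ = (9 * (k * l : ℝ) ^ 2) ^ k * (p : ℝ) ^ (M * (8 * (k * l : ℝ) ^ 2 - 4 * (k * l)) +
        (2 * (2 * k * l * M - (1-(1-1/(k:ℝ))^l)*(k*(k+1)/2-1)*M + 4*k^2*l)) +
        M * (k * (k + 1)) : ℝ) * (4 * s) ^ G.card := by
        rw [hYp, ← pow_mul, ← pow_mul, Real.rpow_add hp0, Real.rpow_add hp0]
        have hle : 4 * m ≤ 8 * m ^ 2 := by nlinarith
        have e1 : (p : ℝ) ^ (M * (8 * (k * l : ℝ) ^ 2 - 4 * (k * l)) : ℝ) =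
            (p : ℝ) ^ (M * (8 * m ^ 2 - 4 * m)) := by
          rw [← Real.rpow_natCast (p : ℝ), hm]
          rw [hm] at hle
          congr 1
          push_cast [Nat.cast_sub hle]
          ring
        have e2 : (p : ℝ) ^ (M * (k * (k + 1)) : ℝ) = (p : ℝ) ^ (M * (k * (k + 1))) := by
          rw [← Real.rpow_natCast (p : ℝ)]
          congr 1
          push_cast
          rfl
        rw [e1, e2, hm]
        push_cast
        ring
    _ ≤ _ := by
        refine mul_le_mul_of_nonneg_right ?_ hs
        refine mul_le_mul_of_nonneg_left ?_ (by positivity)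
        apply Real.rpow_le_rpow_of_exponent_le hp1
        set q := (1 - 1 / (k : ℝ)) ^ l with hq
        have hk' : (3 : ℝ) ≤ k := by exact_mod_cast hk
        have hq0 : 0 ≤ q := by
          apply pow_nonneg
          rw [sub_nonneg, div_le_one (by linarith)]; linarith
        have hM0 : (0 : ℝ) ≤ M := by positivity
        have : 0 ≤ q * M * (k ^ 2 - k + 2) := by
          apply mul_nonneg (mul_nonneg hq0 hM0); nlinarith
        nlinarith

theorem multichoose_le_two_pow (j r : ℕ) : Nat.multichoose j r ≤ 2 ^ (j + r) := by
  rw [Nat.multichoose_eq]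
  exact (Nat.choose_le_two_pow _ _).trans (Nat.pow_le_pow_right (by norm_num) (by omega))

theorem one_le_multichoose (j r : ℕ) : 1 ≤ Nat.multichoose (j + 1) r := by
  rw [Nat.multichoose_eq]
  exact Nat.choose_pos (by omega)

theorem multichoose_le_succ (a r : ℕ) :
    Nat.multichoose (a + 1) r ≤ Nat.multichoose (a + 1) (r + 1) := by
  rw [Nat.multichoose_succ_succ]; omega

theorem multichoose_succ_le_mul (a r : ℕ) :
    Nat.multichoose (a + 2) r ≤ (r + 1) * Nat.multichoose (a + 1) (r + 1) := by
  induction r with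
  | zero => simp
  | succ r ih =>
    rw [Nat.multichoose_succ_succ]
    have := multichoose_le_succ a (r + 1)
    nlinarith

theorem multichoose_mono_right (a : ℕ) : Monotone (Nat.multichoose (a + 1)) :=
  monotone_nat_of_le_succ (multichoose_le_succ a)

theorem multichoose_gap {j r r' : ℕ} (hj : 2 ≤ j) (h : r < r') :
    Nat.multichoose j r + 1 ≤ Nat.multichoose j r' ∧
      Nat.multichoose j r ≤ (r + 1) * (Nat.multichoose j r' - Nat.multichoose j r) := by
  obtain ⟨a, rfl⟩ : ∃ a, j = a + 2 := ⟨j - 2, by omega⟩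
  have h1 := multichoose_mono_right (a + 1) (show r + 1 ≤ r' from h)
  have h2 : Nat.multichoose (a + 2) (r + 1) =
      Nat.multichoose (a + 1) (r + 1) + Nat.multichoose (a + 2) r := Nat.multichoose_succ_succ _ _
  have h3 := one_le_multichoose a (r + 1)
  have h4 := multichoose_succ_le_mul a r
  refine ⟨by simp only [add_assoc] at *; norm_num at *; omega, h4.trans ?_⟩
  apply Nat.mul_le_mul_left
  simp only [add_assoc] at *; norm_num at *; omega

/-- At most one of the combinations `p + q * multichoose j r` is much smaller than `|p| + |q|`. -/
theorem combination_lower_bound {j k r r' : ℕ} (hj : 2 ≤ j) (hr : r < r') (hk : r' ≤ k) (p q : ℝ)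
    (h : |p + q * Nat.multichoose j r| < (|p| + |q|) / (4 * (k + 2))) :
    (|p| + |q|) / (4 * (k + 2)) ≤ |p + q * Nat.multichoose j r'| := by
  by_contra hcon
  push Not at hcon
  set δ := (|p| + |q|) / (4 * (k + 2)) with hδ
  have hF : |p| + |q| = δ * (4 * (k + 2)) := by rw [hδ]; field_simp
  obtain ⟨g1, g2⟩ := multichoose_gap hj hr
  set A := Nat.multichoose j r
  set B := Nat.multichoose j r'
  have g1' : (A : ℝ) + 1 ≤ B := by exact_mod_cast g1
  have g2' : (A : ℝ) ≤ (r + 1) * (B - A) := by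
    have : ((B - A : ℕ) : ℝ) = B - A := Nat.cast_sub (by omega)
    rw [← this]; exact_mod_cast g2
  have d1 : |q| * (B - A) ≤ 2 * δ := by
    have : |q * ((B : ℝ) - A)| ≤ 2 * δ := by
      rw [show q * ((B : ℝ) - A) = (p + q * B) - (p + q * A) by ring]
      exact (abs_sub _ _).trans (by linarith)
    rwa [abs_mul, abs_of_nonneg (by linarith : (0 : ℝ) ≤ (B : ℝ) - A)] at this
  have hq := abs_nonneg q
  have d2 : |q| ≤ 2 * δ := by nlinarith
  have d3 : |q| * A ≤ (r + 1) * (2 * δ) := by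
    calc |q| * A ≤ |q| * ((r + 1) * (B - A)) := by gcongr
      _ = (r + 1) * (|q| * (B - A)) := by ring
      _ ≤ _ := by gcongr
  have d4 : |p| ≤ δ + |q| * A := by
    have : |p| ≤ |p + q * A| + |q * A| := by
      calc |p| = |(p + q * A) - q * A| := by ring_nf
        _ ≤ _ := abs_sub _ _
    rw [abs_mul, Nat.abs_cast] at this
    linarith
  have hδ0 : 0 < δ := lt_of_le_of_lt (abs_nonneg _) h
  have hrk : (r : ℝ) + 1 ≤ k := by exact_mod_cast (show r + 1 ≤ k by omega)
  nlinarith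

theorem one_add_mul_taylor (j k : ℕ) (s : ℝ) :
    (1 + s) * ∑ r ∈ range (k + 1), (-1 : ℝ) ^ r * Nat.multichoose (j + 1) r * s ^ r =
      ∑ r ∈ range (k + 1), (-1 : ℝ) ^ r * Nat.multichoose j r * s ^ r +
        (-1) ^ k * Nat.multichoose (j + 1) k * s ^ (k + 1) := by
  induction k with
  | zero => simp
  | succ k ih =>
    rw [sum_range_succ, mul_add, ih, sum_range_succ _ (k + 1), Nat.multichoose_succ_succ]
    push_cast
    ring

theorem inv_pow_taylor (j k : ℕ) {s : ℝ} (hs : 0 ≤ s) :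
    |((1 + s) ^ j)⁻¹ - ∑ r ∈ range (k + 1), (-1 : ℝ) ^ r * Nat.multichoose j r * s ^ r| ≤
      Nat.multichoose j (k + 1) * s ^ (k + 1) := by
  induction j with
  | zero => rw [sum_range_succ']; simp
  | succ j ih =>
    have h1 := one_add_mul_taylor j k s
    set P := ∑ r ∈ range (k + 1), (-1 : ℝ) ^ r * Nat.multichoose (j + 1) r * s ^ r
    set Q := ∑ r ∈ range (k + 1), (-1 : ℝ) ^ r * Nat.multichoose j r * s ^ r
    have hs1 : 0 < 1 + s := by linarith
    have h2 : (1 + s) * (((1 + s) ^ (j + 1))⁻¹ - P) = (((1 + s) ^ j)⁻¹ - Q) -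
        (-1) ^ k * Nat.multichoose (j + 1) k * s ^ (k + 1) := by
      rw [mul_sub, h1, pow_succ, mul_inv]
      field_simp
      ring
    have h3 : (1 + s) * |((1 + s) ^ (j + 1))⁻¹ - P| ≤
        Nat.multichoose j (k + 1) * s ^ (k + 1) + Nat.multichoose (j + 1) k * s ^ (k + 1) := by
      rw [← abs_of_pos hs1, ← abs_mul, abs_of_pos hs1, h2]
      refine (abs_sub _ _).trans (add_le_add ih (le_of_eq ?_))
      rw [abs_mul, abs_mul, abs_pow, abs_neg, abs_one, one_pow, one_mul, Nat.abs_cast,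
        abs_of_nonneg (by positivity)]
    rw [Nat.multichoose_succ_succ]
    push_cast
    rw [add_mul]
    nlinarith [abs_nonneg (((1 + s) ^ (j + 1))⁻¹ - P)]

/-- Taylor expansion of the phase `t ↦ u / t + v / t ^ j`. -/
theorem phase_taylor {j k : ℕ} (hj : 1 ≤ j) (u v : ℝ) {x h : ℝ} (hx : 0 < x) (hh : 0 ≤ h) :
    |u / (x + h) + v / (x + h) ^ j - (u / x + v / x ^ j + ∑ r : Fin k,
        ((-1) ^ ((r : ℕ) + 1) * (u / x + v / x ^ j * Nat.multichoose j ((r : ℕ) + 1)) /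
          x ^ ((r : ℕ) + 1)) * h ^ ((r : ℕ) + 1))| ≤
      (|u / x| + |v / x ^ j|) * (Nat.multichoose j (k + 1) * (h / x) ^ (k + 1)) := by
  have hs : 0 ≤ h / x := by positivity
  have t1 := inv_pow_taylor 1 k hs
  have t2 := inv_pow_taylor j k hs
  simp only [Nat.multichoose_one, Nat.cast_one, mul_one, one_mul, pow_one] at t1
  have e1 : u / (x + h) = u / x * (1 + h / x)⁻¹ := by field_simp
  have e2 : v / (x + h) ^ j = v / x ^ j * ((1 + h / x) ^ j)⁻¹ := by
    rw [show x + h = x * (1 + h / x) by field_simp, mul_pow]; field_simp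
  have e3 : u / x + v / x ^ j + ∑ r : Fin k,
        ((-1) ^ ((r : ℕ) + 1) * (u / x + v / x ^ j * Nat.multichoose j ((r : ℕ) + 1)) /
          x ^ ((r : ℕ) + 1)) * h ^ ((r : ℕ) + 1) =
      u / x * ∑ r ∈ range (k + 1), (-1 : ℝ) ^ r * (h / x) ^ r +
      v / x ^ j * ∑ r ∈ range (k + 1), (-1 : ℝ) ^ r * Nat.multichoose j r * (h / x) ^ r := by
    rw [Fin.sum_univ_eq_sum_range (fun r => ((-1) ^ (r + 1) *
      (u / x + v / x ^ j * Nat.multichoose j (r + 1)) / x ^ (r + 1)) * h ^ (r + 1)),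
      Finset.mul_sum, Finset.mul_sum, ← Finset.sum_add_distrib, Finset.sum_range_succ',
      add_comm]
    congr 1
    · refine Finset.sum_congr rfl fun r _ => ?_
      rw [div_pow]; ring
    · simp
  rw [e1, e2, e3]
  set A := ∑ r ∈ range (k + 1), (-1 : ℝ) ^ r * (h / x) ^ r
  set C := ∑ r ∈ range (k + 1), (-1 : ℝ) ^ r * Nat.multichoose j r * (h / x) ^ r
  have hmc : (1 : ℝ) ≤ Nat.multichoose j (k + 1) := by
    obtain ⟨a, rfl⟩ : ∃ a, j = a + 1 := ⟨j - 1, by omega⟩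
    exact_mod_cast one_le_multichoose a (k + 1)
  have t1' : |(1 + h / x)⁻¹ - A| ≤ Nat.multichoose j (k + 1) * (h / x) ^ (k + 1) :=
    t1.trans (le_mul_of_one_le_left (by positivity) hmc)
  calc _ = |u / x * ((1 + h / x)⁻¹ - A) + v / x ^ j * (((1 + h / x) ^ j)⁻¹ - C)| := by ring_nf
    _ ≤ |u / x| * |(1 + h / x)⁻¹ - A| + |v / x ^ j| * |((1 + h / x) ^ j)⁻¹ - C| := by
        rw [← abs_mul, ← abs_mul]; exact abs_add_le _ _
    _ ≤ _ := by
        rw [add_mul]; gcongr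

theorem card_good_indices {k : ℕ} (w σ : ℝ) (hw : 0 < w) (hσ : 0 < σ) (hk : w / (4 * σ) ≤ k)
    (P : ℕ → Prop) [DecidablePred P]
    (hP : ∀ r r', r < r' → r' ≤ k → ¬ P r → P r') :
    w / (4 * σ) - 2 * w - 3 ≤ (((univ : Finset (Fin k)).filter fun r : Fin k =>
      (2 * w + 1 ≤ ((r : ℕ) + 1 : ℕ) ∧ σ * ((r : ℕ) + 1 : ℕ) ≤ w / 4) ∧ P ((r : ℕ) + 1)).card : ℝ) := by
  classical
  set G := (univ : Finset (Fin k)).filter fun r : Fin k =>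
      (2 * w + 1 ≤ ((r : ℕ) + 1 : ℕ) ∧ σ * ((r : ℕ) + 1 : ℕ) ≤ w / 4) ∧ P ((r : ℕ) + 1)
  set R := Finset.Icc ⌈2 * w + 1⌉₊ ⌊w / (4 * σ)⌋₊ with hR
  have hRk : ∀ r ∈ R, 1 ≤ r ∧ r ≤ k := by
    intro r hr
    rw [hR, mem_Icc] at hr
    constructor
    · have := Nat.ceil_le.1 hr.1
      by_contra h0
      have : r = 0 := by omega
      subst this
      simp at *; linarith
    · exact hr.2.trans (Nat.floor_le_of_le hk)
  have hbad : (R.filter fun r => ¬ P r).card ≤ 1 := by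
    rw [Finset.card_le_one]
    intro a ha b hb
    rw [mem_filter] at ha hb
    rcases lt_trichotomy a b with h | h | h
    · exact absurd (hP a b h (hRk b hb.1).2 ha.2) hb.2
    · exact h
    · exact absurd (hP b a h (hRk a ha.1).2 hb.2) ha.2
  have hsub : R.filter P ⊆ G.image fun r : Fin k => (r : ℕ) + 1 := by
    intro r hr
    rw [mem_filter] at hr
    obtain ⟨h1, h2⟩ := hRk r hr.1
    have e : r - 1 + 1 = r := by omega
    rw [mem_image]
    refine ⟨⟨r - 1, by omega⟩, ?_, e⟩
    have hr1 := mem_Icc.1 hr.1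
    simp only [G, mem_filter, mem_univ, true_and, e]
    refine ⟨⟨Nat.ceil_le.1 hr1.1, ?_⟩, hr.2⟩
    have : (r : ℝ) ≤ w / (4 * σ) := (Nat.cast_le.2 hr1.2).trans (Nat.floor_le (by positivity))
    rw [le_div_iff₀ (by positivity)] at this
    linarith
  have hcard := (Finset.card_le_card hsub).trans Finset.card_image_le
  have hsum : (R.filter P).card + (R.filter fun r => ¬ P r).card = R.card :=
    Finset.card_filter_add_card_filter_not _
  have hRc : ⌊w / (4 * σ)⌋₊ + 1 ≤ R.card + ⌈2 * w + 1⌉₊ := by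
    rw [hR, Nat.card_Icc]; omega
  have h1 : ((⌊w / (4 * σ)⌋₊ + 1 : ℕ) : ℝ) ≤ (G.card + 1 + ⌈2 * w + 1⌉₊ : ℕ) := by
    exact_mod_cast (show ⌊w / (4 * σ)⌋₊ + 1 ≤ G.card + 1 + ⌈2 * w + 1⌉₊ by omega)
  push_cast at h1
  have h2 := Nat.lt_floor_add_one (w / (4 * σ))
  have h3 := Nat.ceil_lt_add_one (show 0 ≤ 2 * w + 1 by positivity)
  linarith

theorem norm_sum_ee_taylor_le {j k Y : ℕ} (hj : 1 ≤ j) (u v : ℝ) {x : ℝ} (hx : 0 < x) {η : ℝ}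
    (hη : (|u / x| + |v / x ^ j|) * (Nat.multichoose j (k + 1) *
      ((Y : ℝ) ^ 2 / x) ^ (k + 1)) ≤ η) :
    ‖∑ z ∈ Finset.Ico (0 : ℤ) Y, ∑ y ∈ Finset.Ico (0 : ℤ) Y,
      ee (u / (x + y * z) + v / (x + y * z) ^ j)‖ ≤
    ‖∑ z ∈ Finset.Ico (0 : ℤ) Y, ∑ y ∈ Finset.Ico (0 : ℤ) Y, ee (∑ r : Fin k,
        ((-1) ^ ((r : ℕ) + 1) * (u / x + v / x ^ j * Nat.multichoose j ((r : ℕ) + 1)) /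
          x ^ ((r : ℕ) + 1)) * (y : ℝ) ^ ((r : ℕ) + 1) * (z : ℝ) ^ ((r : ℕ) + 1))‖ +
      (Y : ℝ) ^ 2 * (2 * Real.pi * η) := by
  set c := u / x + v / x ^ j
  set φ : Fin k → ℝ := fun r =>
    ((-1) ^ ((r : ℕ) + 1) * (u / x + v / x ^ j * Nat.multichoose j ((r : ℕ) + 1)) /
          x ^ ((r : ℕ) + 1)) with hφ
  have key : ∀ z ∈ Finset.Ico (0 : ℤ) Y, ∀ y ∈ Finset.Ico (0 : ℤ) Y,
      ‖ee (u / (x + y * z) + v / (x + y * z) ^ j) -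
        ee c * ee (∑ r : Fin k, φ r * (y : ℝ) ^ ((r : ℕ) + 1) * (z : ℝ) ^ ((r : ℕ) + 1))‖ ≤
        2 * Real.pi * η := by
    intro z hz y hy
    rw [mem_Ico] at hz hy
    have hz0 : (0 : ℝ) ≤ z := by exact_mod_cast hz.1
    have hy0 : (0 : ℝ) ≤ y := by exact_mod_cast hy.1
    have hzY : (z : ℝ) ≤ Y := by exact_mod_cast hz.2.le
    have hyY : (y : ℝ) ≤ Y := by exact_mod_cast hy.2.le
    have h := phase_taylor (k := k) hj u v hx (show (0 : ℝ) ≤ y * z by positivity)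
    rw [← ee_add]
    refine (norm_ee_sub_ee_le _ _).trans ?_
    refine mul_le_mul_of_nonneg_left ?_ (by positivity)
    refine le_trans (le_of_eq ?_) (h.trans (le_trans ?_ hη))
    · congr 3
      refine Finset.sum_congr rfl fun r _ => ?_
      rw [mul_pow, hφ]; ring
    · have : (y : ℝ) * z ≤ (Y : ℝ) ^ 2 := by nlinarith
      gcongr
  have h1 : ‖∑ z ∈ Finset.Ico (0 : ℤ) Y, ∑ y ∈ Finset.Ico (0 : ℤ) Y,
      (ee (u / (x + y * z) + v / (x + y * z) ^ j) -
        ee c * ee (∑ r : Fin k, φ r * (y : ℝ) ^ ((r : ℕ) + 1) * (z : ℝ) ^ ((r : ℕ) + 1)))‖ ≤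
      (Y : ℝ) ^ 2 * (2 * Real.pi * η) := by
    refine (norm_sum_le_of_le _ fun z hz => norm_sum_le_of_le _ fun y hy => key z hz y hy).trans ?_
    simp only [sum_const, Int.card_Ico, nsmul_eq_mul]
    simp
    apply le_of_eq; ring
  simp only [Finset.sum_sub_distrib, ← Finset.mul_sum] at h1
  have h2 : ‖ee c * ∑ z ∈ Finset.Ico (0 : ℤ) Y, ∑ y ∈ Finset.Ico (0 : ℤ) Y,
      ee (∑ r : Fin k, φ r * (y : ℝ) ^ ((r : ℕ) + 1) * (z : ℝ) ^ ((r : ℕ) + 1))‖ =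
      ‖∑ z ∈ Finset.Ico (0 : ℤ) Y, ∑ y ∈ Finset.Ico (0 : ℤ) Y,
      ee (∑ r : Fin k, φ r * (y : ℝ) ^ ((r : ℕ) + 1) * (z : ℝ) ^ ((r : ℕ) + 1))‖ := by
    rw [norm_mul, norm_ee, one_mul]
  rw [← h2]
  exact (norm_le_norm_add_norm_sub' _ _).trans (add_le_add_right h1 _)

theorem four_le_exp_two : (4 : ℝ) ≤ Real.exp 2 := by
  have := Real.add_one_le_exp (1 : ℝ)
  rw [show (2 : ℝ) = 1 + 1 by norm_num, Real.exp_add]; nlinarith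

theorem two_pow_le_exp (n : ℕ) : (2 : ℝ) ^ n ≤ Real.exp n := by
  rw [← Real.exp_one_pow]
  gcongr
  have := Real.add_one_le_exp (1 : ℝ); linarith

theorem four_pow_le_exp (n : ℕ) : (4 : ℝ) ^ n ≤ Real.exp (2 * n) := by
  rw [mul_comm, Real.exp_nat_mul]
  gcongr
  exact four_le_exp_two

/-- Size of the Taylor coefficients. -/
theorem taylor_coeff_size {j k ρ : ℕ} (hj : 1 ≤ j) (hρ : ρ ≤ k) {w ℓ u v x : ℝ}
    (hx1 : Real.exp ℓ ≤ x) (hx2 : x ≤ 4 * Real.exp ℓ)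
    (hF : |u| / Real.exp ℓ + |v| / Real.exp ℓ ^ j = Real.exp (w * ℓ)) :
    |u / x| + |v / x ^ j| ≤ Real.exp (w * ℓ) ∧
    |(-1) ^ ρ * (u / x + v / x ^ j * Nat.multichoose j ρ) / x ^ ρ| ≤
      Real.exp (w * ℓ + (j + k) - ρ * ℓ) ∧
    ((|u / x| + |v / x ^ j|) / (4 * (k + 2)) ≤ |u / x + v / x ^ j * Nat.multichoose j ρ| →
      Real.exp (w * ℓ - 2 * j - 3 * k - 3 - ρ * ℓ) ≤
      |(-1) ^ ρ * (u / x + v / x ^ j * Nat.multichoose j ρ) / x ^ ρ|) := by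
  have hB := Real.exp_pos ℓ
  have hx0 : 0 < x := hB.trans_le hx1
  have eabs : |(-1) ^ ρ * (u / x + v / x ^ j * Nat.multichoose j ρ) / x ^ ρ| =
      |u / x + v / x ^ j * Nat.multichoose j ρ| / x ^ ρ := by
    rw [abs_div, abs_mul, abs_pow, abs_neg, abs_one, one_pow, one_mul, abs_pow, abs_of_pos hx0]
  have hFx : |u / x| + |v / x ^ j| = |u| / x + |v| / x ^ j := by
    rw [abs_div, abs_div, abs_pow, abs_of_pos hx0]
  have hup : |u / x| + |v / x ^ j| ≤ Real.exp (w * ℓ) := by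
    rw [hFx, ← hF]; gcongr
  have hlow : Real.exp (w * ℓ) ≤ 4 ^ j * (|u / x| + |v / x ^ j|) := by
    rw [hFx, ← hF, mul_add]
    have h4 : (4 : ℝ) ≤ 4 ^ j := by
      calc (4 : ℝ) = 4 ^ 1 := by norm_num
        _ ≤ 4 ^ j := pow_le_pow_right₀ (by norm_num) hj
    apply add_le_add
    · calc |u| / Real.exp ℓ = 4 * (|u| / (4 * Real.exp ℓ)) := by field_simp
        _ ≤ 4 ^ j * (|u| / x) := by gcongr
    · calc |v| / Real.exp ℓ ^ j = 4 ^ j * (|v| / (4 * Real.exp ℓ) ^ j) := by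
            rw [mul_pow]; field_simp
        _ ≤ 4 ^ j * (|v| / x ^ j) := by gcongr
  have hmc0 : (1 : ℝ) ≤ Nat.multichoose j ρ := by
    obtain ⟨a, rfl⟩ : ∃ a, j = a + 1 := ⟨j - 1, by omega⟩
    exact_mod_cast one_le_multichoose a ρ
  have hmc1 : (Nat.multichoose j ρ : ℝ) ≤ Real.exp (j + k) := by
    calc (Nat.multichoose j ρ : ℝ) ≤ 2 ^ (j + ρ) := by exact_mod_cast multichoose_le_two_pow j ρ
      _ ≤ Real.exp ((j + ρ : ℕ) : ℝ) := two_pow_le_exp _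
      _ ≤ _ := by
        apply Real.exp_le_exp.2; push_cast
        have : (ρ : ℝ) ≤ k := by exact_mod_cast hρ
        linarith
  refine ⟨hup, ?_, fun h => ?_⟩
  · rw [eabs, Real.exp_sub, Real.exp_nat_mul, Real.exp_add]
    have : |u / x + v / x ^ j * Nat.multichoose j ρ| ≤ Real.exp (w * ℓ) * Real.exp (j + k) := by
      calc _ ≤ |u / x| + |v / x ^ j| * Nat.multichoose j ρ := by
            refine (abs_add_le _ _).trans (le_of_eq ?_)
            rw [abs_mul, Nat.abs_cast]
        _ ≤ (|u / x| + |v / x ^ j|) * Nat.multichoose j ρ := by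
            rw [add_mul]
            exact add_le_add (le_mul_of_one_le_right (abs_nonneg _) hmc0) le_rfl
        _ ≤ _ := by gcongr
    gcongr
  · rw [eabs, Real.exp_sub, Real.exp_nat_mul]
    have hk0 : (0 : ℝ) ≤ k := by positivity
    have hxρ : x ^ ρ ≤ Real.exp (2 * k) * Real.exp ℓ ^ ρ := by
      calc x ^ ρ ≤ (4 * Real.exp ℓ) ^ ρ := by gcongr
        _ = 4 ^ ρ * Real.exp ℓ ^ ρ := mul_pow _ _ _
        _ ≤ _ := by
          gcongr
          refine (four_pow_le_exp ρ).trans (Real.exp_le_exp.2 ?_)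
          gcongr
    have hk2 : 4 * ((k : ℝ) + 2) ≤ Real.exp (k + 3) := by
      have h1 := Real.add_one_le_exp ((k : ℝ) + 1)
      rw [show (k : ℝ) + 3 = 2 + (k + 1) by ring, Real.exp_add]
      have := four_le_exp_two
      nlinarith
    have hc : Real.exp (w * ℓ - 2 * j - k - 3) ≤ |u / x + v / x ^ j * Nat.multichoose j ρ| := by
      refine le_trans ?_ h
      rw [le_div_iff₀ (by positivity)]
      refine le_of_mul_le_mul_left ?_ (show (0 : ℝ) < 4 ^ j by positivity)
      refine le_trans ?_ hlow
      calc 4 ^ j * (Real.exp (w * ℓ - 2 * j - k - 3) * (4 * (k + 2))) ≤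
          Real.exp (2 * j) * (Real.exp (w * ℓ - 2 * j - k - 3) * Real.exp (k + 3)) := by
            gcongr; exact four_pow_le_exp j
        _ = Real.exp (w * ℓ) := by rw [← Real.exp_add, ← Real.exp_add]; congr 1; ring
    calc Real.exp (w * ℓ - 2 * j - 3 * k - 3) / Real.exp ℓ ^ ρ =
        Real.exp (w * ℓ - 2 * j - k - 3) / (Real.exp (2 * k) * Real.exp ℓ ^ ρ) := by
          rw [show w * ℓ - 2 * j - k - 3 = (w * ℓ - 2 * j - 3 * k - 3) + 2 * k by ring,
            Real.exp_add]
          field_simp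
      _ ≤ _ := by gcongr

theorem local_saving {p k l M j : ℕ} (hp : p.Prime) (hk : 3 ≤ k) (hkp : (2 * k) ^ 4 ≤ p)
    (hl : 1 ≤ l) (hj : 2 ≤ j) {w ℓ σ δ u v x : ℝ} (hw : 0 < w) (hσ : 0 < σ)
    (hkσ : w / (4 * σ) ≤ k)
    (hx1 : Real.exp ℓ ≤ x) (hx2 : x ≤ 4 * Real.exp ℓ)
    (hF : |u| / Real.exp ℓ + |v| / Real.exp ℓ ^ j = Real.exp (w * ℓ))
    (hY : (1 - 2 * σ) * ℓ / 2 ≤ M * Real.log p)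
    (h1 : (j : ℝ) + k ≤ ℓ) (h2 : 4 * (2 * j + 3 * k + 3) ≤ w * ℓ) (h3 : 48 ≤ w * ℓ)
    (hδ : k * Real.log (9 * (k * l) ^ 2) + Real.log p * ((2 * (k : ℝ) ^ 2 *
      (1 - 1 / (k : ℝ)) ^ l + 2) * M + 8 * k ^ 2 * l) - (w / (4 * σ) - 2 * w - 3) * (w * ℓ / 16) ≤
      -(4 * (k * l) ^ 2 * δ)) :
    ‖∑ z ∈ Finset.Ico (0 : ℤ) (p ^ M : ℕ), ∑ y ∈ Finset.Ico (0 : ℤ) (p ^ M : ℕ),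
      ee (∑ r : Fin k,
        ((-1) ^ ((r : ℕ) + 1) * (u / x + v / x ^ j * Nat.multichoose j ((r : ℕ) + 1)) /
          x ^ ((r : ℕ) + 1)) * (y : ℝ) ^ ((r : ℕ) + 1) * (z : ℝ) ^ ((r : ℕ) + 1))‖ ≤
      ((p ^ M : ℕ) : ℝ) ^ 2 * Real.exp (-δ) := by
  classical
  have hB := Real.exp_pos ℓ
  have hx0 : 0 < x := hB.trans_le hx1
  have hp0 : (0 : ℝ) < p := by exact_mod_cast hp.pos
  have hℓ : 0 < ℓ := by
    have : (0 : ℝ) < j := by exact_mod_cast (show 0 < j by omega)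
    have : (0 : ℝ) ≤ k := by positivity
    linarith
  set P : ℕ → Prop := fun r => (|u / x| + |v / x ^ j|) / (4 * (k + 2)) ≤
    |u / x + v / x ^ j * Nat.multichoose j r|
  have hcard := card_good_indices (k := k) w σ hw hσ hkσ P
    (fun r r' h h' hn => combination_lower_bound hj h h' _ _ (not_le.1 hn))
  set G := (univ : Finset (Fin k)).filter fun r : Fin k =>
      (2 * w + 1 ≤ ((r : ℕ) + 1 : ℕ) ∧ σ * ((r : ℕ) + 1 : ℕ) ≤ w / 4) ∧ P ((r : ℕ) + 1) with hGdef
  have hp1 : Real.exp (M * Real.log p) = ((p ^ M : ℕ) : ℝ) := by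
    rw [Real.exp_nat_mul, Real.exp_log hp0]; push_cast; rfl
  have hG : ∀ r ∈ G, ((-1) ^ ((r : ℕ) + 1) *
      (u / x + v / x ^ j * Nat.multichoose j ((r : ℕ) + 1)) / x ^ ((r : ℕ) + 1)) ≠ 0 ∧
      |((-1) ^ ((r : ℕ) + 1) *
      (u / x + v / x ^ j * Nat.multichoose j ((r : ℕ) + 1)) / x ^ ((r : ℕ) + 1))| ≤ 1 ∧
      √|((-1) ^ ((r : ℕ) + 1) *
      (u / x + v / x ^ j * Nat.multichoose j ((r : ℕ) + 1)) / x ^ ((r : ℕ) + 1))| +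
      1 / (((k * l : ℕ) * ((p ^ M : ℕ) : ℝ) ^ ((r : ℕ) + 1)) *
      √|((-1) ^ ((r : ℕ) + 1) *
      (u / x + v / x ^ j * Nat.multichoose j ((r : ℕ) + 1)) / x ^ ((r : ℕ) + 1))|) ≤
      2 * Real.exp (-(w * ℓ / 8)) := by
    intro r hr
    rw [hGdef, mem_filter] at hr
    obtain ⟨-, ⟨hr1, hr2⟩, hr3⟩ := hr
    obtain ⟨-, c1, c2⟩ := taylor_coeff_size (j := j) (k := k) (ρ := (r : ℕ) + 1) (by omega)
      r.2 hx1 hx2 hF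
    have c3 := c2 hr3
    set ρ := (r : ℕ) + 1
    set f := |(-1) ^ ρ * (u / x + v / x ^ j * Nat.multichoose j ρ) / x ^ ρ|
    have hρ : (2 * w + 1) * ℓ ≤ ρ * ℓ := by gcongr
    have hf0 : 0 < f := lt_of_lt_of_le (Real.exp_pos _) c3
    have c4 : f ≤ Real.exp (-(w * ℓ)) := c1.trans (Real.exp_le_exp.2 (by linarith))
    refine ⟨abs_pos.1 hf0, c4.trans (Real.exp_le_one_iff.2 (by nlinarith)), ?_⟩
    have s1 : √f ≤ Real.exp (-(w * ℓ / 8)) := by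
      calc √f ≤ √(Real.exp (-(w * ℓ))) := Real.sqrt_le_sqrt c4
        _ = Real.exp (-(w * ℓ) / 2) := (Real.exp_half _).symm
        _ ≤ _ := Real.exp_le_exp.2 (by linarith)
    have s2 : Real.exp ((w * ℓ - 2 * j - 3 * k - 3 - ρ * ℓ) / 2) ≤ √f := by
      rw [Real.exp_half]; exact Real.sqrt_le_sqrt c3
    have s3 : Real.exp (w * ℓ / 8) ≤ ((k * l : ℕ) * ((p ^ M : ℕ) : ℝ) ^ ρ) * √f := by
      have hkl : (1 : ℝ) ≤ (k * l : ℕ) := by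
        exact_mod_cast Nat.one_le_iff_ne_zero.2 (by positivity)
      calc Real.exp (w * ℓ / 8) ≤ 1 * Real.exp (ρ * ((1 - 2 * σ) * ℓ / 2)) *
            Real.exp ((w * ℓ - 2 * j - 3 * k - 3 - ρ * ℓ) / 2) := by
            rw [one_mul, ← Real.exp_add]
            apply Real.exp_le_exp.2
            have : σ * ρ * ℓ ≤ w / 4 * ℓ := by gcongr
            linarith
        _ ≤ _ := by
            gcongr
            rw [Real.exp_nat_mul, ← hp1]
            gcongr
    have s4 : 1 / (((k * l : ℕ) * ((p ^ M : ℕ) : ℝ) ^ ρ) * √f) ≤ Real.exp (-(w * ℓ / 8)) := by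
      rw [Real.exp_neg, one_div]
      exact inv_anti₀ (Real.exp_pos _) s3
    linarith
  have main := bilinear_saving hp hk hkp hl M (fun r : Fin k => ((-1) ^ ((r : ℕ) + 1) *
      (u / x + v / x ^ j * Nat.multichoose j ((r : ℕ) + 1)) / x ^ ((r : ℕ) + 1))) G hG
  set V := ‖∑ z ∈ Finset.Ico (0 : ℤ) (p ^ M : ℕ), ∑ y ∈ Finset.Ico (0 : ℤ) (p ^ M : ℕ),
      ee (∑ r : Fin k,
        ((-1) ^ ((r : ℕ) + 1) * (u / x + v / x ^ j * Nat.multichoose j ((r : ℕ) + 1)) /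
          x ^ ((r : ℕ) + 1)) * (y : ℝ) ^ ((r : ℕ) + 1) * (z : ℝ) ^ ((r : ℕ) + 1))‖
  have hkl0 : 0 < k * l := by positivity
  have hn : 4 * (k * l) ^ 2 ≠ 0 := by positivity
  have hkl0' : (0 : ℝ) < k * l := by exact_mod_cast hkl0
  refine le_of_pow_le_pow_left₀ hn (by positivity) (main.trans ?_)
  have f1 : (9 * (k * l : ℝ) ^ 2) ^ k = Real.exp (k * Real.log (9 * (k * l) ^ 2)) := by
    rw [Real.exp_nat_mul, Real.exp_log (by positivity)]
  have f2 : (4 * (2 * Real.exp (-(w * ℓ / 8)))) ^ G.card ≤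
      Real.exp (-((w / (4 * σ) - 2 * w - 3) * (w * ℓ / 16))) := by
    have e8 : (8 : ℝ) ≤ Real.exp 3 := by
      have h := two_pow_le_exp 3
      norm_num at h; exact h
    calc (4 * (2 * Real.exp (-(w * ℓ / 8)))) ^ G.card ≤
        (Real.exp 3 * Real.exp (-(w * ℓ / 8))) ^ G.card := by
          rw [← mul_assoc]; gcongr; linarith
      _ ≤ (Real.exp (-(w * ℓ / 16))) ^ G.card := by
          rw [← Real.exp_add]; gcongr; linarith
      _ = Real.exp (-(G.card * (w * ℓ / 16))) := by
          rw [← Real.exp_nat_mul]; congr 1; ring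
      _ ≤ _ := by
          apply Real.exp_le_exp.2
          apply neg_le_neg
          gcongr
  rw [f1, Real.rpow_def_of_pos hp0]
  calc _ ≤ Real.exp (k * Real.log (9 * (k * l) ^ 2)) * Real.exp (Real.log p *
        (8 * (k * l : ℝ) ^ 2 * M + (2 * (k : ℝ) ^ 2 * (1 - 1 / (k : ℝ)) ^ l + 2) * M +
          8 * k ^ 2 * l)) * Real.exp (-((w / (4 * σ) - 2 * w - 3) * (w * ℓ / 16))) := by
        gcongr
    _ ≤ Real.exp ((4 * (k * l) ^ 2 : ℕ) * (2 * (M * Real.log p) + (-δ))) := by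
        rw [← Real.exp_add, ← Real.exp_add]
        apply Real.exp_le_exp.2
        push_cast
        nlinarith
    _ = _ := by
        rw [Real.exp_nat_mul, Real.exp_add, ← hp1, two_mul, Real.exp_add]
        ring

theorem norm_sum_sub_shift_le (a b h : ℕ) (g : ℝ → ℂ) (hg : ∀ t, ‖g t‖ ≤ 1) :
    ‖∑ x ∈ Finset.Ioc a b, g x - ∑ x ∈ Finset.Ioc a b, g (x + h)‖ ≤ 2 * h := by
  rcases le_or_gt b a with hab | hab
  · rw [Finset.Ioc_eq_empty_of_le hab]; simp
  have tel : ∀ f : ℕ → ℂ, ∀ c, a ≤ c → ∑ x ∈ Finset.Ioc a c, (f x - f (x + 1)) =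
      f (a + 1) - f (c + 1) := by
    intro f c hc
    induction c, hc using Nat.le_induction with
    | base => simp
    | succ c hc ih => rw [Finset.sum_Ioc_succ_top hc, ih]; ring
  induction h with
  | zero => simp
  | succ h ih =>
    have h1 := tel (fun x => g ((x + h : ℕ) : ℝ)) b hab.le
    rw [Finset.sum_sub_distrib] at h1
    have h2 : ‖∑ x ∈ Finset.Ioc a b, g ((x : ℝ) + h) -
        ∑ x ∈ Finset.Ioc a b, g ((x : ℝ) + ((h + 1 : ℕ) : ℝ))‖ ≤ 2 := by
      have e : ∀ x : ℕ, (x : ℝ) + ((h + 1 : ℕ) : ℝ) = ((x + 1 + h : ℕ) : ℝ) := fun x => by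
        push_cast; ring
      simp only [e]
      push_cast at h1 ⊢
      rw [h1]
      refine (norm_sub_le _ _).trans ?_
      have a1 := hg ((a : ℝ) + 1 + h)
      have a2 := hg ((b : ℝ) + 1 + h)
      linarith
    calc _ ≤ _ := norm_sub_le_norm_sub_add_norm_sub _ (∑ x ∈ Finset.Ioc a b, g ((x : ℝ) + h)) _
      _ ≤ 2 * h + 2 := add_le_add ih h2
      _ = _ := by push_cast; ring

theorem norm_sum_le_of_bilinear (a b Y : ℕ) (hY : 1 ≤ Y) (g : ℝ → ℂ) (hg : ∀ t, ‖g t‖ ≤ 1) {D : ℝ}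
    (hD : ∀ x ∈ Finset.Ioc a b, ‖∑ z ∈ Finset.Ico (0 : ℤ) Y, ∑ y ∈ Finset.Ico (0 : ℤ) Y,
      g (x + y * z)‖ ≤ (Y : ℝ) ^ 2 * D) :
    ‖∑ x ∈ Finset.Ioc a b, g x‖ ≤ (Finset.Ioc a b).card * D + 2 * (Y : ℝ) ^ 2 := by
  set S := ∑ x ∈ Finset.Ioc a b, g x
  have hY0 : (0 : ℝ) < (Y : ℝ) ^ 2 := by positivity
  have h1 : ‖∑ z ∈ Finset.Ico (0 : ℤ) Y, ∑ y ∈ Finset.Ico (0 : ℤ) Y,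
      (S - ∑ x ∈ Finset.Ioc a b, g (x + y * z))‖ ≤ (Y : ℝ) ^ 2 * (2 * (Y : ℝ) ^ 2) := by
    refine (norm_sum_le_of_le (f := fun z : ℤ => ∑ y ∈ Finset.Ico (0 : ℤ) Y,
      (S - ∑ x ∈ Finset.Ioc a b, g ((x : ℝ) + (y : ℝ) * (z : ℝ))))
      (n := fun _ : ℤ => (Y : ℝ) * (2 * (Y : ℝ) ^ 2)) (Finset.Ico (0 : ℤ) Y) fun z hz =>
      (norm_sum_le_of_le (f := fun y : ℤ => S - ∑ x ∈ Finset.Ioc a b, g ((x : ℝ) + (y : ℝ) * (z : ℝ)))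
        (n := fun _ : ℤ => 2 * (Y : ℝ) ^ 2) (Finset.Ico (0 : ℤ) Y) fun y hy => ?_).trans ?_).trans ?_
    · rw [mem_Ico] at hz hy
      lift y to ℕ using hy.1
      lift z to ℕ using hz.1
      have h := norm_sum_sub_shift_le a b (y * z) g hg
      push_cast at h ⊢
      refine h.trans ?_
      have hy' : (y : ℝ) ≤ Y := by exact_mod_cast hy.2.le
      have hz' : (z : ℝ) ≤ Y := by exact_mod_cast hz.2.le
      have : (y : ℝ) * z ≤ Y * Y := by gcongr
      linarith
    · simp
    · simp; apply le_of_eq; ring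
  have h2 : ∑ z ∈ Finset.Ico (0 : ℤ) Y, ∑ y ∈ Finset.Ico (0 : ℤ) Y,
      (S - ∑ x ∈ Finset.Ioc a b, g (x + y * z)) = (Y : ℂ) ^ 2 * S -
      ∑ x ∈ Finset.Ioc a b, ∑ z ∈ Finset.Ico (0 : ℤ) Y, ∑ y ∈ Finset.Ico (0 : ℤ) Y,
        g (x + y * z) := by
    simp only [Finset.sum_sub_distrib]
    congr 1
    · simp; ring
    · rw [Finset.sum_comm (s := Finset.Ioc a b)]
      refine Finset.sum_congr rfl fun z _ => ?_
      rw [Finset.sum_comm]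
  have h3 : ‖∑ x ∈ Finset.Ioc a b, ∑ z ∈ Finset.Ico (0 : ℤ) Y, ∑ y ∈ Finset.Ico (0 : ℤ) Y,
        g (x + y * z)‖ ≤ (Finset.Ioc a b).card * ((Y : ℝ) ^ 2 * D) := by
    refine (norm_sum_le_of_le _ hD).trans (le_of_eq ?_)
    rw [sum_const, nsmul_eq_mul]
  rw [h2] at h1
  have h4 : (Y : ℝ) ^ 2 * ‖S‖ ≤ (Y : ℝ) ^ 2 * ((Finset.Ioc a b).card * D + 2 * (Y : ℝ) ^ 2) := by
    have e : (Y : ℝ) ^ 2 * ‖S‖ = ‖(Y : ℂ) ^ 2 * S‖ := by simp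
    rw [e]
    refine (norm_le_norm_add_norm_sub' _ _).trans ((add_le_add h3 h1).trans (le_of_eq ?_))
    ring
  exact le_of_mul_le_mul_left h4 hY0

theorem exists_prime_scale {k g : ℕ} (hk : 1 ≤ k) (hg : 1 ≤ g) {σ ℓ : ℝ} (hσ : 0 < σ)
    (hσ4 : σ ≤ 1 / 4) (hℓ : 0 ≤ ℓ) (h1 : 4 * g * k ≤ σ * ℓ) (h2 : 32 * g * (k : ℝ) ^ 2 ≤ ℓ) :
    ∃ p : ℕ, p.Prime ∧ (2 * k) ^ 4 ≤ p ∧ (1 - 2 * σ) * ℓ / 2 ≤ (g * k : ℕ) * Real.log p ∧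
      (g * k : ℕ) * Real.log p ≤ (1 - σ) * ℓ / 2 := by
  have hM : (0 : ℝ) < (g * k : ℕ) := by exact_mod_cast Nat.mul_pos hg hk
  set s := (1 - 2 * σ) * ℓ / (2 * (g * k : ℕ)) with hs
  have hs0 : 0 ≤ s := div_nonneg (mul_nonneg (by linarith) hℓ) (by positivity)
  have hX1 : 1 ≤ Real.exp s := Real.one_le_exp hs0
  set N := ⌈Real.exp s⌉₊
  have hN1 : Real.exp s ≤ N := Nat.le_ceil _
  have hN2 : (N : ℝ) < Real.exp s + 1 := Nat.ceil_lt_add_one (by positivity)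
  have hN0 : N ≠ 0 := by
    intro h; rw [h] at hN1; norm_num at hN1; linarith
  obtain ⟨p, hp, hp1, hp2⟩ := Nat.exists_prime_lt_and_le_two_mul N hN0
  have hp1' : (N : ℝ) < p := by exact_mod_cast hp1
  have hp2' : (p : ℝ) ≤ 2 * N := by exact_mod_cast hp2
  have hpp : (0 : ℝ) < p := by exact_mod_cast hp.pos
  have hsM : (g * k : ℕ) * s = (1 - 2 * σ) * ℓ / 2 := by
    rw [hs]; field_simp
  refine ⟨p, hp, ?_, ?_, ?_⟩
  · have : ((2 * k : ℕ) : ℝ) ^ 4 ≤ Real.exp s := by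
      calc ((2 * k : ℕ) : ℝ) ^ 4 ≤ Real.exp (2 * k) ^ 4 := by
            gcongr
            push_cast
            linarith [Real.add_one_le_exp (2 * (k : ℝ))]
        _ = Real.exp (8 * k) := by rw [← Real.exp_nat_mul]; congr 1; push_cast; ring
        _ ≤ _ := by
          apply Real.exp_le_exp.2
          refine le_of_mul_le_mul_left ?_ hM
          rw [hsM]; push_cast
          nlinarith
    exact_mod_cast (this.trans hN1).trans hp1'.le
  · rw [← hsM]
    gcongr
    rw [Real.le_log_iff_exp_le hpp]
    linarith
  · have h3 : Real.log p ≤ s + 2 := by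
      rw [Real.log_le_iff_le_exp hpp, Real.exp_add]
      have := four_le_exp_two
      nlinarith
    calc (g * k : ℕ) * Real.log p ≤ (g * k : ℕ) * (s + 2) := by gcongr
      _ = (1 - 2 * σ) * ℓ / 2 + 2 * (g * k) := by rw [mul_add, hsM]; push_cast; ring
      _ ≤ _ := by linarith

theorem saving_exponent_le {p k L g : ℕ} (hk : 3 ≤ k) (hL : 1 ≤ L) (hg : 1 ≤ g)
    {w ℓ σ δ G : ℝ} (hℓ : 0 ≤ ℓ) (hG : 1 ≤ G) (hσ : 0 < σ)
    (hM : (g * k : ℕ) * Real.log p ≤ (1 - σ) * ℓ / 2)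
    (hsav : 5 * G * ℓ ≤ (w / (4 * σ) - 2 * w - 3) * (w * ℓ / 16))
    (hq : (k : ℝ) ^ 2 * Real.exp (-L) ≤ G / 2) (hgL : 8 * L * (k : ℝ) ^ 2 ≤ g * G)
    (hlog : (6 * L + 4) * (k : ℝ) ^ 2 ≤ G * ℓ)
    (hδ : 2 * ((k : ℝ) * (L * k : ℕ)) ^ 2 * δ ≤ G * ℓ) :
    k * Real.log (9 * (k * (L * k : ℕ)) ^ 2) + Real.log p * ((2 * (k : ℝ) ^ 2 *
      (1 - 1 / (k : ℝ)) ^ (L * k) + 2) * (g * k : ℕ) + 8 * k ^ 2 * (L * k : ℕ)) -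
      (w / (4 * σ) - 2 * w - 3) * (w * ℓ / 16) ≤ -(4 * (k * (L * k : ℕ)) ^ 2 * δ) := by
  have hk0 : (3 : ℝ) ≤ k := by exact_mod_cast hk
  have hL0 : (1 : ℝ) ≤ L := by exact_mod_cast hL
  have hg0 : (1 : ℝ) ≤ g := by exact_mod_cast hg
  have e1 : Real.log (9 * ((k : ℝ) * (L * k : ℕ)) ^ 2) ≤ 6 * L + 4 * k := by
    rw [Real.log_le_iff_le_exp (by push_cast; positivity)]
    have h1 : (3 * L : ℝ) ≤ Real.exp (3 * L) := by linarith [Real.add_one_le_exp (3 * (L : ℝ))]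
    have h2 : (k : ℝ) ≤ Real.exp k := by linarith [Real.add_one_le_exp (k : ℝ)]
    calc 9 * ((k : ℝ) * (L * k : ℕ)) ^ 2 = (3 * L) ^ 2 * (k : ℝ) ^ 4 := by push_cast; ring
      _ ≤ Real.exp (3 * L) ^ 2 * Real.exp k ^ 4 := by gcongr
      _ = _ := by
        rw [← Real.exp_nat_mul, ← Real.exp_nat_mul, ← Real.exp_add]; congr 1; push_cast; ring
  have e2 : k * Real.log (9 * ((k : ℝ) * (L * k : ℕ)) ^ 2) ≤ G * ℓ := by
    calc _ ≤ k * (6 * L + 4 * k : ℝ) := by gcongr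
      _ ≤ (6 * L + 4) * (k : ℝ) ^ 2 := by nlinarith [mul_nonneg (show (0 : ℝ) ≤ L by linarith) (mul_nonneg (show (0 : ℝ) ≤ k by linarith) (show (0 : ℝ) ≤ k - 1 by linarith))]
      _ ≤ _ := hlog
  have e3 : (1 - 1 / (k : ℝ)) ^ (L * k) ≤ Real.exp (-L) := by
    have := Real.one_sub_div_pow_le_exp_neg (n := k) (t := 1) (by linarith)
    calc (1 - 1 / (k : ℝ)) ^ (L * k) = ((1 - 1 / (k : ℝ)) ^ k) ^ L := by rw [mul_comm, pow_mul]
      _ ≤ Real.exp (-1) ^ L := by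
        gcongr
        apply pow_nonneg
        rw [sub_nonneg, div_le_one (by linarith)]; linarith
      _ = _ := by rw [← Real.exp_nat_mul]; simp
  set M := (g * k : ℕ) * Real.log p with hMdef
  have hM0 : 0 ≤ M := mul_nonneg (by positivity) (Real.log_natCast_nonneg p)
  have hM1 : M ≤ ℓ / 2 := by nlinarith
  have e4 : Real.log p * ((2 * (k : ℝ) ^ 2 * (1 - 1 / (k : ℝ)) ^ (L * k) + 2) * (g * k : ℕ) +
      8 * k ^ 2 * (L * k : ℕ)) ≤ 2 * (G * ℓ) := by
    calc _ = (2 * ((k : ℝ) ^ 2 * (1 - 1 / (k : ℝ)) ^ (L * k)) + 2 + 8 * L * k ^ 2 / g) * M := by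
          rw [hMdef]; push_cast; field_simp
      _ ≤ (2 * (G / 2) + 2 * G + G) * M := by
          gcongr
          · exact (mul_le_mul_of_nonneg_left e3 (by positivity)).trans hq
          · linarith
          · rw [div_le_iff₀ (by linarith)]; linarith
      _ ≤ (2 * (G / 2) + 2 * G + G) * (ℓ / 2) := by gcongr
      _ = _ := by ring
  linarith

theorem sum_bound_numerics {n Y2 σ δ ℓ : ℝ} (hn : n ≤ 4 * Real.exp ℓ)
    (hY2 : Y2 ≤ Real.exp ((1 - σ) * ℓ)) (hℓ : 0 ≤ ℓ) (hδσ : δ ≤ σ * ℓ) (hσ4 : σ ≤ 1 / 4) :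
    n * (Real.exp (-δ) + 2 * Real.pi * Real.exp (1 - ℓ)) + 2 * Y2 ≤ 80 * Real.exp (ℓ - δ) := by
  have hδℓ : 1 ≤ Real.exp (ℓ - δ) := Real.one_le_exp (by nlinarith)
  have b1 : Real.exp ℓ * Real.exp (-δ) = Real.exp (ℓ - δ) := by rw [← Real.exp_add]; congr 1
  have b2 : Real.exp ℓ * Real.exp (1 - ℓ) = Real.exp 1 := by rw [← Real.exp_add]; congr 1; ring
  have b3 : Real.exp ((1 - σ) * ℓ) ≤ Real.exp (ℓ - δ) := Real.exp_le_exp.2 (by linarith)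
  have b4 : Real.pi * Real.exp 1 ≤ 9 := by
    have := Real.pi_lt_d2
    have := Real.exp_one_lt_d9
    nlinarith [Real.exp_pos 1, Real.pi_pos]
  calc _ ≤ 4 * Real.exp ℓ * (Real.exp (-δ) + 2 * Real.pi * Real.exp (1 - ℓ)) +
        2 * Real.exp ((1 - σ) * ℓ) := by gcongr
    _ = 4 * Real.exp (ℓ - δ) + 8 * (Real.pi * Real.exp 1) + 2 * Real.exp ((1 - σ) * ℓ) := by
        rw [← b1, ← b2]; ring
    _ ≤ _ := by linarith

theorem smooth_sum_of_params {k L g j a b : ℕ} (hk : 3 ≤ k) (hL : 1 ≤ L) (hg : 1 ≤ g)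
    (hj : 2 ≤ j) {w ℓ σ δ G u v : ℝ} (hw : 0 < w) (hG : 1 ≤ G) (hσ : 0 < σ) (hσ4 : σ ≤ 1 / 4)
    (hkσ : w / (4 * σ) ≤ k) (hkw : w + 2 ≤ σ * k)
    (hsav : 5 * G * ℓ ≤ (w / (4 * σ) - 2 * w - 3) * (w * ℓ / 16))
    (hq : (k : ℝ) ^ 2 * Real.exp (-L) ≤ G / 2) (hgL : 8 * L * (k : ℝ) ^ 2 ≤ g * G)
    (hlog : (6 * L + 4) * (k : ℝ) ^ 2 ≤ G * ℓ)
    (hδ : 2 * ((k : ℝ) * (L * k : ℕ)) ^ 2 * δ ≤ G * ℓ) (hδσ : δ ≤ σ * ℓ)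
    (h1 : (j : ℝ) + k ≤ ℓ) (h2 : 4 * (2 * j + 3 * k + 3) ≤ w * ℓ) (h3 : 48 ≤ w * ℓ)
    (h4 : 4 * g * k ≤ σ * ℓ) (h5 : 32 * g * (k : ℝ) ^ 2 ≤ ℓ)
    (hF : |u| / Real.exp ℓ + |v| / Real.exp ℓ ^ j = Real.exp (w * ℓ))
    (hx : ∀ x ∈ Finset.Ioc a b, Real.exp ℓ ≤ (x : ℝ) ∧ (x : ℝ) ≤ 4 * Real.exp ℓ) :
    ‖∑ x ∈ Finset.Ioc a b, ee (u / x + v / (x : ℝ) ^ j)‖ ≤ 80 * Real.exp (ℓ - δ) := by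
  have hℓ : 0 ≤ ℓ := le_trans (by positivity) h1
  obtain ⟨p, hp, hp1, hp2, hp3⟩ := exists_prime_scale (by omega) hg hσ hσ4 hℓ h4 h5
  have hp0 : (0 : ℝ) < p := by exact_mod_cast hp.pos
  have hkl := saving_exponent_le hk hL hg hℓ hG hσ hp3 hsav hq hgL hlog hδ
  have hB := Real.exp_pos ℓ
  set Y := p ^ (g * k) with hYdef
  have hY1 : 1 ≤ Y := Nat.one_le_pow _ _ hp.pos
  have hYe : (Y : ℝ) = Real.exp ((g * k : ℕ) * Real.log p) := by
    rw [Real.exp_nat_mul, Real.exp_log hp0, hYdef]; push_cast; rfl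
  have hY2 : (Y : ℝ) ^ 2 ≤ Real.exp ((1 - σ) * ℓ) := by
    rw [hYe, ← Real.exp_nat_mul]; apply Real.exp_le_exp.2; push_cast at hp3 ⊢; linarith
  have hloc : ∀ x ∈ Finset.Ioc a b, ‖∑ z ∈ Finset.Ico (0 : ℤ) Y, ∑ y ∈ Finset.Ico (0 : ℤ) Y,
      ee (u / ((x : ℝ) + y * z) + v / ((x : ℝ) + y * z) ^ j)‖ ≤
      (Y : ℝ) ^ 2 * (Real.exp (-δ) + 2 * Real.pi * Real.exp (1 - ℓ)) := by
    intro x hxm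
    obtain ⟨hx1, hx2⟩ := hx x hxm
    have hx0 : (0 : ℝ) < x := hB.trans_le hx1
    have hη : (|u / x| + |v / (x : ℝ) ^ j|) * (Nat.multichoose j (k + 1) *
        ((Y : ℝ) ^ 2 / x) ^ (k + 1)) ≤ Real.exp (1 - ℓ) := by
      have a1 : |u / x| + |v / (x : ℝ) ^ j| ≤ Real.exp (w * ℓ) := by
        rw [← hF, abs_div, abs_div, abs_of_pos hx0, abs_of_pos (pow_pos hx0 j)]
        gcongr
      have a2 : (Nat.multichoose j (k + 1) : ℝ) ≤ Real.exp (j + k + 1) := by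
        calc (Nat.multichoose j (k + 1) : ℝ) ≤ 2 ^ (j + (k + 1)) := by
              exact_mod_cast multichoose_le_two_pow j (k + 1)
          _ ≤ _ := (two_pow_le_exp _).trans (Real.exp_le_exp.2 (by push_cast; linarith))
      have a3 : (Y : ℝ) ^ 2 / x ≤ Real.exp (-(σ * ℓ)) := by
        rw [div_le_iff₀ hx0]
        calc (Y : ℝ) ^ 2 ≤ Real.exp (-(σ * ℓ)) * Real.exp ℓ := by
              rw [← Real.exp_add]; exact hY2.trans (Real.exp_le_exp.2 (by linarith))
          _ ≤ _ := by gcongr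
      calc _ ≤ Real.exp (w * ℓ) * (Real.exp (j + k + 1) * Real.exp (-(σ * ℓ)) ^ (k + 1)) := by
            gcongr
        _ = Real.exp (w * ℓ + (j + k + 1 - (k + 1) * (σ * ℓ))) := by
            rw [← Real.exp_nat_mul, ← Real.exp_add, ← Real.exp_add]; congr 1; push_cast; ring
        _ ≤ _ := by
            apply Real.exp_le_exp.2
            have : (w + 2) * ℓ ≤ σ * k * ℓ := by gcongr
            nlinarith
    refine (norm_sum_ee_taylor_le (j := j) (k := k) (Y := Y) (by omega) u v hx0 hη).trans ?_
    have hls := local_saving hp hk hp1 (Nat.one_le_iff_ne_zero.2 (by positivity)) hj hw hσ hkσ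
      hx1 hx2 hF hp2 h1 h2 h3 hkl
    rw [← hYdef] at hls
    clear_value Y
    refine (add_le_add hls le_rfl).trans (le_of_eq ?_)
    ring
  clear_value Y
  have key := norm_sum_le_of_bilinear a b Y hY1 (fun t => ee (u / t + v / t ^ j))
    (fun t => (norm_ee _).le) hloc
  refine key.trans ?_
  have hcard : ((Finset.Ioc a b).card : ℝ) ≤ 4 * Real.exp ℓ := by
    rcases le_or_gt b a with h | h
    · rw [Finset.Ioc_eq_empty_of_le h]; simp [hB.le]
    · have := (hx b (by simp [h])).2
      rw [Nat.card_Ioc]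
      refine le_trans ?_ this
      exact_mod_cast Nat.sub_le _ _
  exact sum_bound_numerics hcard hY2 hℓ hδσ hσ4

set_option maxHeartbeats 800000 in
/-- A Vinogradov-type bound for sums of `ee (u / x + v / x ^ j)` over short intervals. -/
theorem smooth_sum (w0 : ℝ) (hw0 : 0 < w0) (hw01 : w0 ≤ 1) :
    ∃ K c : ℝ, 1 ≤ K ∧ 0 < c ∧ ∀ (ℓ w u v : ℝ) (j a b : ℕ), 2 ≤ j → w0 ≤ w → K * w ^ 2 ≤ ℓ →
      K * j ≤ ℓ → |u| / Real.exp ℓ + |v| / Real.exp ℓ ^ j = Real.exp (w * ℓ) →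
      (∀ x ∈ Finset.Ioc a b, Real.exp ℓ ≤ (x : ℝ) ∧ (x : ℝ) ≤ 4 * Real.exp ℓ) →
      ‖∑ x ∈ Finset.Ioc a b, ee (u / x + v / (x : ℝ) ^ j)‖ ≤ 80 * Real.exp (ℓ - c * ℓ / w ^ 2) := by
  set σ := w0 ^ 2 / 400 with hσdef
  set A := 1300 / w0 ^ 3 with hAdef
  have hσ : 0 < σ := by positivity
  have hA : 0 < A := by positivity
  obtain ⟨L, hL1, hL⟩ : ∃ L : ℕ, 1 ≤ L ∧ A ^ 2 * w0 ^ 2 * Real.exp (-L) ≤ 1 / 2 := by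
    obtain ⟨n, hn⟩ := exists_nat_ge (2 * (A ^ 2 * w0 ^ 2))
    refine ⟨n + 1, by omega, ?_⟩
    rw [Real.exp_neg, ← div_eq_mul_inv, div_le_iff₀ (Real.exp_pos _)]
    have := Real.add_one_le_exp ((n + 1 : ℕ) : ℝ)
    push_cast at this ⊢
    linarith
  obtain ⟨g, hg1, hg⟩ : ∃ g : ℕ, 1 ≤ g ∧ 8 * L * (A ^ 2 * w0 ^ 2) ≤ g := by
    obtain ⟨n, hn⟩ := exists_nat_ge (8 * L * (A ^ 2 * w0 ^ 2))
    exact ⟨n + 1, by omega, by push_cast; linarith⟩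
  have hL0 : (1 : ℝ) ≤ L := by exact_mod_cast hL1
  have hg0 : (1 : ℝ) ≤ g := by exact_mod_cast hg1
  set c := min (1 / (2 * L ^ 2 * A ^ 4 * w0 ^ 2)) (σ * w0 ^ 2) with hc
  refine ⟨4 + 4 * A / w0 + 32 / w0 + 48 * A / w0 ^ 2 + 48 / w0 + 32 * g * A ^ 2 +
    4 * g * A / (w0 * σ) + (6 * L + 4) * A ^ 2 * w0 ^ 2 + 48 * A, c, ?_, by positivity, ?_⟩
  · have : 0 ≤ 4 * A / w0 + 32 / w0 + 48 * A / w0 ^ 2 + 48 / w0 + 32 * g * A ^ 2 +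
      4 * g * A / (w0 * σ) + (6 * L + 4) * A ^ 2 * w0 ^ 2 + 48 * A := by positivity
    linarith
  set K := 4 + 4 * A / w0 + 32 / w0 + 48 * A / w0 ^ 2 + 48 / w0 + 32 * g * A ^ 2 +
    4 * g * A / (w0 * σ) + (6 * L + 4) * A ^ 2 * w0 ^ 2 + 48 * A with hK
  have p1 : 0 < 4 * A / w0 := by positivity
  have p2 : 0 < 32 / w0 := by positivity
  have p3 : 0 < 48 * A / w0 ^ 2 := by positivity
  have p4 : 0 < 48 / w0 := by positivity
  have p5 : 0 < 32 * g * A ^ 2 := by positivity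
  have p6 : 0 < 4 * g * A / (w0 * σ) := by positivity
  have p7 : 0 < (6 * L + 4) * A ^ 2 * w0 ^ 2 := by positivity
  have p8 : 0 < 48 * A := by positivity
  have k0 : 4 ≤ K := by linarith
  have k1 : 4 * A ≤ K * w0 := by rw [← div_le_iff₀ hw0]; linarith
  have k2 : 32 ≤ K * w0 := by rw [← div_le_iff₀ hw0]; linarith
  have k4 : 48 ≤ K * w0 := by rw [← div_le_iff₀ hw0]; linarith
  have k5 : 32 * g * A ^ 2 ≤ K := by linarith
  have k6 : 4 * g * A ≤ K * (w0 * σ) := by rw [← div_le_iff₀ (by positivity)]; linarith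
  have k7 : (6 * L + 4) * A ^ 2 * w0 ^ 2 ≤ K := by linarith
  have k8 : 48 * A ≤ K := by linarith
  clear_value K
  clear p1 p2 p3 p4 p5 p6 p7 p8 hK
  intro ℓ w u v j a b hj hw hKw hKj hF hx
  have hwp : 0 < w := hw0.trans_le hw
  have hj2 : (2 : ℝ) ≤ j := by exact_mod_cast hj
  have hℓK : K * 2 ≤ ℓ := le_trans (by gcongr) hKj
  have hℓ0 : 0 < ℓ := by linarith
  have hKwℓ : K * w0 * w ≤ ℓ := by
    refine le_trans ?_ hKw
    rw [mul_assoc, sq]; gcongr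
  have hr : 1 ≤ w / w0 := by rw [le_div_iff₀ hw0]; linarith
  set G := (w / w0) ^ 2 with hG
  have hG1 : 1 ≤ G := one_le_pow₀ hr
  have hGw : G * w0 ^ 2 = w ^ 2 := by rw [hG]; field_simp
  set k := ⌈(w + 2) / σ⌉₊ with hkdef
  have hk1 : (w + 2) / σ ≤ k := Nat.le_ceil _
  have hk2 : (k : ℝ) < (w + 2) / σ + 1 := Nat.ceil_lt_add_one (by positivity)
  have hkw : w + 2 ≤ σ * k := by rwa [div_le_iff₀ hσ, mul_comm] at hk1
  have hw02 : w0 ^ 2 ≤ 1 := pow_le_one₀ hw0.le hw01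
  have hσ4 : σ ≤ 1 / 4 := by rw [hσdef]; linarith
  have hk3 : 3 ≤ k := by
    have h : σ * k ≤ 1 / 4 * k := by gcongr
    have : (3 : ℝ) ≤ k := by linarith
    exact_mod_cast this
  have hkA : (k : ℝ) ≤ A * w := by
    have e : (w + 2) / σ + 1 = (400 * w + 800 + w0 ^ 2) / w0 ^ 2 := by rw [hσdef]; field_simp; ring
    have e2 : A * w = 1300 * (w / w0) / w0 ^ 2 := by rw [hAdef]; field_simp
    refine hk2.le.trans ?_
    rw [e, e2]
    gcongr
    have : w ≤ w / w0 := le_div_self hwp.le hw0 hw01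
    linarith
  have hkσ : w / (4 * σ) ≤ k := by
    refine le_trans ?_ hk1
    rw [div_le_div_iff₀ (by positivity) hσ]; linarith [mul_pos hwp hσ]
  have hkk : (k : ℝ) ^ 2 ≤ A ^ 2 * w0 ^ 2 * G := by
    calc (k : ℝ) ^ 2 ≤ (A * w) ^ 2 := by gcongr
      _ = _ := by rw [mul_pow, ← hGw]; ring
  have hGℓ : G * K ≤ G * ℓ := by gcongr; linarith
  have hδ0 : 0 ≤ c * ℓ / w ^ 2 := by positivity
  clear_value k
  apply smooth_sum_of_params hk3 hL1 hg1 hj hwp hG1 hσ hσ4 hkσ hkw (δ := c * ℓ / w ^ 2) (hF := hF)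
    (hx := hx)
  · have e1 : w / (4 * σ) = 100 * (w / w0) / w0 := by rw [hσdef]; field_simp; norm_num
    have h1 : w / w0 ≤ w / w0 / w0 := le_div_self (by positivity) hw0 hw01
    have h2 : w ≤ w / w0 := le_div_self hwp.le hw0 hw01
    have h3 : 95 * (w / w0 / w0) ≤ w / (4 * σ) - 2 * w - 3 := by
      rw [e1, mul_div_assoc]; linarith
    calc 5 * G * ℓ ≤ 95 / 16 * G * ℓ := by gcongr; norm_num
      _ = 95 * (w / w0 / w0) * (w * ℓ / 16) := by rw [hG]; field_simp
      _ ≤ _ := by gcongr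
  · calc _ ≤ A ^ 2 * w0 ^ 2 * G * Real.exp (-L) := by gcongr
      _ = A ^ 2 * w0 ^ 2 * Real.exp (-L) * G := by ring
      _ ≤ 1 / 2 * G := by gcongr
      _ = _ := by ring
  · calc 8 * L * (k : ℝ) ^ 2 ≤ 8 * L * (A ^ 2 * w0 ^ 2 * G) := by gcongr
      _ = 8 * L * (A ^ 2 * w0 ^ 2) * G := by ring
      _ ≤ _ := by gcongr
  · calc (6 * L + 4) * (k : ℝ) ^ 2 ≤ (6 * L + 4) * (A ^ 2 * w0 ^ 2 * G) := by gcongr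
      _ = G * ((6 * L + 4) * A ^ 2 * w0 ^ 2) := by ring
      _ ≤ G * K := by gcongr
      _ ≤ _ := hGℓ
  · calc 2 * ((k : ℝ) * (L * k : ℕ)) ^ 2 * (c * ℓ / w ^ 2) =
          2 * L ^ 2 * (k : ℝ) ^ 4 * (c * ℓ / w ^ 2) := by push_cast; ring
      _ ≤ 2 * L ^ 2 * (A * w) ^ 4 * (1 / (2 * L ^ 2 * A ^ 4 * w0 ^ 2) * ℓ / w ^ 2) := by
          gcongr
          exact min_le_left _ _
      _ = G * ℓ := by rw [hG]; field_simp
  · rw [div_le_iff₀ (by positivity)]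
    have : c ≤ σ * w0 ^ 2 := min_le_right _ _
    calc c * ℓ ≤ σ * w0 ^ 2 * ℓ := by gcongr
      _ ≤ σ * w ^ 2 * ℓ := by gcongr
      _ = _ := by ring
  · have : 4 * (k : ℝ) ≤ ℓ := by
      calc 4 * (k : ℝ) ≤ 4 * (A * w) := by gcongr
        _ = 4 * A * w := by ring
        _ ≤ K * w0 * w := by gcongr
        _ ≤ _ := hKwℓ
    have : 4 * (j : ℝ) ≤ ℓ := le_trans (by gcongr) hKj
    linarith
  · have a1 : 32 * j ≤ w * ℓ := by
      calc 32 * (j : ℝ) ≤ K * w0 * j := by gcongr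
        _ = w0 * (K * j) := by ring
        _ ≤ w * ℓ := by gcongr
    have a2 : 96 * k ≤ w * ℓ := by
      calc 96 * (k : ℝ) ≤ 96 * (A * w) := by gcongr
        _ = w * (48 * A * 2) := by ring
        _ ≤ w * (K * 2) := by gcongr
        _ ≤ _ := by gcongr
    have a3 : 48 * 2 ≤ w * ℓ := by
      calc (48 : ℝ) * 2 ≤ K * w0 * 2 := by gcongr
        _ = w0 * (K * 2) := by ring
        _ ≤ w * ℓ := by gcongr
    linarith
  · calc (48 : ℝ) ≤ K * w0 * 2 := by linarith
        _ = w0 * (K * 2) := by ring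
        _ ≤ w * ℓ := by gcongr
  · calc 4 * g * (k : ℝ) ≤ 4 * g * (A * w) := by gcongr
      _ = 4 * g * A * w := by ring
      _ ≤ K * (w0 * σ) * w := by gcongr
      _ = σ * (K * w0 * w) := by ring
      _ ≤ _ := by gcongr
  · calc 32 * g * (k : ℝ) ^ 2 ≤ 32 * g * (A * w) ^ 2 := by gcongr
      _ = 32 * g * A ^ 2 * w ^ 2 := by ring
      _ ≤ K * w ^ 2 := by gcongr
      _ ≤ _ := hKw

theorem sum_Ioc_divisorsAntidiagonal {R : Type*} [AddCommMonoid R] (P Q : ℕ) (F : ℕ → ℕ → R) :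
    ∑ d ∈ Finset.Ioc P Q, ∑ q ∈ d.divisorsAntidiagonal, F q.1 q.2 =
      ∑ b ∈ Finset.Ioc 0 Q, ∑ c ∈ Finset.Ioc (P / b) (Q / b), F b c := by
  rw [Finset.sum_sigma', Finset.sum_sigma']
  refine Finset.sum_bij' (fun s _ => ⟨s.2.1, s.2.2⟩) (fun s _ => ⟨s.1 * s.2, (s.1, s.2)⟩) ?_ ?_ ?_ ?_ ?_
  · rintro ⟨d, b, c⟩ h
    simp only [mem_sigma, mem_Ioc, Nat.mem_divisorsAntidiagonal] at h ⊢
    obtain ⟨⟨h1, h2⟩, rfl, h3⟩ := h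
    have hb : 0 < b := Nat.pos_of_ne_zero (left_ne_zero_of_mul h3)
    have hc : 0 < c := Nat.pos_of_ne_zero (right_ne_zero_of_mul h3)
    refine ⟨⟨hb, le_trans (Nat.le_mul_of_pos_right b hc) h2⟩, ?_, ?_⟩
    · rw [Nat.div_lt_iff_lt_mul hb]; linarith [mul_comm b c]
    · rw [Nat.le_div_iff_mul_le hb]; linarith [mul_comm b c]
  · rintro ⟨b, c⟩ h
    simp only [mem_sigma, mem_Ioc, Nat.mem_divisorsAntidiagonal] at h ⊢
    obtain ⟨⟨hb, -⟩, h1, h2⟩ := h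
    rw [Nat.div_lt_iff_lt_mul hb] at h1
    rw [Nat.le_div_iff_mul_le hb] at h2
    rw [mul_comm b c]
    exact ⟨⟨h1, h2⟩, trivial, by omega⟩
  · rintro ⟨d, b, c⟩ h
    simp only [mem_sigma, Nat.mem_divisorsAntidiagonal] at h
    obtain ⟨-, rfl, -⟩ := h
    rfl
  · rintro ⟨b, c⟩ _; rfl
  · rintro ⟨d, b, c⟩ _; rfl

theorem norm_sum_mul_le_of_monotone {a b : ℕ} (hab : a ≤ b) (w : ℕ → ℝ) (g : ℕ → ℂ) {D : ℝ}
    (hw0 : 0 ≤ w a) (hw : ∀ i ∈ Finset.Ico a b, w i ≤ w (i + 1))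
    (hD : ∀ i ∈ Finset.Icc a b, ‖∑ c ∈ Finset.Ioc a i, g c‖ ≤ D) :
    ‖∑ c ∈ Finset.Ioc a b, (w c : ℂ) * g c‖ ≤ 2 * w b * D := by
  have key : ∀ b, a ≤ b → ∑ c ∈ Finset.Ioc a b, (w c : ℂ) * g c =
      w b * ∑ c ∈ Finset.Ioc a b, g c -
        ∑ i ∈ Finset.Ico a b, ((w (i + 1) - w i : ℝ) : ℂ) * ∑ c ∈ Finset.Ioc a i, g c := by
    intro b hb
    induction b, hb using Nat.le_induction with
    | base => simp
    | succ b hb ih =>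
      rw [Finset.sum_Ioc_succ_top hb, Finset.sum_Ioc_succ_top hb, Finset.sum_Ico_succ_top hb, ih]
      push_cast; ring
  have hD0 : 0 ≤ D := (norm_nonneg _).trans (hD a (by simp [hab]))
  have tel : ∑ i ∈ Finset.Ico a b, (w (i + 1) - w i) = w b - w a := Finset.sum_Ico_sub w hab
  have hwb : 0 ≤ w b := by
    have : 0 ≤ w b - w a := by
      rw [← tel]; exact Finset.sum_nonneg fun i hi => sub_nonneg.2 (hw i hi)
    linarith
  rw [key b hab]
  calc _ ≤ ‖(w b : ℂ) * ∑ c ∈ Finset.Ioc a b, g c‖ +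
        ‖∑ i ∈ Finset.Ico a b, ((w (i + 1) - w i : ℝ) : ℂ) * ∑ c ∈ Finset.Ioc a i, g c‖ :=
        norm_sub_le _ _
    _ ≤ w b * D + ∑ i ∈ Finset.Ico a b, (w (i + 1) - w i) * D := by
        gcongr
        · rw [norm_mul, Complex.norm_real, Real.norm_of_nonneg hwb]
          gcongr
          exact hD b (by simp [hab])
        · refine norm_sum_le_of_le _ fun i hi => ?_
          have h0 := sub_nonneg.2 (hw i hi)
          rw [norm_mul, Complex.norm_real, Real.norm_of_nonneg h0]
          gcongr
          exact hD i (Finset.Ico_subset_Icc_self hi)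
    _ = w b * D + (w b - w a) * D := by rw [← Finset.sum_mul, tel]
    _ ≤ _ := by nlinarith

/-- The part of an arithmetic function supported on `n ≤ U`. -/
noncomputable def lowPart (U : ℕ) (f : ArithmeticFunction ℝ) : ArithmeticFunction ℝ :=
  ⟨fun n => if n ≤ U then f n else 0, by simp⟩

/-- The part of an arithmetic function supported on `n > U`. -/
noncomputable def highPart (U : ℕ) (f : ArithmeticFunction ℝ) : ArithmeticFunction ℝ :=
  ⟨fun n => if n ≤ U then 0 else f n, by simp⟩

theorem lowPart_apply (U : ℕ) (f : ArithmeticFunction ℝ) (n : ℕ) :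
    lowPart U f n = if n ≤ U then f n else 0 := rfl

theorem highPart_apply (U : ℕ) (f : ArithmeticFunction ℝ) (n : ℕ) :
    highPart U f n = if n ≤ U then 0 else f n := rfl

theorem lowPart_add_highPart (U : ℕ) (f : ArithmeticFunction ℝ) :
    lowPart U f + highPart U f = f := by
  ext n
  rw [ArithmeticFunction.add_apply, lowPart_apply, highPart_apply]
  split_ifs <;> simp

open ArithmeticFunction in
theorem vaughan_identity (U V : ℕ) :
    (vonMangoldt : ArithmeticFunction ℝ) = lowPart U vonMangoldt +
      lowPart V (moebius : ArithmeticFunction ℝ) * ArithmeticFunction.log -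
      lowPart V (moebius : ArithmeticFunction ℝ) * lowPart U vonMangoldt *
        (ArithmeticFunction.zeta : ArithmeticFunction ℝ) +
      highPart V (moebius : ArithmeticFunction ℝ) * (highPart U vonMangoldt *
        (ArithmeticFunction.zeta : ArithmeticFunction ℝ)) := by
  have h1 := lowPart_add_highPart U vonMangoldt
  have h2 := lowPart_add_highPart V (moebius : ArithmeticFunction ℝ)
  have h3 : (moebius : ArithmeticFunction ℝ) * (ArithmeticFunction.zeta : ArithmeticFunction ℝ) = 1 :=
    ArithmeticFunction.coe_moebius_mul_coe_zeta
  have h4 := ArithmeticFunction.vonMangoldt_mul_zeta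
  set Λ₁ := lowPart U vonMangoldt
  set Λ₂ := highPart U vonMangoldt
  set μ₁ := lowPart V (moebius : ArithmeticFunction ℝ)
  set μ₂ := highPart V (moebius : ArithmeticFunction ℝ)
  rw [← h4, ← h1]
  rw [← h2] at h3
  linear_combination (-Λ₂) * h3

open ArithmeticFunction in
theorem mul_zeta_bounds (f : ArithmeticFunction ℝ) (h0 : ∀ n, 0 ≤ f n)
    (h1 : ∀ n, f n ≤ vonMangoldt n) (n : ℕ) :
    0 ≤ (f * (ArithmeticFunction.zeta : ArithmeticFunction ℝ)) n ∧
      (f * (ArithmeticFunction.zeta : ArithmeticFunction ℝ)) n ≤ Real.log n := by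
  rw [ArithmeticFunction.coe_mul_zeta_apply]
  refine ⟨Finset.sum_nonneg fun i _ => h0 i, ?_⟩
  rw [← ArithmeticFunction.vonMangoldt_sum]
  exact Finset.sum_le_sum fun i _ => h1 i

open ArithmeticFunction in
theorem abs_low_mul_low_le (U V n : ℕ) :
    |(lowPart V (moebius : ArithmeticFunction ℝ) * lowPart U vonMangoldt) n| ≤ Real.log n := by
  rw [ArithmeticFunction.mul_apply, ← ArithmeticFunction.vonMangoldt_sum,
    ← Nat.sum_divisorsAntidiagonal' (f := fun _ y => vonMangoldt y)]
  refine (Finset.abs_sum_le_sum_abs _ _).trans (Finset.sum_le_sum fun q _ => ?_)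
  rw [abs_mul, lowPart_apply, lowPart_apply]
  have a1 : |if q.1 ≤ V then (moebius : ArithmeticFunction ℝ) q.1 else 0| ≤ 1 := by
    split_ifs
    · rw [ArithmeticFunction.intCoe_apply]
      exact_mod_cast ArithmeticFunction.abs_moebius_le_one
    · simp
  have a2 : |if q.2 ≤ U then vonMangoldt q.2 else 0| ≤ vonMangoldt q.2 := by
    split_ifs
    · rw [abs_of_nonneg ArithmeticFunction.vonMangoldt_nonneg]
    · simp [ArithmeticFunction.vonMangoldt_nonneg]
  calc _ ≤ 1 * vonMangoldt q.2 := by gcongr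
    _ = _ := one_mul _

open ArithmeticFunction in
theorem low_mul_low_eq_zero {U V n : ℕ} (h : U * V < n) :
    (lowPart V (moebius : ArithmeticFunction ℝ) * lowPart U vonMangoldt) n = 0 := by
  rw [ArithmeticFunction.mul_apply]
  refine Finset.sum_eq_zero fun q hq => ?_
  rw [Nat.mem_divisorsAntidiagonal] at hq
  rw [lowPart_apply, lowPart_apply]
  split_ifs with h1 h2
  · exfalso
    have := Nat.mul_le_mul h2 h1
    rw [mul_comm q.2, hq.1] at this
    omega
  · simp
  · simp
  · simp

open ArithmeticFunction in
theorem high_mul_zeta_eq_zero {U n : ℕ} (h : n ≤ U) :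
    (highPart U vonMangoldt * (ArithmeticFunction.zeta : ArithmeticFunction ℝ)) n = 0 := by
  rw [ArithmeticFunction.coe_mul_zeta_apply]
  refine Finset.sum_eq_zero fun i hi => ?_
  rw [highPart_apply, if_pos ((Nat.divisor_le hi).trans h)]

theorem sum_inv_Ioc_le (n : ℕ) : ∑ b ∈ Finset.Ioc 0 n, (1 / (b : ℝ)) ≤ 1 + Real.log n := by
  have h := harmonic_le_one_add_log n
  rw [harmonic_eq_sum_Icc, show Finset.Icc 1 n = Finset.Ioc 0 n from
    Finset.Icc_add_one_left_eq_Ioc 0 n] at h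
  push_cast at h
  simpa [one_div] using h

theorem norm_typeI_le {P Q W : ℕ} (f : ℕ → ℂ) (A : ℕ → ℝ) (w : ℕ → ℝ) {T η : ℝ} (hη : 0 ≤ η)
    (hQ : Real.log Q ≤ T) (hA : ∀ b ∈ Finset.Ioc 0 Q, |A b| ≤ T)
    (hW : ∀ b, W < b → A b = 0) (hPQ : P ≤ Q) {R : ℝ}
    (hw0 : ∀ b ∈ Finset.Ioc 0 Q, 0 ≤ w (P / b))
    (hw1 : Monotone w) (hwR : ∀ n ≤ Q, w n ≤ R)
    (hI : ∀ b ∈ Finset.Ioc 0 W, ∀ c ∈ Finset.Icc (P / b) (Q / b),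
      ‖∑ i ∈ Finset.Ioc (P / b) c, f (b * i)‖ ≤ η * P / b) :
    ‖∑ b ∈ Finset.Ioc 0 Q, ∑ c ∈ Finset.Ioc (P / b) (Q / b), ((A b * w c : ℝ) : ℂ) * f (b * c)‖ ≤
      2 * T * R * (1 + T) * η * P := by
  rcases Nat.eq_zero_or_pos Q with h0 | hQ0
  · subst h0; simp at hPQ; subst hPQ; simp
  have hT : 0 ≤ T := (Real.log_natCast_nonneg Q).trans hQ
  have hR : 0 ≤ R := (hw0 Q (by simp [hQ0])).trans (hwR _ ((Nat.div_le_self _ _).trans hPQ))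
  calc _ ≤ ∑ b ∈ Finset.Ioc 0 Q, T * (2 * R * (η * P / b)) := by
        refine norm_sum_le_of_le _ fun b hb => ?_
        by_cases hbW : W < b
        · simp only [hW b hbW, zero_mul, Complex.ofReal_zero, Finset.sum_const_zero, norm_zero]
          positivity
        have hb' : b ∈ Finset.Ioc 0 W := by
          rw [mem_Ioc] at hb ⊢; omega
        have hab : P / b ≤ Q / b := Nat.div_le_div_right hPQ
        have e : ∑ c ∈ Finset.Ioc (P / b) (Q / b), ((A b * w c : ℝ) : ℂ) * f (b * c) =
            (A b : ℂ) * ∑ c ∈ Finset.Ioc (P / b) (Q / b), (w c : ℂ) * f (b * c) := by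
          rw [Finset.mul_sum]
          refine Finset.sum_congr rfl fun c _ => ?_
          push_cast; ring
        rw [e, norm_mul, Complex.norm_real, Real.norm_eq_abs]
        gcongr
        · exact hA b hb
        · refine (norm_sum_mul_le_of_monotone hab w (fun c => f (b * c)) (hw0 b hb)
            (fun i _ => hw1 (Nat.le_succ i)) (hI b hb')).trans ?_
          gcongr
          exact hwR _ (Nat.div_le_self _ _)
    _ = T * (2 * R * (η * P)) * ∑ b ∈ Finset.Ioc 0 Q, (1 / (b : ℝ)) := by
        rw [Finset.mul_sum]
        refine Finset.sum_congr rfl fun b _ => ?_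
        ring
    _ ≤ T * (2 * R * (η * P)) * (1 + T) := by
        gcongr
        exact (sum_inv_Ioc_le Q).trans (by linarith)
    _ = _ := by ring

theorem sum_norm_sq_comm {ι κ : Type*} (s : Finset ι) (t : Finset κ) (g : ι → κ → ℂ) :
    ∑ z ∈ t, ‖∑ x ∈ s, g x z‖ ^ 2 ≤
      ∑ x ∈ s, ∑ x' ∈ s, ‖∑ z ∈ t, g x z * (starRingEnd ℂ) (g x' z)‖ := by
  have e : ((∑ z ∈ t, ‖∑ x ∈ s, g x z‖ ^ 2 : ℝ) : ℂ) =
      ∑ x ∈ s, ∑ x' ∈ s, ∑ z ∈ t, g x z * (starRingEnd ℂ) (g x' z) := by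
    push_cast
    rw [Finset.sum_congr rfl fun x _ => Finset.sum_comm, Finset.sum_comm]
    refine Finset.sum_congr rfl fun z _ => ?_
    rw [← Complex.mul_conj', map_sum, Finset.sum_mul_sum]
  have h0 : 0 ≤ ∑ z ∈ t, ‖∑ x ∈ s, g x z‖ ^ 2 := Finset.sum_nonneg fun z _ => by positivity
  calc ∑ z ∈ t, ‖∑ x ∈ s, g x z‖ ^ 2 = ‖((∑ z ∈ t, ‖∑ x ∈ s, g x z‖ ^ 2 : ℝ) : ℂ)‖ := by
        rw [Complex.norm_real, Real.norm_of_nonneg h0]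
    _ ≤ _ := by
        rw [e]
        exact norm_sum_le_of_le _ fun x _ => norm_sum_le _ _

theorem norm_sum_mul_sq_le {κ : Type*} (t : Finset κ) (α : κ → ℝ) (h : κ → ℂ) {T : ℝ}
    (hα : ∀ z ∈ t, |α z| ≤ T) :
    ‖∑ z ∈ t, (α z : ℂ) * h z‖ ^ 2 ≤ T ^ 2 * t.card * ∑ z ∈ t, ‖h z‖ ^ 2 := by
  calc ‖∑ z ∈ t, (α z : ℂ) * h z‖ ^ 2 ≤ (∑ z ∈ t, |α z| * ‖h z‖) ^ 2 := by
        gcongr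
        refine norm_sum_le_of_le _ fun z _ => ?_
        rw [norm_mul, Complex.norm_real, Real.norm_eq_abs]
    _ ≤ (∑ z ∈ t, |α z| ^ 2) * ∑ z ∈ t, ‖h z‖ ^ 2 := Finset.sum_mul_sq_le_sq_mul_sq _ _ _
    _ ≤ (∑ z ∈ t, T ^ 2) * ∑ z ∈ t, ‖h z‖ ^ 2 := by
        gcongr with z hz
        exact hα z hz
    _ = _ := by rw [Finset.sum_const, nsmul_eq_mul]; ring

/-- The number of pairs in `[X, 2 * X)` at distance at most `h`. -/
theorem card_near_pairs_le (X : ℕ) {h : ℝ} (hh : 0 ≤ h) :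
    ∑ x ∈ Finset.Ico X (2 * X), ∑ x' ∈ Finset.Ico X (2 * X),
      (if |(x : ℝ) - x'| ≤ h then (1 : ℝ) else 0) ≤ X * (2 * h + 1) := by
  calc _ ≤ ∑ x ∈ Finset.Ico X (2 * X), (2 * h + 1) := by
        refine Finset.sum_le_sum fun x _ => ?_
        rw [Finset.sum_ite, Finset.sum_const_zero, add_zero, Finset.sum_const, nsmul_eq_mul, mul_one]
        have hsub : ((Finset.Ico X (2 * X)).filter fun x' : ℕ => |(x : ℝ) - x'| ≤ h) ⊆
            Finset.Icc (x - ⌊h⌋₊) (x + ⌊h⌋₊) := by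
          intro x' hx'
          rw [mem_filter, abs_le] at hx'
          obtain ⟨-, h1, h2⟩ := hx'
          rw [mem_Icc]
          constructor
          · rw [tsub_le_iff_right]
            rcases le_or_gt x x' with h3 | h3
            · omega
            · have : x - x' ≤ ⌊h⌋₊ := Nat.le_floor (by rw [Nat.cast_sub h3.le]; linarith)
              omega
          · rcases le_or_gt x' x with h3 | h3
            · omega
            · have : x' - x ≤ ⌊h⌋₊ := Nat.le_floor (by rw [Nat.cast_sub h3.le]; linarith)
              omega
        have hf := Nat.floor_le hh
        calc (((Finset.Ico X (2 * X)).filter fun x' : ℕ => |(x : ℝ) - x'| ≤ h).card : ℝ) ≤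
              ((Finset.Icc (x - ⌊h⌋₊) (x + ⌊h⌋₊)).card : ℝ) := by
              exact_mod_cast Finset.card_le_card hsub
          _ ≤ ((2 * ⌊h⌋₊ + 1 : ℕ) : ℝ) := by
              rw [Nat.card_Icc]; exact_mod_cast (by omega)
          _ ≤ _ := by push_cast; linarith
    _ = _ := by
        rw [Finset.sum_const, Nat.card_Ico, nsmul_eq_mul]
        congr 2; omega

theorem norm_dyadic_typeII_sq_le {P U V X : ℕ} (f : ℕ → ℂ) (hf : ∀ n, ‖f n‖ ≤ 1)
    (β α : ℕ → ℝ) {T η : ℝ} (hη : 0 ≤ η) (hX : 1 ≤ X)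
    (hβ : ∀ x, |β x| ≤ 1) (hβV : ∀ x ≤ V, β x = 0) (hα : ∀ z ≤ 4 * P, |α z| ≤ T)
    (hαU : ∀ z ≤ U, α z = 0)
    (hII : ∀ x x' a c : ℕ, V < x → x < x' → x' < 2 * x → η * x / 2 ≤ (x' : ℝ) - x → U ≤ a → a < c →
      P / x ≤ a → c ≤ 4 * P / x' →
      ‖∑ z ∈ Finset.Ioc a c, f (x * z) * (starRingEnd ℂ) (f (x' * z))‖ ≤ η * P / x) :
    ‖∑ x ∈ Finset.Ico X (2 * X), ∑ z ∈ Finset.Ioc (P / x) (4 * P / x),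
      ((β x * α z : ℝ) : ℂ) * f (x * z)‖ ^ 2 ≤ T ^ 2 * (P : ℝ) ^ 2 * (36 * η + 16 / X) := by
  classical
  have hX0 : (0 : ℝ) < X := by exact_mod_cast hX
  set Z := 4 * P / X with hZ
  have hZ' : (Z : ℝ) ≤ 4 * P / X := by
    have := Nat.cast_div_le (α := ℝ) (m := 4 * P) (n := X)
    push_cast at this; exact this
  set g : ℕ → ℕ → ℂ := fun x z =>
    if P / x < z ∧ z ≤ 4 * P / x then (β x : ℂ) * f (x * z) else 0 with hg
  have hg1 : ∀ x z, ‖g x z‖ ≤ 1 := by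
    intro x z
    simp only [hg]
    split_ifs
    · rw [norm_mul, Complex.norm_real, Real.norm_eq_abs]
      exact mul_le_one₀ (hβ x) (norm_nonneg _) (hf _)
    · simp
  have e1 : ∑ x ∈ Finset.Ico X (2 * X), ∑ z ∈ Finset.Ioc (P / x) (4 * P / x),
      ((β x * α z : ℝ) : ℂ) * f (x * z) =
      ∑ z ∈ Finset.Ioc U Z, (α z : ℂ) * ∑ x ∈ Finset.Ico X (2 * X), g x z := by
    simp_rw [Finset.mul_sum]
    rw [Finset.sum_comm]
    refine Finset.sum_congr rfl fun x hx => ?_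
    rw [mem_Ico] at hx
    have hle : 4 * P / x ≤ Z := Nat.div_le_div_left hx.1 hX
    rw [← Finset.sum_filter_add_sum_filter_not (Finset.Ioc (P / x) (4 * P / x)) (fun z => U < z)]
    rw [Finset.sum_eq_zero (s := (Finset.Ioc (P / x) (4 * P / x)).filter fun z => ¬ U < z), add_zero]
    · rw [← Finset.sum_filter_add_sum_filter_not (Finset.Ioc U Z)
        (fun z => P / x < z ∧ z ≤ 4 * P / x)]
      rw [Finset.sum_eq_zero (s := (Finset.Ioc U Z).filter
        fun z => ¬ (P / x < z ∧ z ≤ 4 * P / x)), add_zero]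
      · have : (Finset.Ioc (P / x) (4 * P / x)).filter (fun z => U < z) =
            (Finset.Ioc U Z).filter (fun z => P / x < z ∧ z ≤ 4 * P / x) := by
          ext z; simp only [mem_filter, mem_Ioc]; constructor
          · rintro ⟨⟨h1, h2⟩, h3⟩; exact ⟨⟨h3, h2.trans hle⟩, h1, h2⟩
          · rintro ⟨⟨h3, -⟩, h1, h2⟩; exact ⟨⟨h1, h2⟩, h3⟩
        rw [this]
        refine Finset.sum_congr rfl fun z hz => ?_
        rw [mem_filter] at hz
        simp only [hg]
        rw [if_pos hz.2]; push_cast; ring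
      · intro z hz
        rw [mem_filter] at hz
        simp only [hg]
        rw [if_neg hz.2, mul_zero]
    · intro z hz
      rw [mem_filter] at hz
      rw [hαU z (not_lt.1 hz.2)]; simp
  rw [e1]
  have hcardZ : ((Finset.Ioc U Z).card : ℝ) ≤ Z := by
    rw [Nat.card_Ioc]; exact_mod_cast Nat.sub_le _ _
  have hpair : ∀ x ∈ Finset.Ico X (2 * X), ∀ x' ∈ Finset.Ico X (2 * X),
      ‖∑ z ∈ Finset.Ioc U Z, g x z * (starRingEnd ℂ) (g x' z)‖ ≤
      4 * P / X * (if |(x : ℝ) - x'| ≤ η * X then (1 : ℝ) else 0) + η * P / X := by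
    have far : ∀ x ∈ Finset.Ico X (2 * X), ∀ x' ∈ Finset.Ico X (2 * X), x < x' →
        η * X ≤ (x' : ℝ) - x → ‖∑ z ∈ Finset.Ioc U Z, g x z * (starRingEnd ℂ) (g x' z)‖ ≤
        η * P / X := by
      intro x hx x' hx' hlt hd
      rw [mem_Ico] at hx hx'
      have hRHS : η * P / x ≤ η * P / X := by
        gcongr; exact hx.1
      rcases le_or_gt x V with hxV | hxV
      · rw [Finset.sum_eq_zero]
        · rw [norm_zero]; positivity
        · intro z _; simp [hg, hβV x hxV]
      have e2 : ∑ z ∈ Finset.Ioc U Z, g x z * (starRingEnd ℂ) (g x' z) =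
          ∑ z ∈ Finset.Ioc (max U (P / x)) (4 * P / x'),
            ((β x * β x' : ℝ) : ℂ) * (f (x * z) * (starRingEnd ℂ) (f (x' * z))) := by
        symm
        refine Finset.sum_subset_zero_on_sdiff ?_ ?_ ?_
        · intro z hz
          rw [mem_Ioc] at hz ⊢
          exact ⟨(le_max_left _ _).trans_lt hz.1, hz.2.trans (Nat.div_le_div_left hx'.1 hX)⟩
        · intro z hz
          rw [mem_sdiff, mem_Ioc, mem_Ioc] at hz
          simp only [hg]
          by_cases h1 : P / x < z ∧ z ≤ 4 * P / x
          · by_cases h2 : P / x' < z ∧ z ≤ 4 * P / x'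
            · exact absurd ⟨max_lt hz.1.1 h1.1, h2.2⟩ hz.2
            · rw [if_neg h2]; simp
          · rw [if_neg h1]; simp
        · intro z hz
          rw [mem_Ioc] at hz
          have h1 : P / x < z := (le_max_right _ _).trans_lt hz.1
          have h2 : P / x' < z := (Nat.div_le_div_left hlt.le (by omega)).trans_lt h1
          have h3 : z ≤ 4 * P / x := hz.2.trans (Nat.div_le_div_left hlt.le (by omega))
          simp only [hg]
          rw [if_pos ⟨h1, h3⟩, if_pos ⟨h2, hz.2⟩, map_mul, Complex.conj_ofReal]
          push_cast; ring
      rw [e2, ← Finset.mul_sum, norm_mul, Complex.norm_real, Real.norm_eq_abs, abs_mul]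
      rcases lt_or_ge (max U (P / x)) (4 * P / x') with hac | hac
      · have := hII x x' _ _ hxV hlt (by omega) (by
          have : (x : ℝ) ≤ 2 * X := by exact_mod_cast hx.2.le
          calc η * x / 2 ≤ η * (2 * X) / 2 := by gcongr
            _ ≤ _ := by linarith) (le_max_left _ _) hac (le_max_right _ _) le_rfl
        calc _ ≤ 1 * (η * P / x) := by
              gcongr
              exact mul_le_one₀ (hβ x) (abs_nonneg _) (hβ x')
          _ ≤ _ := by rw [one_mul]; exact hRHS
      · rw [Finset.Ioc_eq_empty_of_le hac, Finset.sum_empty, norm_zero, mul_zero]; positivity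
    intro x hx x' hx'
    split_ifs with hnear
    · refine le_trans (norm_sum_le_of_le (n := fun _ => (1 : ℝ)) _ fun z _ => ?_) ?_
      · rw [norm_mul, RCLike.norm_conj]
        exact mul_le_one₀ (hg1 _ _) (norm_nonneg _) (hg1 _ _)
      · rw [Finset.sum_const, nsmul_eq_mul, mul_one, mul_one]
        have : 0 ≤ η * P / X := by positivity
        linarith
    · rw [mul_zero, zero_add]
      rcases lt_trichotomy x x' with h | h | h
      · refine far x hx x' hx' h ?_
        rw [abs_sub_comm, abs_of_pos (by rw [sub_pos]; exact_mod_cast h)] at hnear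
        linarith
      · subst h; simp only [sub_self, abs_zero, not_le] at hnear
        exact absurd hnear (not_lt.2 (by positivity))
      · have e3 : ∑ z ∈ Finset.Ioc U Z, g x z * (starRingEnd ℂ) (g x' z) =
            (starRingEnd ℂ) (∑ z ∈ Finset.Ioc U Z, g x' z * (starRingEnd ℂ) (g x z)) := by
          rw [map_sum]
          refine Finset.sum_congr rfl fun z _ => ?_
          rw [map_mul, Complex.conj_conj, mul_comm]
        rw [e3, RCLike.norm_conj]
        refine far x' hx' x hx h ?_
        rw [abs_of_pos (by rw [sub_pos]; exact_mod_cast h)] at hnear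
        linarith
  have hαT : ∀ z ∈ Finset.Ioc U Z, |α z| ≤ T := by
    intro z hz
    rw [mem_Ioc] at hz
    exact hα z (hz.2.trans (Nat.div_le_self _ _))
  calc _ ≤ T ^ 2 * (Finset.Ioc U Z).card * ∑ z ∈ Finset.Ioc U Z,
        ‖∑ x ∈ Finset.Ico X (2 * X), g x z‖ ^ 2 := norm_sum_mul_sq_le _ _ _ hαT
    _ ≤ T ^ 2 * (4 * P / X) * ∑ x ∈ Finset.Ico X (2 * X), ∑ x' ∈ Finset.Ico X (2 * X),
        (4 * P / X * (if |(x : ℝ) - x'| ≤ η * X then (1 : ℝ) else 0) + η * P / X) := by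
        gcongr
        · exact hcardZ.trans hZ'
        · refine (sum_norm_sq_comm _ _ g).trans ?_
          exact Finset.sum_le_sum fun x hx => Finset.sum_le_sum fun x' hx' => hpair x hx x' hx'
    _ = T ^ 2 * (4 * P / X) * (4 * P / X * (∑ x ∈ Finset.Ico X (2 * X),
          ∑ x' ∈ Finset.Ico X (2 * X), (if |(x : ℝ) - x'| ≤ η * X then (1 : ℝ) else 0)) +
          X * X * (η * P / X)) := by
        have hc : 2 * X - X = X := by omega
        simp only [Finset.sum_add_distrib, ← Finset.mul_sum, Finset.sum_const, Nat.card_Ico,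
          nsmul_eq_mul, hc]
        ring
    _ ≤ T ^ 2 * (4 * P / X) * (4 * P / X * (X * (2 * (η * X) + 1)) + X * X * (η * P / X)) := by
        gcongr
        exact card_near_pairs_le X (by positivity)
    _ = _ := by field_simp; ring

theorem sum_Ico_dyadic {R : Type*} [AddCommMonoid R] (F : ℕ → R) (N : ℕ) :
    ∑ x ∈ Finset.Ico 1 (2 ^ N), F x =
      ∑ i ∈ Finset.range N, ∑ x ∈ Finset.Ico (2 ^ i) (2 * 2 ^ i), F x := by
  induction N with
  | zero => simp
  | succ N ih =>
    rw [Finset.sum_range_succ, ← ih, ← pow_succ', Finset.sum_Ico_consecutive]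
    · exact Nat.one_le_two_pow
    · exact Nat.pow_le_pow_right (by norm_num) (Nat.le_succ N)

theorem log_two_le_two_mul_log {Q : ℕ} (hQ : 1 ≤ Q) : (Nat.log 2 Q : ℝ) ≤ 2 * Real.log Q := by
  have h1 : ((2 ^ Nat.log 2 Q : ℕ) : ℝ) ≤ Q := by exact_mod_cast Nat.pow_log_le_self 2 (by omega)
  have h2 := Real.log_le_log (by positivity) h1
  push_cast at h2
  rw [Real.log_pow] at h2
  have := Real.log_two_gt_d9
  nlinarith [show (0 : ℝ) ≤ Nat.log 2 Q from Nat.cast_nonneg _]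

theorem norm_typeII_le {P U V : ℕ} (hP : 1 ≤ P) (f : ℕ → ℂ) (hf : ∀ n, ‖f n‖ ≤ 1)
    (β α : ℕ → ℝ) {T ρ : ℝ} (hρ : 0 < ρ) (hT1 : 1 ≤ T) (hT : Real.log (4 * P) ≤ T)
    (hV : 2 ≤ ρ ^ 2 * V)
    (hβ : ∀ x, |β x| ≤ 1) (hβV : ∀ x ≤ V, β x = 0) (hα : ∀ z ≤ 4 * P, |α z| ≤ T)
    (hαU : ∀ z ≤ U, α z = 0)
    (hII : ∀ x x' a c : ℕ, V < x → x < x' → x' < 2 * x → ρ ^ 2 * x / 2 ≤ (x' : ℝ) - x → U ≤ a →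
      a < c → P / x ≤ a → c ≤ 4 * P / x' →
      ‖∑ z ∈ Finset.Ioc a c, f (x * z) * (starRingEnd ℂ) (f (x' * z))‖ ≤ ρ ^ 2 * P / x) :
    ‖∑ x ∈ Finset.Ioc 0 (4 * P), ∑ z ∈ Finset.Ioc (P / x) (4 * P / x),
      ((β x * α z : ℝ) : ℂ) * f (x * z)‖ ≤ 24 * T ^ 2 * P * ρ := by
  set F : ℕ → ℂ := fun x => ∑ z ∈ Finset.Ioc (P / x) (4 * P / x), ((β x * α z : ℝ) : ℂ) * f (x * z)
  set N := Nat.log 2 (4 * P) + 1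
  have hN : 4 * P < 2 ^ N := Nat.lt_pow_succ_log_self (by norm_num) _
  have hN3 : (N : ℝ) ≤ 3 * T := by
    have := log_two_le_two_mul_log (Q := 4 * P) (by omega)
    push_cast at this
    simp only [N]; push_cast; linarith
  have e : ∑ x ∈ Finset.Ioc 0 (4 * P), F x = ∑ i ∈ Finset.range N,
      ∑ x ∈ Finset.Ico (2 ^ i) (2 * 2 ^ i), F x := by
    rw [← sum_Ico_dyadic]
    refine Finset.sum_subset ?_ ?_
    · intro x hx
      rw [mem_Ioc] at hx; rw [mem_Ico]; omega
    · intro x hx hx'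
      rw [mem_Ico] at hx
      rw [mem_Ioc] at hx'
      have h : 4 * P / x = 0 := Nat.div_eq_of_lt (by omega)
      simp only [F, h]
      rw [Finset.Ioc_eq_empty_of_le (Nat.zero_le _), Finset.sum_empty]
  have hi : ∀ i ∈ Finset.range N, ‖∑ x ∈ Finset.Ico (2 ^ i) (2 * 2 ^ i), F x‖ ≤ T * P * (8 * ρ) := by
    intro i _
    rcases le_or_gt (2 * 2 ^ i) (V + 1) with h | h
    · rw [Finset.sum_eq_zero]
      · rw [norm_zero]; positivity
      · intro x hx
        rw [mem_Ico] at hx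
        simp only [F]
        refine Finset.sum_eq_zero fun z _ => ?_
        rw [hβV x (by omega)]; simp
    · have hb := norm_dyadic_typeII_sq_le (P := P) (X := 2 ^ i) f hf β α (η := ρ ^ 2) (by positivity)
        Nat.one_le_two_pow hβ hβV hα hαU hII
      refine le_of_sq_le_sq (hb.trans ?_) (by positivity)
      have hVi : (V : ℝ) ≤ 2 * (2 ^ i : ℕ) := by exact_mod_cast (by omega : V ≤ 2 * 2 ^ i)
      have h1 : 1 / ((2 ^ i : ℕ) : ℝ) ≤ ρ ^ 2 := by
        rw [div_le_iff₀ (by positivity)]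
        have : ρ ^ 2 * V ≤ ρ ^ 2 * (2 * (2 ^ i : ℕ)) := by gcongr
        linarith
      have h2 : 36 * ρ ^ 2 + 16 / ((2 ^ i : ℕ) : ℝ) ≤ 64 * ρ ^ 2 := by
        have : 16 / ((2 ^ i : ℕ) : ℝ) = 16 * (1 / ((2 ^ i : ℕ) : ℝ)) := by ring
        rw [this]; linarith [sq_nonneg ρ]
      calc _ ≤ T ^ 2 * (P : ℝ) ^ 2 * (64 * ρ ^ 2) := by gcongr
        _ = _ := by ring
  rw [e]
  refine (norm_sum_le_of_le _ hi).trans ?_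
  rw [Finset.sum_const, card_range, nsmul_eq_mul]
  calc (N : ℝ) * (T * P * (8 * ρ)) ≤ 3 * T * (T * P * (8 * ρ)) := by gcongr
    _ = _ := by ring

open ArithmeticFunction in
theorem vaughan_sum {P U V : ℕ} (hU : 1 ≤ U) (hUP : U ≤ P) (f : ℕ → ℂ)
    (hf : ∀ n, ‖f n‖ ≤ 1) {T ρ : ℝ} (hρ : 0 < ρ) (hρ1 : ρ ≤ 1) (hT1 : 1 ≤ T)
    (hT : Real.log (4 * P) ≤ T) (hV : 2 ≤ ρ ^ 2 * V)
    (hI : ∀ b ∈ Finset.Ioc 0 (U * V), ∀ c ∈ Finset.Icc (P / b) (4 * P / b),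
      ‖∑ i ∈ Finset.Ioc (P / b) c, f (b * i)‖ ≤ ρ ^ 2 * P / b)
    (hII : ∀ x x' a c : ℕ, V < x → x < x' → x' < 2 * x → ρ ^ 2 * x / 2 ≤ (x' : ℝ) - x → U ≤ a →
      a < c → P / x ≤ a → c ≤ 4 * P / x' →
      ‖∑ z ∈ Finset.Ioc a c, f (x * z) * (starRingEnd ℂ) (f (x' * z))‖ ≤ ρ ^ 2 * P / x) :
    ‖∑ d ∈ Finset.Ioc P (4 * P), (vonMangoldt d : ℂ) * f d‖ ≤ 32 * T ^ 3 * P * ρ := by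
  have hP : 1 ≤ P := hU.trans hUP
  have hTQ : Real.log ((4 * P : ℕ) : ℝ) ≤ T := by push_cast; exact hT
  have hlog : ∀ n : ℕ, n ≤ 4 * P → Real.log n ≤ T := by
    intro n hn
    rcases Nat.eq_zero_or_pos n with rfl | h0
    · simp; linarith
    · exact (Real.log_le_log (by exact_mod_cast h0) (by exact_mod_cast hn)).trans hTQ
  set μ₁ := lowPart V (moebius : ArithmeticFunction ℝ) with hμ₁
  set μ₂ := highPart V (moebius : ArithmeticFunction ℝ) with hμ₂
  set A := μ₁ * lowPart U vonMangoldt with hA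
  set α := highPart U vonMangoldt * (ArithmeticFunction.zeta : ArithmeticFunction ℝ) with hαd
  have hmu : ∀ n, |(moebius : ArithmeticFunction ℝ) n| ≤ 1 := fun n => by
    rw [ArithmeticFunction.intCoe_apply]
    exact_mod_cast ArithmeticFunction.abs_moebius_le_one
  have hμ₁1 : ∀ n, |μ₁ n| ≤ 1 := fun n => by
    rw [hμ₁, lowPart_apply]; split_ifs
    · exact hmu n
    · simp
  have hμ₂1 : ∀ n, |μ₂ n| ≤ 1 := fun n => by
    rw [hμ₂, highPart_apply]; split_ifs
    · simp
    · exact hmu n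
  have hα := mul_zeta_bounds (highPart U vonMangoldt)
    (fun n => by rw [highPart_apply]; split_ifs <;> simp [ArithmeticFunction.vonMangoldt_nonneg])
    (fun n => by rw [highPart_apply]; split_ifs <;> simp [ArithmeticFunction.vonMangoldt_nonneg])
  have split : ∑ d ∈ Finset.Ioc P (4 * P), (vonMangoldt d : ℂ) * f d =
      ∑ b ∈ Finset.Ioc 0 (4 * P), ∑ c ∈ Finset.Ioc (P / b) (4 * P / b),
        ((μ₁ b * Real.log c : ℝ) : ℂ) * f (b * c) -
      ∑ b ∈ Finset.Ioc 0 (4 * P), ∑ c ∈ Finset.Ioc (P / b) (4 * P / b),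
        ((A b * (fun _ => 1 : ℕ → ℝ) c : ℝ) : ℂ) * f (b * c) +
      ∑ b ∈ Finset.Ioc 0 (4 * P), ∑ c ∈ Finset.Ioc (P / b) (4 * P / b),
        ((μ₂ b * α c : ℝ) : ℂ) * f (b * c) := by
    rw [← sum_Ioc_divisorsAntidiagonal P (4 * P) fun b c => ((μ₁ b * Real.log c : ℝ) : ℂ) * f (b * c),
      ← sum_Ioc_divisorsAntidiagonal P (4 * P) fun b c =>
        ((A b * (fun _ => 1 : ℕ → ℝ) c : ℝ) : ℂ) * f (b * c),
      ← sum_Ioc_divisorsAntidiagonal P (4 * P) fun b c => ((μ₂ b * α c : ℝ) : ℂ) * f (b * c),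
      ← Finset.sum_sub_distrib, ← Finset.sum_add_distrib]
    refine Finset.sum_congr rfl fun d hd => ?_
    rw [mem_Ioc] at hd
    have hv : vonMangoldt d = (μ₁ * ArithmeticFunction.log) d -
        (A * (ArithmeticFunction.zeta : ArithmeticFunction ℝ)) d + (μ₂ * α) d := by
      conv_lhs => rw [vaughan_identity U V]
      rw [ArithmeticFunction.add_apply, sub_eq_add_neg, ArithmeticFunction.add_apply,
        ArithmeticFunction.neg_apply, ← sub_eq_add_neg, ArithmeticFunction.add_apply, lowPart_apply, if_neg (by omega), zero_add]
    have h1 : ∀ G : ℕ → ℕ → ℝ, ∑ q ∈ d.divisorsAntidiagonal, ((G q.1 q.2 : ℝ) : ℂ) * f (q.1 * q.2) =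
        ((∑ q ∈ d.divisorsAntidiagonal, G q.1 q.2 : ℝ) : ℂ) * f d := by
      intro G
      push_cast
      rw [Finset.sum_mul]
      refine Finset.sum_congr rfl fun q hq => ?_
      rw [(Nat.mem_divisorsAntidiagonal.1 hq).1]
    have h3 : (μ₁ * ArithmeticFunction.log) d =
        ∑ q ∈ d.divisorsAntidiagonal, μ₁ q.1 * Real.log q.2 := by
      rw [ArithmeticFunction.mul_apply]; rfl
    have h4 : (A * (ArithmeticFunction.zeta : ArithmeticFunction ℝ)) d =
        ∑ q ∈ d.divisorsAntidiagonal, A q.1 * (fun _ => 1 : ℕ → ℝ) q.2 := by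
      rw [ArithmeticFunction.mul_apply]
      refine Finset.sum_congr rfl fun q hq => ?_
      have h2 : q.2 ≠ 0 := by
        have := Nat.mem_divisorsAntidiagonal.1 hq
        exact right_ne_zero_of_mul (this.1 ▸ this.2)
      rw [ArithmeticFunction.natCoe_apply, ArithmeticFunction.zeta_apply, if_neg h2]; simp
    rw [h1 fun b c => μ₁ b * Real.log c, h1 fun b c => A b * (fun _ => 1 : ℕ → ℝ) c,
      h1 fun b c => μ₂ b * α c, hv, h3, h4, ArithmeticFunction.mul_apply, ← sub_mul, ← add_mul,
      Complex.ofReal_add, Complex.ofReal_sub]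
  have b1 := norm_typeI_le (P := P) (Q := 4 * P) (W := U * V) f (fun b => μ₁ b)
    (fun c => Real.log c) (η := ρ ^ 2) (R := T) (by positivity) hTQ (fun b _ => (hμ₁1 b).trans hT1)
    (fun b hb => by
      simp only [hμ₁, lowPart_apply]
      rw [if_neg]; nlinarith) (by omega) (fun b _ => Real.log_natCast_nonneg _)
    (by
      intro m n hmn
      rcases Nat.eq_zero_or_pos m with rfl | h0
      · simp [Real.log_natCast_nonneg]
      · exact Real.log_le_log (by exact_mod_cast h0) (by exact_mod_cast hmn))
    hlog hI
  have b2 := norm_typeI_le (P := P) (Q := 4 * P) (W := U * V) f (fun b => A b)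
    (fun _ => 1) (η := ρ ^ 2) (R := 1) (by positivity) hTQ
    (fun b hb => (abs_low_mul_low_le U V b).trans (hlog b (mem_Ioc.1 hb).2))
    (fun b hb => low_mul_low_eq_zero hb) (by omega) (fun b _ => zero_le_one)
    monotone_const (fun _ _ => le_rfl) hI
  have b3 := norm_typeII_le hP f hf (fun b => μ₂ b) (fun c => α c) hρ hT1 hT hV hμ₂1
    (fun x hx => by simp only [hμ₂, highPart_apply]; rw [if_pos hx])
    (fun z hz => by rw [abs_of_nonneg (hα z).1]; exact (hα z).2.trans (hlog z hz))
    (fun z hz => high_mul_zeta_eq_zero hz) hII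
  rw [split]
  have hρ2 : ρ ^ 2 ≤ ρ := by nlinarith
  have hT2 : T ^ 2 ≤ T ^ 3 := pow_le_pow_right₀ hT1 (by norm_num)
  have hT3 : T ≤ T ^ 2 := by nlinarith
  calc _ ≤ 2 * T * T * (1 + T) * ρ ^ 2 * P + 2 * T * 1 * (1 + T) * ρ ^ 2 * P +
        24 * T ^ 2 * P * ρ := (norm_add_le _ _).trans
          (add_le_add ((norm_sub_le _ _).trans (add_le_add b1 b2)) b3)
    _ = ((2 * T ^ 3 + 4 * T ^ 2 + 2 * T) * ρ ^ 2 + 24 * T ^ 2 * ρ) * P := by ring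
    _ ≤ ((2 * T ^ 3 + 4 * T ^ 3 + 2 * T ^ 3) * ρ + 24 * T ^ 3 * ρ) * P := by
        gcongr
        exact hT3.trans hT2
    _ = _ := by ring

open Filter in
theorem eventually_mul_pow_le_exp {a r : ℝ} (ha : 0 < a) (hr : 0 < r) (C : ℝ) (n : ℕ) :
    ∀ᶠ X : ℝ in atTop, C * X ^ n ≤ Real.exp (a * X ^ r) := by
  have h1 : ∀ᶠ X : ℝ in atTop, ‖Real.log X‖ ≤ a / (n + 1) * ‖X ^ r‖ :=
    (isLittleO_log_rpow_atTop hr).def (by positivity)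
  have h2 : ∀ᶠ X : ℝ in atTop, C ≤ X := eventually_ge_atTop C
  filter_upwards [h1, h2, eventually_ge_atTop 1] with X h1 h2 h3
  have h0 : 0 < X := by linarith
  rw [Real.norm_of_nonneg (Real.log_nonneg h3), Real.norm_of_nonneg (by positivity)] at h1
  calc C * X ^ n ≤ X * X ^ n := by gcongr
    _ = Real.exp ((n + 1 : ℕ) * Real.log X) := by
        rw [Real.exp_nat_mul, Real.exp_log h0, pow_succ']
    _ ≤ _ := by
        apply Real.exp_le_exp.2
        push_cast
        calc ((n : ℝ) + 1) * Real.log X ≤ (n + 1) * (a / (n + 1) * X ^ r) := by gcongr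
          _ = _ := by field_simp

open Filter in
theorem eventually_le_rpow {r : ℝ} (hr : 0 < r) (C : ℝ) : ∀ᶠ X : ℝ in atTop, C ≤ X ^ r :=
  (tendsto_rpow_atTop hr).eventually_ge_atTop C

open Filter in
/-- Uniform version of `smooth_sum` in the Vinogradov range `X ^ (2 / 3 + e) ≤ log (length)`. -/
theorem smooth_sum_uniform {c0 e : ℝ} (hc0 : 0 < c0) (hc1 : c0 ≤ 1) (he : 0 < e) (A : ℕ) :
    ∀ᶠ X : ℝ in atTop, ∀ (τ ℓ u v : ℝ) (j a b : ℕ), X ^ ((2 : ℝ) / 3 + e) ≤ τ → τ / 4 ≤ ℓ → ℓ ≤ τ →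
      2 ≤ j → (j : ℝ) ≤ 2 * X / τ + 2 → Real.exp (c0 * τ) ≤ |u| / Real.exp ℓ + |v| / Real.exp ℓ ^ j →
      |u| / Real.exp ℓ + |v| / Real.exp ℓ ^ j ≤ Real.exp (4 * X) →
      (∀ x ∈ Finset.Ioc a b, Real.exp ℓ ≤ (x : ℝ) ∧ (x : ℝ) ≤ 4 * Real.exp ℓ) →
      ‖∑ x ∈ Finset.Ioc a b, ee (u / x + v / (x : ℝ) ^ j)‖ ≤ Real.exp ℓ / X ^ A := by
  obtain ⟨K, c, hK, hc, H⟩ := smooth_sum c0 hc0 hc1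
  filter_upwards [eventually_ge_atTop 1, eventually_le_rpow (show 0 < 3 * e by linarith) (1024 * K),
    eventually_le_rpow (show (0 : ℝ) < 1 / 3 by norm_num) (16 * K),
    eventually_mul_pow_le_exp (show 0 < c / 1024 by positivity) (show 0 < 3 * e by linarith) 80 A]
    with X hX1 hX2 hX3 hX4
  intro τ ℓ u v j a b hτ hℓ1 hℓ2 hj hj2 hF1 hF2 hx
  have hX0 : 0 < X := by linarith
  have hτX : X ^ ((2 : ℝ) / 3) ≤ τ :=
    (Real.rpow_le_rpow_of_exponent_le hX1 (by linarith)).trans hτ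
  have hτ0 : 0 < τ := lt_of_lt_of_le (by positivity) hτX
  have hℓ0 : 0 < ℓ := by linarith
  have hτ3 : X ^ (3 * e) * X ^ 2 ≤ τ ^ 3 := by
    calc X ^ (3 * e) * X ^ 2 = (X ^ ((2 : ℝ) / 3 + e)) ^ 3 := by
          rw [← Real.rpow_natCast (X ^ ((2 : ℝ) / 3 + e)), ← Real.rpow_mul hX0.le,
            ← Real.rpow_natCast X 2, ← Real.rpow_add hX0]
          congr 1; push_cast; ring
      _ ≤ _ := by gcongr
  have hℓ3 : X ^ (3 * e) * X ^ 2 / 64 ≤ ℓ ^ 3 := by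
    calc _ ≤ τ ^ 3 / 64 := by gcongr
      _ = (τ / 4) ^ 3 := by ring
      _ ≤ _ := by gcongr
  set F := |u| / Real.exp ℓ + |v| / Real.exp ℓ ^ j with hFdef
  have hF0 : 0 < F := lt_of_lt_of_le (Real.exp_pos _) hF1
  set w := Real.log F / ℓ with hw
  have hwℓ : w * ℓ = Real.log F := by rw [hw]; field_simp
  have hw1 : c0 ≤ w := by
    rw [hw, le_div_iff₀ hℓ0]
    calc c0 * ℓ ≤ c0 * τ := by gcongr
      _ ≤ _ := by rwa [Real.le_log_iff_exp_le hF0]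
  have hw0 : 0 < w := hc0.trans_le hw1
  have hw2 : w * ℓ ≤ 4 * X := by rw [hwℓ]; rwa [Real.log_le_iff_le_exp hF0]
  have hw3 : w ^ 2 * ℓ ^ 2 ≤ 16 * X ^ 2 := by
    calc w ^ 2 * ℓ ^ 2 = (w * ℓ) ^ 2 := by ring
      _ ≤ (4 * X) ^ 2 := by gcongr
      _ = _ := by ring
  have hmain := H ℓ w u v j a b hj hw1 ?_ ?_ (by rw [hwℓ, Real.exp_log hF0]) hx
  · refine hmain.trans ?_
    have hs : c / 1024 * X ^ (3 * e) ≤ c * ℓ / w ^ 2 := by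
      rw [le_div_iff₀ (by positivity)]
      refine le_of_mul_le_mul_right ?_ (show 0 < ℓ ^ 2 by positivity)
      calc c / 1024 * X ^ (3 * e) * w ^ 2 * ℓ ^ 2 = c / 1024 * X ^ (3 * e) * (w ^ 2 * ℓ ^ 2) := by ring
        _ ≤ c / 1024 * X ^ (3 * e) * (16 * X ^ 2) := by gcongr
        _ = c * (X ^ (3 * e) * X ^ 2 / 64) := by ring
        _ ≤ c * ℓ ^ 3 := by gcongr
        _ = _ := by ring
    have hX4' := hX4.trans (Real.exp_le_exp.2 hs)
    rw [Real.exp_sub, le_div_iff₀ (by positivity)]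
    calc 80 * (Real.exp ℓ / Real.exp (c * ℓ / w ^ 2)) * X ^ A =
          Real.exp ℓ * (80 * X ^ A / Real.exp (c * ℓ / w ^ 2)) := by ring
      _ ≤ Real.exp ℓ * 1 := by
          gcongr
          rwa [div_le_one (Real.exp_pos _)]
      _ = _ := mul_one _
  · refine le_of_mul_le_mul_right ?_ (show 0 < ℓ ^ 2 by positivity)
    calc K * w ^ 2 * ℓ ^ 2 = K * (w ^ 2 * ℓ ^ 2) := by ring
      _ ≤ K * (16 * X ^ 2) := by gcongr
      _ = 1024 * K * X ^ 2 / 64 := by ring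
      _ ≤ X ^ (3 * e) * X ^ 2 / 64 := by gcongr
      _ ≤ ℓ ^ 3 := hℓ3
      _ = _ := by ring
  · have h1 : X ^ ((1 : ℝ) / 3) ≤ τ :=
      (Real.rpow_le_rpow_of_exponent_le hX1 (by norm_num)).trans hτX
    have h2 : X ^ ((1 : ℝ) / 3) * X ≤ τ ^ 2 := by
      calc X ^ ((1 : ℝ) / 3) * X = (X ^ ((2 : ℝ) / 3)) ^ 2 := by
            rw [← Real.rpow_natCast (X ^ ((2 : ℝ) / 3)), ← Real.rpow_mul hX0.le,
              ← Real.rpow_add_one hX0.ne']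
            congr 1; push_cast; ring
        _ ≤ _ := by gcongr
    have h3 : 16 * K * X ≤ τ ^ 2 := le_trans (by gcongr) h2
    have h4 : K * (2 * X / τ) ≤ τ / 8 := by
      rw [← mul_div_assoc, div_le_iff₀ hτ0]; linarith
    calc K * (j : ℝ) ≤ K * (2 * X / τ + 2) := by gcongr
      _ ≤ τ / 4 := by rw [mul_add]; linarith
      _ ≤ ℓ := hℓ1

theorem ee_typeI_phase (u v : ℝ) (j : ℕ) {b : ℝ} (i : ℝ) :
    u / (b * i) + v / (b * i) ^ j = (u / b) / i + (v / b ^ j) / i ^ j := by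
  rw [mul_pow, div_div, div_div]

open Filter in
/-- Exponential sums over prime powers with phases `u / d + v / d ^ j`. -/
theorem prime_sum {c0 e : ℝ} (hc0 : 0 < c0) (hc1 : c0 ≤ 1) (he : 0 < e) (A : ℕ) :
    ∀ᶠ X : ℝ in atTop, ∀ (P j : ℕ) (u v : ℝ), X ^ ((2 : ℝ) / 3 + e) ≤ Real.log P →
      Real.log P ≤ X → 2 ≤ j → (j : ℝ) ≤ 2 * X / Real.log P + 2 →
      Real.exp (c0 * Real.log P) ≤ |u| / P + |v| / (P : ℝ) ^ j →
      |u| / P + |v| / (P : ℝ) ^ j ≤ Real.exp (4 * X) →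
      ‖∑ d ∈ Finset.Ioc P (4 * P), (ArithmeticFunction.vonMangoldt d : ℂ) *
        ee (u / d + v / (d : ℝ) ^ j)‖ ≤ P / X ^ A := by
  filter_upwards [eventually_ge_atTop 256, smooth_sum_uniform (c0 := c0 / 2) (by positivity)
    (by linarith) he (2 * A + 8), eventually_mul_pow_le_exp (show 0 < c0 / 24 by positivity)
    (show (0 : ℝ) < 2 / 3 by norm_num) 8 (2 * A + 8)] with X hX H hexp
  intro P j u v hτ1 hτX hj hj2 hF1 hF2
  have hX0 : 0 < X := by linarith
  have hX1 : 1 ≤ X := by linarith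
  set τ := Real.log P with hτdef
  have hτ2 : X ^ ((2 : ℝ) / 3) ≤ τ :=
    (Real.rpow_le_rpow_of_exponent_le hX1 (by linarith)).trans hτ1
  have hτ0 : 0 < τ := lt_of_lt_of_le (by positivity) hτ2
  have hP0 : (0 : ℝ) < P := by
    rcases Nat.eq_zero_or_pos P with h | h
    · simp [hτdef, h] at hτ0
    · exact_mod_cast h
  have hPe : Real.exp τ = P := Real.exp_log hP0
  have hXpow : 1 ≤ X ^ (2 * A + 8) := one_le_pow₀ hX1
  have hbig : ∀ a : ℝ, c0 / 24 ≤ a → 8 * X ^ (2 * A + 8) ≤ Real.exp (a * τ) := fun a ha =>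
    hexp.trans (Real.exp_le_exp.2 (by
      have : 0 ≤ a := le_trans (by positivity) ha
      gcongr))
  set F := |u| / P + |v| / (P : ℝ) ^ j with hF
  clear_value F τ
  set ρ : ℝ := 1 / X ^ (A + 4) with hρdef
  have hρ0 : 0 < ρ := by positivity
  have hρ1 : ρ ≤ 1 := by
    rw [hρdef, div_le_one (by positivity)]; exact one_le_pow₀ hX1
  have hρ2 : ρ ^ 2 = 1 / X ^ (2 * A + 8) := by
    rw [hρdef, div_pow, one_pow, ← pow_mul]; congr 2; ring
  set U := ⌊Real.exp (τ / 3)⌋₊ with hUdef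
  have hUle : (U : ℝ) ≤ Real.exp (τ / 3) := Nat.floor_le (Real.exp_pos _).le
  have hUge : Real.exp (τ / 3) / 2 ≤ U := by
    have h1 : Real.exp (τ / 3) < U + 1 := Nat.lt_floor_add_one _
    have h2 := hbig (1 / 3) (by linarith)
    rw [show 1 / 3 * τ = τ / 3 by ring] at h2
    linarith
  have hU4 : 4 * Real.exp (τ / 4) ≤ U := by
    have h2 := hbig (1 / 12) (by linarith)
    calc 4 * Real.exp (τ / 4) = 8 * Real.exp (τ / 4) / 2 := by ring
      _ ≤ Real.exp (1 / 12 * τ) * Real.exp (τ / 4) / 2 := by gcongr; linarith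
      _ = Real.exp (τ / 3) / 2 := by rw [← Real.exp_add]; congr 2; ring
      _ ≤ _ := hUge
  clear_value U
  have hU8 : 2 * X ^ (2 * A + 8) ≤ U := by
    have h2 := hbig (1 / 4) (by linarith)
    rw [show 1 / 4 * τ = τ / 4 by ring] at h2
    linarith
  have hU1 : 1 ≤ U := by
    have : (1 : ℝ) ≤ U := by linarith
    exact_mod_cast this
  have hUP : U ≤ P := by
    have : (U : ℝ) ≤ P := by
      rw [← hPe]; exact hUle.trans (Real.exp_le_exp.2 (by linarith))
    exact_mod_cast this
  have hexpl : ∀ b : ℝ, 0 < b → Real.exp (τ - Real.log b) = P / b := fun b hb => by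
    rw [Real.exp_sub, hPe, Real.exp_log hb]
  have key := vaughan_sum (P := P) (U := U) (V := U) hU1 hUP
    (fun d => ee (u / d + v / (d : ℝ) ^ j)) (fun n => (norm_ee _).le) (T := 2 * X) hρ0 hρ1
    (by linarith) ?_ ?_ ?_ ?_
  · refine key.trans ?_
    rw [hρdef, mul_one_div, pow_add, ← div_div, div_le_iff₀ (by positivity)]
    rw [show 32 * (2 * X) ^ 3 * (P : ℝ) / X ^ A = (P / X ^ A) * (256 * X ^ 3) by ring]
    gcongr
    calc 256 * X ^ 3 ≤ X * X ^ 3 := by gcongr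
      _ = X ^ 4 := by ring
  · rw [Real.log_mul (by norm_num) hP0.ne', ← hτdef]
    have : Real.log 4 ≤ 4 - 1 := Real.log_le_sub_one_of_pos (by norm_num)
    linarith
  · rw [hρ2, one_div_mul_eq_div, le_div_iff₀ (by positivity)]
    exact hU8
  · intro b hb c hc
    rw [Finset.mem_Ioc] at hb
    rw [Finset.mem_Icc] at hc
    have hb0 : (0 : ℝ) < b := by exact_mod_cast hb.1
    have hb1 : (1 : ℝ) ≤ b := by exact_mod_cast hb.1
    have hlb : Real.log b ≤ 2 * τ / 3 := by
      rw [Real.log_le_iff_le_exp hb0]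
      calc (b : ℝ) ≤ U * U := by exact_mod_cast hb.2
        _ ≤ Real.exp (τ / 3) * Real.exp (τ / 3) := by gcongr
        _ = _ := by rw [← Real.exp_add]; congr 1; ring
    have hlb0 : 0 ≤ Real.log b := Real.log_nonneg hb1
    have hl := hexpl b hb0
    have hE : |u / b| / Real.exp (τ - Real.log b) + |v / (b : ℝ) ^ j| / Real.exp (τ - Real.log b) ^ j
        = F := by
      rw [hl, hF, abs_div, abs_div, abs_of_pos hb0, abs_of_pos (pow_pos hb0 j), div_pow]
      field_simp
    have h := H τ (τ - Real.log b) (u / b) (v / (b : ℝ) ^ j) j (P / b) c hτ1 (by linarith)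
      (by linarith) hj hj2 (by
        rw [hE]; exact (Real.exp_le_exp.2 (by nlinarith)).trans hF1) (by rw [hE]; exact hF2) ?_
    · rw [hl] at h
      calc _ = ‖∑ x ∈ Ioc (P / b) c, ee (u / b / x + v / (b : ℝ) ^ j / (x : ℝ) ^ j)‖ := by
            congr 1
            refine Finset.sum_congr rfl fun i _ => ?_
            push_cast
            rw [ee_typeI_phase]
        _ ≤ _ := h
        _ = _ := by rw [hρ2]; ring
    · intro x hx
      rw [Finset.mem_Ioc] at hx
      rw [hl]
      constructor
      · rw [div_le_iff₀ hb0]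
        have := (Nat.div_lt_iff_lt_mul hb.1).1 hx.1
        exact_mod_cast this.le
      · rw [← mul_div_assoc, le_div_iff₀ hb0]
        have := (Nat.le_div_iff_mul_le hb.1).1 (hx.2.trans hc.2)
        exact_mod_cast this
  · intro x x' a c hVx hxx' hx'2 hsep hUa hac hPa hc
    have hx0 : 0 < x := by omega
    have hx'0 : 0 < x' := by omega
    have hxr : (0 : ℝ) < x := by exact_mod_cast hx0
    have hxr' : (0 : ℝ) < x' := by exact_mod_cast hx'0
    have hxlt : (x : ℝ) < x' := by exact_mod_cast hxx'
    have hx2 : (x' : ℝ) < 2 * x := by exact_mod_cast hx'2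
    have hl := hexpl x hxr
    have hPx : Real.exp (τ / 4) ≤ P / x := by
      rw [le_div_iff₀ hxr]
      have h1 : U * x' ≤ 4 * P := by
        have h2 : U ≤ 4 * P / x' := by omega
        exact (Nat.le_div_iff_mul_le hx'0).1 h2
      have h2 : (U : ℝ) * x' ≤ 4 * P := by exact_mod_cast h1
      have h3 : 4 * Real.exp (τ / 4) * x ≤ U * x' := by gcongr
      linarith
    have hℓ1 : τ / 4 ≤ τ - Real.log x := by
      rw [← hl] at hPx; exact Real.exp_le_exp.1 hPx
    have hℓ2 : 0 ≤ Real.log x := Real.log_nonneg (by exact_mod_cast hx0)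
    obtain ⟨r, hr⟩ : ∃ r : ℝ, r = x / x' := ⟨_, rfl⟩
    have hr0 : 0 < r := by rw [hr]; positivity
    have hr1 : r < 1 := by rw [hr, div_lt_one hxr']; exact hxlt
    have hrj : r ^ j ≤ r := by
      calc r ^ j ≤ r ^ 1 := pow_le_pow_of_le_one hr0.le hr1.le (by omega)
        _ = r := pow_one r
    have hrj0 : 0 ≤ r ^ j := by positivity
    have hsep' : ρ ^ 2 / 4 ≤ 1 - r := by
      rw [hr, one_sub_div hxr'.ne', le_div_iff₀ hxr']
      calc ρ ^ 2 / 4 * x' ≤ ρ ^ 2 / 4 * (2 * x) := by gcongr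
        _ = ρ ^ 2 * x / 2 := by ring
        _ ≤ _ := hsep
    have hE : |u * (1 - r) / x| / Real.exp (τ - Real.log x) +
        |v * (1 - r ^ j) / (x : ℝ) ^ j| / Real.exp (τ - Real.log x) ^ j =
        |u| / P * (1 - r) + |v| / (P : ℝ) ^ j * (1 - r ^ j) := by
      rw [hl, abs_div, abs_div, abs_mul, abs_mul, abs_of_pos hxr, abs_of_pos (pow_pos hxr j),
        abs_of_nonneg (by linarith : 0 ≤ 1 - r), abs_of_nonneg (by linarith : 0 ≤ 1 - r ^ j), div_pow]
      field_simp
    have hu0 : 0 ≤ |u| / P := by positivity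
    have hv0 : 0 ≤ |v| / (P : ℝ) ^ j := by positivity
    have hE1 : F * (ρ ^ 2 / 4) ≤ |u| / P * (1 - r) + |v| / (P : ℝ) ^ j * (1 - r ^ j) := by
      rw [hF, add_mul]
      gcongr
      linarith
    have hE2 : |u| / P * (1 - r) + |v| / (P : ℝ) ^ j * (1 - r ^ j) ≤ F := by
      rw [hF]
      gcongr
      · exact mul_le_of_le_one_right hu0 (by linarith)
      · exact mul_le_of_le_one_right hv0 (by linarith)
    have h := H τ (τ - Real.log x) (u * (1 - r) / x) (v * (1 - r ^ j) / (x : ℝ) ^ j) j a c hτ1 hℓ1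
      (by linarith) hj hj2 ?_ (by rw [hE]; exact hE2.trans hF2) ?_
    · rw [hl] at h
      calc _ = ‖∑ z ∈ Ioc a c, ee (u * (1 - r) / x / z + v * (1 - r ^ j) / (x : ℝ) ^ j / (z : ℝ) ^ j)‖ := by
            congr 1
            refine Finset.sum_congr rfl fun z _ => ?_
            rw [← ee_neg, ← ee_add]
            congr 1
            push_cast
            rw [ee_typeI_phase, ee_typeI_phase, hr, div_pow]
            field_simp
            ring
        _ ≤ _ := h
        _ = _ := by rw [hρ2]; ring
    · rw [hE]
      refine le_trans ?_ hE1
      have h8 := hbig (c0 / 2) (by linarith)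
      rw [hρ2]
      calc Real.exp (c0 / 2 * τ) ≤ Real.exp (c0 / 2 * τ) * (Real.exp (c0 / 2 * τ) *
            (1 / X ^ (2 * A + 8) / 4)) := by
            apply le_mul_of_one_le_right (Real.exp_pos _).le
            rw [div_div, mul_one_div, le_div_iff₀ (by positivity)]
            linarith
        _ = Real.exp (c0 * τ) * (1 / X ^ (2 * A + 8) / 4) := by
            rw [← mul_assoc, ← Real.exp_add]; congr 3; ring
        _ ≤ _ := by gcongr
    · intro z hz
      rw [Finset.mem_Ioc] at hz
      rw [hl]
      constructor
      · rw [div_le_iff₀ hxr]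
        have := (Nat.div_lt_iff_lt_mul hx0).1 (lt_of_le_of_lt hPa hz.1)
        exact_mod_cast this.le
      · rw [← mul_div_assoc, le_div_iff₀ hxr]
        have h1 := (Nat.le_div_iff_mul_le hx'0).1 (hz.2.trans hc)
        have h2 : z * x ≤ 4 * P := (Nat.mul_le_mul_left z hxx'.le).trans h1
        exact_mod_cast h2

/-- The periodic quadratic Bernoulli function. -/
noncomputable def bernSq (x : ℝ) : ℝ := Int.fract x ^ 2 - Int.fract x + 1 / 6

/-- Partial sums of the Fourier series of `bernSq`. -/
noncomputable def bernSqPoly (K : ℕ) (x : ℝ) : ℝ :=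
  ∑ n ∈ Icc 1 K, Real.cos (2 * Real.pi * n * x) / (Real.pi ^ 2 * (n : ℝ) ^ 2)

theorem cos_two_pi_mul_fract (n : ℕ) (x : ℝ) :
    Real.cos (2 * Real.pi * n * Int.fract x) = Real.cos (2 * Real.pi * n * x) := by
  have : 2 * Real.pi * n * Int.fract x =
      2 * Real.pi * n * x - ((n * ⌊x⌋ : ℤ) : ℝ) * (2 * Real.pi) := by
    rw [Int.fract]; push_cast; ring
  rw [this, Real.cos_sub_int_mul_two_pi]

theorem hasSum_bernSq (x : ℝ) :
    HasSum (fun n : ℕ => Real.cos (2 * Real.pi * n * x) / (Real.pi ^ 2 * (n : ℝ) ^ 2))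
      (bernSq x) := by
  have h := hasSum_one_div_nat_pow_mul_cos one_ne_zero
    (x := Int.fract x) ⟨Int.fract_nonneg x, (Int.fract_lt_one x).le⟩
  have h2 := h.mul_left (1 / Real.pi ^ 2)
  convert! h2 using 1
  · ext n
    rw [cos_two_pi_mul_fract, mul_one]
    field_simp
  · have h3 := bernoulliFun_two (Int.fract x)
    unfold bernoulliFun at h3
    rw [mul_one, h3, bernSq]
    have := Real.pi_ne_zero
    simp
    field_simp

theorem abs_bernSq_sub_bernSqPoly_le {K : ℕ} (hK : 1 ≤ K) (x : ℝ) :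
    |bernSq x - bernSqPoly K x| ≤ 1 / (Real.pi ^ 2 * K) := by
  have h := (hasSum_bernSq x).tendsto_sum_nat
  have h2 : Filter.Tendsto (fun M => |∑ n ∈ range M,
      Real.cos (2 * Real.pi * n * x) / (Real.pi ^ 2 * (n : ℝ) ^ 2) - bernSqPoly K x|)
      Filter.atTop (nhds |bernSq x - bernSqPoly K x|) := (h.sub_const _).abs
  refine le_of_tendsto h2 ?_
  filter_upwards [Filter.eventually_ge_atTop (K + 1)] with M hM
  obtain ⟨L, rfl⟩ : ∃ L, M = L + 1 := ⟨M - 1, by omega⟩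
  have hKL : K ≤ L := by omega
  have h3 : ∑ n ∈ range (L + 1), Real.cos (2 * Real.pi * n * x) / (Real.pi ^ 2 * (n : ℝ) ^ 2) =
      bernSqPoly K x + ∑ n ∈ Ioc K L, Real.cos (2 * Real.pi * n * x) / (Real.pi ^ 2 * (n : ℝ) ^ 2) := by
    rw [Finset.sum_range_succ', bernSqPoly]
    simp only [CharP.cast_eq_zero, ne_eq, OfNat.ofNat_ne_zero, not_false_eq_true, zero_pow,
      mul_zero, div_zero, add_zero]
    rw [Finset.range_eq_Ico, Finset.sum_Ico_add' (fun n : ℕ =>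
      Real.cos (2 * Real.pi * n * x) / (Real.pi ^ 2 * (n : ℝ) ^ 2)) 0 L 1]
    rw [show Icc 1 K = Ico (0 + 1) (K + 1) by ext; simp,
      show Ioc K L = Ico (K + 1) (L + 1) by ext; simp,
      Finset.sum_Ico_consecutive _ (by omega) (by omega)]
  rw [h3, add_sub_cancel_left]
  calc |∑ n ∈ Ioc K L, Real.cos (2 * Real.pi * n * x) / (Real.pi ^ 2 * (n : ℝ) ^ 2)|
      ≤ ∑ n ∈ Ioc K L, |Real.cos (2 * Real.pi * n * x) / (Real.pi ^ 2 * (n : ℝ) ^ 2)| :=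
        Finset.abs_sum_le_sum_abs _ _
    _ ≤ ∑ n ∈ Ioc K L, 1 / Real.pi ^ 2 * ((n : ℝ) ^ 2)⁻¹ := by
        refine Finset.sum_le_sum fun n _ => ?_
        rw [abs_div, abs_of_nonneg (by positivity : 0 ≤ Real.pi ^ 2 * (n : ℝ) ^ 2),
          ← one_div, one_div_mul_one_div]
        gcongr
        exact Real.abs_cos_le_one _
    _ = 1 / Real.pi ^ 2 * ∑ n ∈ Ioc K L, ((n : ℝ) ^ 2)⁻¹ := by rw [Finset.mul_sum]
    _ ≤ 1 / Real.pi ^ 2 * ((K : ℝ)⁻¹ - (L : ℝ)⁻¹) := by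
        gcongr
        exact sum_Ioc_inv_sq_le_sub (by omega) hKL
    _ ≤ 1 / Real.pi ^ 2 * (K : ℝ)⁻¹ := by
        gcongr
        have : (0 : ℝ) ≤ (L : ℝ)⁻¹ := by positivity
        linarith
    _ = _ := by rw [← one_div, one_div_mul_one_div]

theorem bernSq_add_sub_le {δ : ℝ} (hδ : 0 < δ) (hδ1 : δ < 1) (x : ℝ) :
    (bernSq (x + δ) - bernSq x) / (2 * δ) ≤ Int.fract x - 1 / 2 + δ / 2 := by
  rw [div_le_iff₀ (by positivity)]
  unfold bernSq
  have h0 := Int.fract_nonneg x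
  have h1 := Int.fract_lt_one x
  have h2 : x = Int.fract x + ⌊x⌋ := (Int.fract_add_floor x).symm
  rcases lt_or_ge (Int.fract x + δ) 1 with h | h
  · have h3 : Int.fract (x + δ) = Int.fract x + δ := by
      rw [Int.fract_eq_iff]
      exact ⟨by linarith, h, ⌊x⌋, by linarith⟩
    rw [h3]; apply le_of_eq; ring
  · have h3 : Int.fract (x + δ) = Int.fract x + δ - 1 := by
      rw [Int.fract_eq_iff]
      exact ⟨by linarith, by linarith, ⌊x⌋ + 1, by push_cast; linarith⟩
    rw [h3]; nlinarith

theorem le_bernSq_sub {δ : ℝ} (hδ : 0 < δ) (hδ1 : δ < 1) (x : ℝ) :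
    Int.fract x - 1 / 2 - δ / 2 ≤ (bernSq x - bernSq (x - δ)) / (2 * δ) := by
  rw [le_div_iff₀ (by positivity)]
  unfold bernSq
  have h0 := Int.fract_nonneg x
  have h1 := Int.fract_lt_one x
  have h2 : x = Int.fract x + ⌊x⌋ := (Int.fract_add_floor x).symm
  rcases lt_or_ge (Int.fract x) δ with h | h
  · have h3 : Int.fract (x - δ) = Int.fract x - δ + 1 := by
      rw [Int.fract_eq_iff]
      exact ⟨by linarith, by linarith, ⌊x⌋ - 1, by push_cast; linarith⟩
    rw [h3]; nlinarith
  · have h3 : Int.fract (x - δ) = Int.fract x - δ := by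
      rw [Int.fract_eq_iff]
      exact ⟨by linarith, by linarith, ⌊x⌋, by linarith⟩
    rw [h3]; apply le_of_eq; ring

theorem ofReal_cos_eq_ee (y : ℝ) : (Real.cos (2 * Real.pi * y) : ℂ) = (ee y + ee (-y)) / 2 := by
  rw [Complex.ofReal_cos, Complex.cos, ee, ee]
  congr 3
  all_goals push_cast
  all_goals ring_nf

theorem sum_symm_Icc_erase (K : ℕ) (f : ℤ → ℂ) :
    ∑ k ∈ (Icc (-K : ℤ) K).erase 0, f k = ∑ n ∈ Icc 1 K, (f n + f (-n)) := by
  induction K with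
  | zero => simp
  | succ K ih =>
    rw [Finset.sum_Icc_succ_top (by omega), ← ih]
    have h : (Icc (-(K + 1 : ℕ) : ℤ) (K + 1 : ℕ)).erase 0 =
        insert ((K + 1 : ℕ) : ℤ) (insert (-(K + 1 : ℕ) : ℤ) ((Icc (-K : ℤ) K).erase 0)) := by
      ext k
      simp only [mem_erase, mem_Icc, mem_insert, Nat.cast_add, Nat.cast_one]
      omega
    rw [h, sum_insert, sum_insert]
    · push_cast; ring
    · simp
    · simp only [mem_erase, mem_Icc, mem_insert, Nat.cast_add, Nat.cast_one]
      omega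

theorem bernSqPoly_eq (K : ℕ) (x : ℝ) : (bernSqPoly K x : ℂ) =
    ∑ k ∈ (Icc (-K : ℤ) K).erase 0, ee (k * x) / (2 * Real.pi ^ 2 * (k : ℂ) ^ 2) := by
  rw [sum_symm_Icc_erase, bernSqPoly, Complex.ofReal_sum]
  refine sum_congr rfl fun n hn => ?_
  rw [Complex.ofReal_div, show 2 * Real.pi * n * x = 2 * Real.pi * (n * x) by ring,
    ofReal_cos_eq_ee]
  push_cast
  rw [neg_mul, neg_sq, ← add_div, div_div]
  congr 1
  ring

/-- Frequencies in the approximation of the sawtooth function. -/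
noncomputable def sawFreq (Y : ℕ) : Finset ℤ := (Icc (-(4 * Y ^ 2 : ℕ) : ℤ) (4 * Y ^ 2 : ℕ)).erase 0

/-- Coefficients in the approximation of the sawtooth function. -/
noncomputable def sawCoeff (Y : ℕ) (k : ℤ) : ℂ :=
  (ee (k * (1 / (4 * Y))) - 1) * (Y / (Real.pi ^ 2 * (k : ℂ) ^ 2))

/-- Coefficients of the error majorant in the approximation of the sawtooth function. -/
noncomputable def sawMaj (Y : ℕ) (k : ℤ) : ℂ :=
  (2 - ee (k * (1 / (4 * Y))) - ee (-(k * (1 / (4 * Y))))) * (Y / (Real.pi ^ 2 * (k : ℂ) ^ 2))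

theorem saw_sum_eq {Y : ℕ} (hY : 1 ≤ Y) (x : ℝ) :
    ∑ k ∈ sawFreq Y, sawCoeff Y k * ee (k * x) =
      (((bernSqPoly (4 * Y ^ 2) (x + 1 / (4 * Y)) - bernSqPoly (4 * Y ^ 2) x) / (2 * (1 / (4 * Y))) : ℝ) : ℂ) := by
  have hY0 : (Y : ℂ) ≠ 0 := by exact_mod_cast (by omega : Y ≠ 0)
  push_cast
  rw [bernSqPoly_eq, bernSqPoly_eq, ← sum_sub_distrib, sum_div, sawFreq]
  refine sum_congr rfl fun k hk => ?_
  have hk0 : (k : ℂ) ≠ 0 := by exact_mod_cast (mem_erase.1 hk).1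
  have hpi : (Real.pi : ℂ) ≠ 0 := by exact_mod_cast Real.pi_ne_zero
  rw [sawCoeff, mul_add, ee_add]
  field_simp
  ring

theorem sawMaj_sum_eq {Y : ℕ} (hY : 1 ≤ Y) (x : ℝ) :
    ∑ k ∈ sawFreq Y, sawMaj Y k * ee (k * x) =
      (((2 * bernSqPoly (4 * Y ^ 2) x - bernSqPoly (4 * Y ^ 2) (x + 1 / (4 * Y)) -
        bernSqPoly (4 * Y ^ 2) (x - 1 / (4 * Y))) / (2 * (1 / (4 * Y))) : ℝ) : ℂ) := by
  have hY0 : (Y : ℂ) ≠ 0 := by exact_mod_cast (by omega : Y ≠ 0)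
  push_cast
  rw [bernSqPoly_eq, bernSqPoly_eq, bernSqPoly_eq, mul_sum, ← sum_sub_distrib, ← sum_sub_distrib,
    sum_div, sawFreq]
  refine sum_congr rfl fun k hk => ?_
  have hk0 : (k : ℂ) ≠ 0 := by exact_mod_cast (mem_erase.1 hk).1
  have hpi : (Real.pi : ℂ) ≠ 0 := by exact_mod_cast Real.pi_ne_zero
  rw [sawMaj, mul_add, mul_sub, ee_add, sub_eq_add_neg (k * x : ℝ), ee_add]
  field_simp
  ring

theorem saw_approx {Y : ℕ} (hY : 1 ≤ Y) (x : ℝ) :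
    ‖((Int.fract x - 1 / 2 : ℝ) : ℂ) - ∑ k ∈ sawFreq Y, sawCoeff Y k * ee (k * x)‖ ≤
      (∑ k ∈ sawFreq Y, sawMaj Y k * ee (k * x)).re + 1 / Y := by
  rw [saw_sum_eq hY, sawMaj_sum_eq hY, ← Complex.ofReal_sub, Complex.norm_real, Complex.ofReal_re,
    Real.norm_eq_abs]
  have hY1 : (1 : ℝ) ≤ Y := by exact_mod_cast hY
  have hY0 : (0 : ℝ) < Y := by linarith
  set δ : ℝ := 1 / (4 * Y) with hδ
  have hδ0 : 0 < δ := by positivity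
  have hδ1 : δ < 1 := by rw [hδ, div_lt_one (by positivity)]; linarith
  have hK : 1 ≤ 4 * Y ^ 2 := by nlinarith
  have e0 := abs_le.1 (abs_bernSq_sub_bernSqPoly_le hK x)
  have e1 := abs_le.1 (abs_bernSq_sub_bernSqPoly_le hK (x + δ))
  have e2 := abs_le.1 (abs_bernSq_sub_bernSqPoly_le hK (x - δ))
  have u := bernSq_add_sub_le hδ0 hδ1 x
  have l := le_bernSq_sub hδ0 hδ1 x
  rw [div_le_iff₀ (by positivity)] at u
  rw [le_div_iff₀ (by positivity)] at l
  set η : ℝ := 1 / (Real.pi ^ 2 * (4 * Y ^ 2 : ℕ)) with hη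
  have hη1 : η ≤ δ ^ 2 / 2 := by
    have h3 := Real.pi_gt_three
    rw [hη, hδ]
    push_cast
    rw [div_pow, div_div, div_le_div_iff₀ (by positivity) (by positivity)]
    calc 1 * ((4 * (Y : ℝ)) ^ 2 * 2) = 8 * (4 * Y ^ 2) := by ring
      _ ≤ Real.pi ^ 2 * (4 * Y ^ 2) := by gcongr; nlinarith
      _ = _ := by ring
  have hYδ : 1 / (Y : ℝ) = 4 * δ := by rw [hδ]; field_simp
  rw [hYδ, ← mul_le_mul_iff_of_pos_right (show 0 < 2 * δ by positivity), add_mul,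
    div_mul_cancel₀ _ (by positivity), ← abs_of_pos (show 0 < 2 * δ by positivity), ← abs_mul,
    abs_of_pos (show 0 < 2 * δ by positivity), sub_mul, div_mul_cancel₀ _ (by positivity), abs_le]
  have hsq : 0 < δ ^ 2 := by positivity
  constructor <;> nlinarith

theorem card_sawFreq_le (Y : ℕ) : (sawFreq Y).card ≤ 8 * Y ^ 2 := by
  rw [sawFreq, card_erase_of_mem (by simp), Int.card_Icc]
  omega

theorem abs_le_of_mem_sawFreq {Y : ℕ} {k : ℤ} (hk : k ∈ sawFreq Y) :
    |(k : ℝ)| ≤ 4 * (Y : ℝ) ^ 2 := by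
  rw [sawFreq, mem_erase, mem_Icc] at hk
  have : |k| ≤ ((4 * Y ^ 2 : ℕ) : ℤ) := abs_le.2 hk.2
  exact_mod_cast this

theorem one_mem_sawFreq {Y : ℕ} (hY : 1 ≤ Y) : (1 : ℤ) ∈ sawFreq Y := by
  rw [sawFreq, mem_erase, mem_Icc]
  have : 1 ≤ Y ^ 2 := Nat.one_le_pow _ _ hY
  omega

theorem one_le_abs_of_mem_sawFreq {Y : ℕ} {k : ℤ} (hk : k ∈ sawFreq Y) : (1 : ℝ) ≤ |(k : ℝ)| := by
  have : 1 ≤ |k| := Int.one_le_abs (mem_erase.1 hk).1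
  exact_mod_cast this

theorem norm_sawCoeff_le {Y : ℕ} {k : ℤ} (hk : k ∈ sawFreq Y) : ‖sawCoeff Y k‖ ≤ 1 := by
  have h1 := one_le_abs_of_mem_sawFreq hk
  rcases Nat.eq_zero_or_pos Y with rfl | hY
  · simp [sawCoeff]
  have hY0 : (0 : ℝ) < Y := by exact_mod_cast hY
  have h := norm_ee_sub_ee_le (k * (1 / (4 * Y))) 0
  rw [ee_zero, sub_zero, abs_mul, abs_of_pos (by positivity : (0 : ℝ) < 1 / (4 * Y))] at h
  have hpi := Real.pi_gt_three
  have h2 : ‖(Y : ℂ) / (Real.pi ^ 2 * (k : ℂ) ^ 2)‖ = Y / (Real.pi ^ 2 * |(k : ℝ)| ^ 2) := by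
    rw [norm_div, norm_mul, norm_pow, norm_pow]
    simp
  rw [sawCoeff, norm_mul, h2]
  set κ := |(k : ℝ)|
  calc _ ≤ 2 * Real.pi * (κ * (1 / (4 * Y))) * (Y / (Real.pi ^ 2 * κ ^ 2)) := by gcongr
    _ = 1 / (2 * Real.pi * κ) := by field_simp; ring
    _ ≤ 1 := by
        rw [div_le_one (by positivity)]
        nlinarith

theorem norm_sawMaj_le {Y : ℕ} {k : ℤ} (hk : k ∈ sawFreq Y) : ‖sawMaj Y k‖ ≤ 1 := by
  have h1 := one_le_abs_of_mem_sawFreq hk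
  rcases Nat.eq_zero_or_pos Y with rfl | hY
  · simp [sawMaj]
  have hY0 : (0 : ℝ) < Y := by exact_mod_cast hY
  have h := norm_ee_sub_ee_le 0 (k * (1 / (4 * Y)))
  have h' := norm_ee_sub_ee_le 0 (-(k * (1 / (4 * Y))))
  rw [ee_zero, zero_sub, abs_neg, abs_mul, abs_of_pos (by positivity : (0 : ℝ) < 1 / (4 * Y))] at h
  rw [ee_zero, zero_sub, neg_neg, abs_mul, abs_of_pos (by positivity : (0 : ℝ) < 1 / (4 * Y))] at h'
  have hpi := Real.pi_gt_three
  have h2 : ‖(Y : ℂ) / (Real.pi ^ 2 * (k : ℂ) ^ 2)‖ = Y / (Real.pi ^ 2 * |(k : ℝ)| ^ 2) := by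
    rw [norm_div, norm_mul, norm_pow, norm_pow]
    simp
  rw [sawMaj, norm_mul, h2]
  set κ := |(k : ℝ)|
  have h3 : ‖2 - ee (k * (1 / (4 * Y))) - ee (-(k * (1 / (4 * Y))))‖ ≤
      2 * Real.pi * (κ * (1 / (4 * Y))) + 2 * Real.pi * (κ * (1 / (4 * Y))) := by
    rw [show 2 - ee (k * (1 / (4 * Y))) - ee (-(k * (1 / (4 * Y)))) =
      (1 - ee (k * (1 / (4 * Y)))) + (1 - ee (-(k * (1 / (4 * Y))))) by ring]
    exact (norm_add_le _ _).trans (by gcongr)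
  calc _ ≤ (2 * Real.pi * (κ * (1 / (4 * Y))) + 2 * Real.pi * (κ * (1 / (4 * Y)))) *
        (Y / (Real.pi ^ 2 * κ ^ 2)) := by gcongr
    _ = 1 / (Real.pi * κ) := by field_simp; ring
    _ ≤ 1 := by
        rw [div_le_one (by positivity)]
        nlinarith

theorem norm_sawCoeff_one_ge {Y : ℕ} (hY : 1 ≤ Y) : 1 / 10 ≤ ‖sawCoeff Y 1‖ := by
  have hY1 : (1 : ℝ) ≤ Y := by exact_mod_cast hY
  have hY0 : (0 : ℝ) < Y := by linarith
  have hpi := Real.pi_gt_three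
  have hpi2 := Real.pi_lt_d2
  have h2 : ‖(Y : ℂ) / (Real.pi ^ 2 * ((1 : ℤ) : ℂ) ^ 2)‖ = Y / Real.pi ^ 2 := by
    rw [norm_div, norm_mul, norm_pow, norm_pow]
    simp
  have hs : 2 / Real.pi * (Real.pi / (4 * Y)) ≤ Real.sin (Real.pi / (4 * Y)) := by
    apply Real.mul_le_sin (by positivity)
    apply div_le_div_of_nonneg_left Real.pi_pos.le (by norm_num) (by linarith)
  have h3 : 1 / (Y : ℝ) ≤ ‖ee (((1 : ℤ) : ℝ) * (1 / (4 * Y))) - 1‖ := by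
    unfold ee
    rw [mul_comm _ Complex.I, Complex.norm_exp_I_mul_ofReal_sub_one]
    have e1 : 2 * Real.pi * (((1 : ℤ) : ℝ) * (1 / (4 * Y))) / 2 = Real.pi / (4 * Y) := by
      push_cast; field_simp
    have e2 : 2 / Real.pi * (Real.pi / (4 * Y)) = 1 / Y / 2 := by field_simp; ring
    rw [e1, Real.norm_eq_abs, abs_mul, abs_of_pos (by norm_num : (0 : ℝ) < 2)]
    have := le_abs_self (Real.sin (Real.pi / (4 * Y)))
    linarith
  rw [sawCoeff, norm_mul, h2]
  calc (1 : ℝ) / 10 ≤ 1 / Real.pi ^ 2 := by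
        apply one_div_le_one_div_of_le (by positivity)
        nlinarith
    _ = 1 / Y * (Y / Real.pi ^ 2) := by field_simp
    _ ≤ _ := by gcongr

/-- Weighted sums of fractional parts in terms of exponential sums. -/
theorem norm_weighted_fract_sub_le {Y : ℕ} (hY : 1 ≤ Y) (s : Finset ℕ) (w : ℕ → ℝ) (hw : ∀ d, 0 ≤ w d)
    (g : ℕ → ℂ) (hg : ∀ d, ‖g d‖ ≤ 1) (x : ℕ → ℝ) :
    ‖∑ d ∈ s, (w d : ℂ) * (g d * (Int.fract (x d) : ℝ)) -
      ∑ k ∈ sawFreq Y, sawCoeff Y k * ∑ d ∈ s, (w d : ℂ) * (g d * ee (k * x d))‖ ≤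
      ‖∑ d ∈ s, (w d : ℂ) * g d‖ + ∑ k ∈ sawFreq Y, ‖∑ d ∈ s, (w d : ℂ) * ee (k * x d)‖ +
        (∑ d ∈ s, w d) / Y := by
  have e1 : ∑ d ∈ s, (w d : ℂ) * (g d * (Int.fract (x d) : ℝ)) -
      ∑ k ∈ sawFreq Y, sawCoeff Y k * ∑ d ∈ s, (w d : ℂ) * (g d * ee (k * x d)) =
      (1 / 2 : ℂ) * ∑ d ∈ s, (w d : ℂ) * g d + ∑ d ∈ s, (w d : ℂ) * g d *
        (((Int.fract (x d) - 1 / 2 : ℝ) : ℂ) - ∑ k ∈ sawFreq Y, sawCoeff Y k * ee (k * x d)) := by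
    simp only [mul_sub, mul_sum, sum_sub_distrib]
    rw [sum_comm (s := sawFreq Y), ← add_sub_assoc, ← sum_add_distrib]
    congr 1
    · refine sum_congr rfl fun d _ => ?_
      push_cast; ring
    · refine sum_congr rfl fun d _ => sum_congr rfl fun k _ => ?_
      ring
  have e2 : ‖∑ d ∈ s, (w d : ℂ) * g d *
        (((Int.fract (x d) - 1 / 2 : ℝ) : ℂ) - ∑ k ∈ sawFreq Y, sawCoeff Y k * ee (k * x d))‖ ≤
      (∑ k ∈ sawFreq Y, sawMaj Y k * ∑ d ∈ s, (w d : ℂ) * ee (k * x d)).re + (∑ d ∈ s, w d) / Y := by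
    calc _ ≤ ∑ d ∈ s, w d * ((∑ k ∈ sawFreq Y, sawMaj Y k * ee (k * x d)).re + 1 / Y) := by
          refine norm_sum_le_of_le _ fun d _ => ?_
          rw [norm_mul, norm_mul, Complex.norm_real, Real.norm_of_nonneg (hw d), mul_assoc]
          refine mul_le_mul_of_nonneg_left ?_ (hw d)
          have h := saw_approx hY (x d)
          exact (mul_le_of_le_one_left (norm_nonneg _) (hg d)).trans h
      _ = _ := by
          simp only [mul_add, sum_add_distrib, mul_one_div]
          rw [← sum_div]
          congr 1
          simp only [mul_sum]
          rw [sum_comm, Complex.re_sum]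
          refine sum_congr rfl fun d _ => ?_
          rw [← Complex.re_ofReal_mul, mul_sum]
          congr 1
          refine sum_congr rfl fun k _ => ?_
          ring
  have e3 : (∑ k ∈ sawFreq Y, sawMaj Y k * ∑ d ∈ s, (w d : ℂ) * ee (k * x d)).re ≤
      ∑ k ∈ sawFreq Y, ‖∑ d ∈ s, (w d : ℂ) * ee (k * x d)‖ := by
    refine (Complex.re_le_norm _).trans (norm_sum_le_of_le _ fun k hk => ?_)
    rw [norm_mul]
    exact mul_le_of_le_one_left (norm_nonneg _) (norm_sawMaj_le hk)
  rw [e1]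
  refine (norm_add_le _ _).trans ?_
  rw [norm_mul]
  have e4 : ‖(1 / 2 : ℂ)‖ * ‖∑ d ∈ s, (w d : ℂ) * g d‖ ≤ ‖∑ d ∈ s, (w d : ℂ) * g d‖ := by
    refine mul_le_of_le_one_left (norm_nonneg _) ?_
    norm_num
  linarith

theorem natDiv_cast_eq_sub_fract (a b : ℕ) : ((a / b : ℕ) : ℝ) = a / b - Int.fract ((a : ℝ) / b) := by
  rw [Int.fract_div_natCast_eq_div_natCast_mod]
  rcases Nat.eq_zero_or_pos b with rfl | hb
  · simp
  have hb' : (b : ℝ) ≠ 0 := by positivity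
  rw [← sub_div, eq_div_iff hb']
  have h := Nat.div_add_mod a b
  have h2 : (b : ℝ) * (a / b : ℕ) + (a % b : ℕ) = a := by exact_mod_cast h
  linarith

/-- Kummer's theorem in terms of fractional parts. -/
theorem sum_fract_eq_padicValNat_choose {p n m J : ℕ} (hp : p.Prime) (hmn : m ≤ n)
    (hJ : n < p ^ (J + 1)) :
    ∑ j ∈ Icc 1 J, (Int.fract ((m : ℝ) / (p : ℝ) ^ j) + Int.fract (((n - m : ℕ) : ℝ) / (p : ℝ) ^ j)
      - Int.fract ((n : ℝ) / (p : ℝ) ^ j)) = padicValNat p (n.choose m) := by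
  have := Fact.mk hp
  have hlog : ∀ a, a ≤ n → Nat.log p a < J + 1 := fun a ha =>
    lt_of_le_of_lt (Nat.log_mono_right ha) (Nat.log_lt_of_lt_pow' (by omega) hJ)
  have h1 : ∀ a, a ≤ n → (padicValNat p a.factorial : ℝ) =
      ∑ j ∈ Icc 1 J, ((a : ℝ) / (p : ℝ) ^ j - Int.fract ((a : ℝ) / (p : ℝ) ^ j)) := by
    intro a ha
    rw [padicValNat_factorial (hlog a ha), Nat.cast_sum]
    refine sum_congr (by ext; simp) fun j _ => ?_
    have := natDiv_cast_eq_sub_fract a (p ^ j)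
    push_cast at this
    exact this
  have h2 := Nat.choose_mul_factorial_mul_factorial hmn
  have h3 : padicValNat p (n.choose m) + padicValNat p m.factorial +
      padicValNat p (n - m).factorial = padicValNat p n.factorial := by
    rw [← h2, padicValNat.mul (mul_ne_zero (Nat.choose_pos hmn).ne' (Nat.factorial_ne_zero _))
      (Nat.factorial_ne_zero _), padicValNat.mul (Nat.choose_pos hmn).ne' (Nat.factorial_ne_zero _)]
  have h4 : (padicValNat p (n.choose m) : ℝ) + padicValNat p m.factorial +
      padicValNat p (n - m).factorial = padicValNat p n.factorial := by exact_mod_cast h3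
  rw [h1 m hmn, h1 _ (Nat.sub_le n m), h1 n le_rfl] at h4
  have h5 : ∑ j ∈ Icc 1 J, ((n : ℝ) / (p : ℝ) ^ j - Int.fract ((n : ℝ) / (p : ℝ) ^ j)) -
      (∑ j ∈ Icc 1 J, ((m : ℝ) / (p : ℝ) ^ j - Int.fract ((m : ℝ) / (p : ℝ) ^ j)) +
      ∑ j ∈ Icc 1 J, (((n - m : ℕ) : ℝ) / (p : ℝ) ^ j - Int.fract (((n - m : ℕ) : ℝ) / (p : ℝ) ^ j)))
      = ∑ j ∈ Icc 1 J, (Int.fract ((m : ℝ) / (p : ℝ) ^ j) +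
        Int.fract (((n - m : ℕ) : ℝ) / (p : ℝ) ^ j) - Int.fract ((n : ℝ) / (p : ℝ) ^ j)) := by
    rw [← sum_add_distrib, ← sum_sub_distrib]
    refine sum_congr rfl fun j _ => ?_
    rw [Nat.cast_sub hmn, sub_div]
    ring
  linarith

theorem sum_Ioc_vonMangoldt_eq (P : ℕ) : ∑ d ∈ Ioc P (4 * P), ArithmeticFunction.vonMangoldt d =
    Chebyshev.psi (4 * P : ℕ) - Chebyshev.psi P := by
  unfold Chebyshev.psi
  rw [Nat.floor_natCast, Nat.floor_natCast, eq_sub_iff_add_eq, add_comm,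
    Finset.sum_Ioc_consecutive _ (by omega) (by omega)]

theorem sum_Ioc_vonMangoldt_le (P : ℕ) :
    ∑ d ∈ Ioc P (4 * P), ArithmeticFunction.vonMangoldt d ≤ 22 * P := by
  rw [sum_Ioc_vonMangoldt_eq]
  have h := Chebyshev.psi_le_const_mul_self (x := ((4 * P : ℕ) : ℝ)) (by positivity)
  have h1 := Chebyshev.psi_nonneg (P : ℝ)
  have h2 : Real.log 4 ≤ 1.5 := by
    rw [show (4 : ℝ) = 2 ^ 2 by norm_num, Real.log_pow]
    have := Real.log_two_lt_d9
    push_cast; linarith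
  push_cast at h ⊢
  have h3 : (Real.log 4 + 4) * (4 * P) ≤ (1.5 + 4) * (4 * P) := by gcongr
  linarith

theorem sum_Ioc_not_prime_vonMangoldt_le {P : ℕ} (hP : 1 ≤ P) :
    ∑ d ∈ Ioc P (4 * P) with ¬ d.Prime, ArithmeticFunction.vonMangoldt d ≤
      4 * √P * Real.log (4 * P) := by
  have h := Chebyshev.psi_sub_theta_le (x := ((4 * P : ℕ) : ℝ)) (by exact_mod_cast (by omega))
  rw [Chebyshev.psi_sub_theta_eq_sum_not_prime, Nat.floor_natCast] at h
  refine le_trans (sum_le_sum_of_subset_of_nonneg ?_ fun _ _ _ =>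
    ArithmeticFunction.vonMangoldt_nonneg) (h.trans (le_of_eq ?_))
  · intro d hd
    simp only [mem_filter, mem_Ioc] at hd ⊢
    exact ⟨⟨by omega, hd.1.2⟩, hd.2⟩
  · push_cast
    rw [Real.sqrt_mul (by norm_num), show √(4 : ℝ) = 2 by
      rw [show (4 : ℝ) = 2 ^ 2 by norm_num]; exact Real.sqrt_sq (by norm_num)]
    ring

theorem le_sum_Ioc_vonMangoldt {P : ℕ} (hP : 1 ≤ P)
    (h : 4 * √P * Real.log (4 * P) + 3 ≤ P / 4) :
    (P : ℝ) ≤ ∑ d ∈ Ioc P (4 * P), ArithmeticFunction.vonMangoldt d := by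
  rw [sum_Ioc_vonMangoldt_eq]
  have hP1 : (1 : ℝ) ≤ P := by exact_mod_cast hP
  have h1 := Chebyshev.psi_ge (4 * P)
  have h2 := Chebyshev.psi_le hP1
  have h3 : Real.log 4 = 2 * Real.log 2 := by
    rw [show (4 : ℝ) = 2 ^ 2 by norm_num, Real.log_pow]; push_cast; ring
  have h5 := Real.log_two_gt_d9
  have hs : 1 ≤ √(P : ℝ) := by rw [Real.one_le_sqrt]; exact hP1
  have h6 : Real.log ((4 * P : ℕ) + 1) ≤ Real.log (4 * P) + 1 := by
    have : Real.log (((4 * P : ℕ) : ℝ) + 1) ≤ Real.log (4 * P * 2) := by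
      apply Real.log_le_log (by positivity); push_cast; linarith
    rw [Real.log_mul (by positivity) (by norm_num)] at this
    have := Real.log_two_lt_d9
    linarith
  have h7 : Real.log P ≤ Real.log (4 * P) := Real.log_le_log (by linarith) (by linarith)
  have h8 : 0 ≤ Real.log (4 * P) := Real.log_nonneg (by linarith)
  have h9 : √(P : ℝ) * Real.log P ≤ √P * Real.log (4 * P) := by gcongr
  have h10 : Real.log (4 * P) ≤ √P * Real.log (4 * P) := le_mul_of_one_le_left h8 hs
  rw [h3] at h2
  push_cast at h1 h6 ⊢
  have h11 : 0.69 * (P : ℝ) ≤ Real.log 2 * P := by gcongr; linarith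
  linarith

/-- Exponential sums over prime powers. -/
noncomputable def vmSum (P j : ℕ) (u v : ℝ) : ℂ :=
  ∑ d ∈ Ioc P (4 * P), (ArithmeticFunction.vonMangoldt d : ℂ) * ee (u / d + v / (d : ℝ) ^ j)

/-- The twisted sum of fractional parts over prime powers. -/
noncomputable def fractSum (P h a j : ℕ) : ℂ :=
  ∑ d ∈ Ioc P (4 * P), (ArithmeticFunction.vonMangoldt d : ℂ) *
    (ee (-h / d) * (Int.fract ((a : ℝ) / (d : ℝ) ^ j) : ℝ))

/-- The exponential sum approximation of `fractSum P h a 1`. -/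
noncomputable def sawSum (Y P h a : ℕ) : ℂ :=
  ∑ k ∈ sawFreq Y, sawCoeff Y k * vmSum P 2 (k * a - h) 0

theorem norm_fractSum_sub_le {Y : ℕ} (hY : 1 ≤ Y) (P h a j : ℕ) :
    ‖fractSum P h a j - ∑ k ∈ sawFreq Y, sawCoeff Y k * vmSum P j (-h) (k * a)‖ ≤
      ‖vmSum P 2 (-h) 0‖ + ∑ k ∈ sawFreq Y, ‖vmSum P j 0 (k * a)‖ + 22 * P / Y := by
  have h1 := norm_weighted_fract_sub_le hY (Ioc P (4 * P)) (fun d => ArithmeticFunction.vonMangoldt d)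
    (fun _ => ArithmeticFunction.vonMangoldt_nonneg) (fun d => ee (-h / d)) (fun d => (norm_ee _).le)
    (fun d => (a : ℝ) / (d : ℝ) ^ j)
  have e1 : ∀ k : ℤ, ∑ d ∈ Ioc P (4 * P), (ArithmeticFunction.vonMangoldt d : ℂ) *
      (ee (-h / d) * ee (k * ((a : ℝ) / (d : ℝ) ^ j))) = vmSum P j (-h) (k * a) := fun k => by
    refine sum_congr rfl fun d _ => ?_
    rw [← ee_add, mul_div_assoc]
  have e2 : ∀ k : ℤ, ∑ d ∈ Ioc P (4 * P), (ArithmeticFunction.vonMangoldt d : ℂ) *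
      ee (k * ((a : ℝ) / (d : ℝ) ^ j)) = vmSum P j 0 (k * a) := fun k => by
    refine sum_congr rfl fun d _ => ?_
    rw [zero_div, zero_add, mul_div_assoc]
  have e3 : ∑ d ∈ Ioc P (4 * P), (ArithmeticFunction.vonMangoldt d : ℂ) * ee (-h / d) =
      vmSum P 2 (-h) 0 := by
    refine sum_congr rfl fun d _ => ?_
    rw [zero_div, add_zero]
  simp only [e1, e2, e3] at h1
  refine h1.trans ?_
  gcongr
  exact sum_Ioc_vonMangoldt_le P

theorem vmSum_one_eq (P : ℕ) (u v : ℝ) : vmSum P 1 u v = vmSum P 2 (v + u) 0 := by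
  refine sum_congr rfl fun d _ => ?_
  rw [pow_one, zero_div, add_zero, ← add_div, add_comm]

theorem norm_fractSum_le_of_le {P h a j : ℕ} {η : ℝ} (hη : (a : ℝ) ≤ η * (P : ℝ) ^ j) :
    ‖fractSum P h a j‖ ≤ 22 * P * η := by
  rcases Nat.eq_zero_or_pos P with rfl | hP
  · simp [fractSum]
  have hP0 : (0 : ℝ) < P := by exact_mod_cast hP
  have hη0 : 0 ≤ η := by
    by_contra hneg
    have : η * (P : ℝ) ^ j < 0 := mul_neg_of_neg_of_pos (by linarith) (by positivity)
    have : (0 : ℝ) ≤ a := by positivity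
    linarith
  calc ‖fractSum P h a j‖ ≤ ∑ d ∈ Ioc P (4 * P), ArithmeticFunction.vonMangoldt d * η := by
        refine norm_sum_le_of_le _ fun d hd => ?_
        rw [norm_mul, norm_mul, norm_ee, one_mul, Complex.norm_real, Complex.norm_real,
          Real.norm_of_nonneg ArithmeticFunction.vonMangoldt_nonneg,
          Real.norm_of_nonneg (Int.fract_nonneg _)]
        refine mul_le_mul_of_nonneg_left ?_ ArithmeticFunction.vonMangoldt_nonneg
        have hd1 : (P : ℝ) ≤ d := by exact_mod_cast (mem_Ioc.1 hd).1.le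
        have h0 : (0 : ℝ) ≤ (a : ℝ) / (d : ℝ) ^ j := by positivity
        have h1 : Int.fract ((a : ℝ) / (d : ℝ) ^ j) ≤ (a : ℝ) / (d : ℝ) ^ j := by
          have : (0 : ℝ) ≤ ⌊(a : ℝ) / (d : ℝ) ^ j⌋ := by exact_mod_cast Int.floor_nonneg.2 h0
          rw [Int.fract]; linarith
        refine h1.trans ?_
        have hd0 : (0 : ℝ) < d := by linarith
        rw [div_le_iff₀ (by positivity)]
        exact hη.trans (by gcongr)
    _ = (∑ d ∈ Ioc P (4 * P), ArithmeticFunction.vonMangoldt d) * η := by rw [sum_mul]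
    _ ≤ _ := by gcongr; exact sum_Ioc_vonMangoldt_le P

open Filter in
theorem fractSum_estimates {c0 e : ℝ} (hc0 : 0 < c0) (hc1 : c0 ≤ 1) (he : 0 < e) :
    ∀ᶠ X : ℝ in atTop, ∀ P h a : ℕ, X ^ ((2 : ℝ) / 3 + e) ≤ Real.log P → Real.log P ≤ X →
      Real.exp ((1 + c0) * Real.log P) ≤ h → (h : ℝ) ≤ Real.exp (2 * X) →
      (a : ℝ) ≤ Real.exp (2 * X) →
      (Real.exp ((1 + c0) * Real.log P) ≤ a →
        ‖fractSum P h a 1 - sawSum ⌈X⌉₊ P h a‖ ≤ 24 * P / X) ∧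
      ∀ j : ℕ, 2 ≤ j → (j : ℝ) ≤ 2 * X / Real.log P + 2 →
        (Real.exp ((j + c0) * Real.log P) ≤ a ∨ (a : ℝ) ≤ Real.exp ((j - c0) * Real.log P)) →
        ‖fractSum P h a j‖ ≤ 24 * P / X := by
  filter_upwards [eventually_ge_atTop 100, prime_sum hc0 hc1 he 4,
    eventually_mul_pow_le_exp (show (0 : ℝ) < 2 by norm_num) (show (0 : ℝ) < 1 by norm_num) 17 2,
    eventually_mul_pow_le_exp hc0 (show (0 : ℝ) < 2 / 3 by norm_num) 1 1] with X hX H hexp1 hexp2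
  intro P h a hτ1 hτX hh1 hh2 ha2
  specialize H P
  have hX0 : 0 < X := by linarith
  have hX1 : 1 ≤ X := by linarith
  rw [Real.rpow_one] at hexp1
  have hτ2 : X ^ ((2 : ℝ) / 3) ≤ Real.log P :=
    (Real.rpow_le_rpow_of_exponent_le hX1 (by linarith)).trans hτ1
  have hτ0 : 0 < Real.log P := lt_of_lt_of_le (by positivity) hτ2
  have hP0 : (0 : ℝ) < P := by
    rcases Nat.eq_zero_or_pos P with h | h
    · simp [h] at hτ0
    · exact_mod_cast h
  have hP1 : (1 : ℝ) ≤ P := by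
    have : 0 < P := by exact_mod_cast hP0
    exact_mod_cast this
  set τ := Real.log P with hτ
  have hPj : ∀ j : ℕ, (P : ℝ) ^ j = Real.exp (j * τ) := fun j => by
    rw [Real.exp_nat_mul, Real.exp_log hP0]
  have hPe : (P : ℝ) = Real.exp τ := (Real.exp_log hP0).symm
  clear_value τ
  set Y := ⌈X⌉₊ with hY
  have hYX : X ≤ Y := Nat.le_ceil X
  have hY1 : (Y : ℝ) ≤ X + 1 := (Nat.ceil_lt_add_one hX0.le).le
  have hY2 : (Y : ℝ) ^ 2 ≤ 2 * X ^ 2 := by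
    calc (Y : ℝ) ^ 2 ≤ (X + 1) ^ 2 := by gcongr
      _ ≤ _ := by nlinarith
  have hY0 : 1 ≤ Y := by
    have : (1 : ℝ) ≤ Y := by linarith
    exact_mod_cast this
  clear_value Y
  have hka : ∀ k ∈ sawFreq Y, |(k : ℝ) * a| ≤ 8 * X ^ 2 * Real.exp (2 * X) := fun k hk => by
    rw [abs_mul, Nat.abs_cast]
    have := abs_le_of_mem_sawFreq hk
    gcongr
    linarith
  have hka2 : ∀ k ∈ sawFreq Y, (a : ℝ) ≤ |(k : ℝ) * a| := fun k hk => by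
    rw [abs_mul, Nat.abs_cast]
    exact le_mul_of_one_le_left (by positivity) (one_le_abs_of_mem_sawFreq hk)
  have hX4 : 17 * X ^ 2 * Real.exp (2 * X) ≤ Real.exp (4 * X) := by
    calc _ ≤ Real.exp (2 * X) * Real.exp (2 * X) := by gcongr
      _ = _ := by rw [← Real.exp_add]; congr 1; ring
  have hX4' : Real.exp (2 * X) + 8 * X ^ 2 * Real.exp (2 * X) ≤ Real.exp (4 * X) := by
    refine le_trans ?_ hX4
    have : Real.exp (2 * X) ≤ X ^ 2 * Real.exp (2 * X) :=
      le_mul_of_one_le_left (Real.exp_pos _).le (one_le_pow₀ hX1)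
    have : 0 ≤ X ^ 2 * Real.exp (2 * X) := by positivity
    linarith
  have hcond : ∀ (j : ℕ) (u v : ℝ), |u| ≤ Real.exp (2 * X) → |v| ≤ 8 * X ^ 2 * Real.exp (2 * X) →
      |u| / P + |v| / (P : ℝ) ^ j ≤ Real.exp (4 * X) := fun j u v hu hv => by
    have h1 : |u| / P ≤ |u| := div_le_self (abs_nonneg _) hP1
    have h2 : |v| / (P : ℝ) ^ j ≤ |v| := div_le_self (abs_nonneg _) (one_le_pow₀ hP1)
    linarith
  have hlow : ∀ (j : ℕ) (v : ℝ), Real.exp ((j + c0) * τ) ≤ |v| →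
      Real.exp (c0 * τ) ≤ |v| / (P : ℝ) ^ j := fun j v hv => by
    rw [hPj, le_div_iff₀ (Real.exp_pos _), ← Real.exp_add]
    refine le_trans (le_of_eq ?_) hv
    congr 1; ring
  have hlow1 : ∀ (v : ℝ), Real.exp ((1 + c0) * τ) ≤ |v| → Real.exp (c0 * τ) ≤ |v| / P := fun v hv => by
    have := hlow 1 v (by push_cast; exact hv)
    rwa [pow_one] at this
  have hvh : ‖vmSum P 2 (-h) 0‖ ≤ P / X ^ 4 := by
    refine H 2 (-h) 0 hτ1 hτX le_rfl (by
      have : 0 ≤ 2 * X / τ := by positivity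
      push_cast; linarith) ?_ (hcond 2 _ _ ?_ ?_)
    · rw [abs_zero, zero_div, add_zero]
      exact hlow1 _ (by rw [abs_neg, Nat.abs_cast]; exact hh1)
    · rw [abs_neg, Nat.abs_cast]; exact hh2
    · rw [abs_zero]; positivity
  have hsum : ∀ g : ℤ → ℝ, (∀ k ∈ sawFreq Y, g k ≤ P / X ^ 4) →
      ∑ k ∈ sawFreq Y, g k ≤ 16 * P / X ^ 2 := fun g hg => by
    calc ∑ k ∈ sawFreq Y, g k ≤ (sawFreq Y).card • ((P : ℝ) / X ^ 4) := sum_le_card_nsmul _ _ _ hg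
      _ ≤ (16 * X ^ 2) * (P / X ^ 4) := by
          rw [nsmul_eq_mul]
          gcongr
          have : ((sawFreq Y).card : ℝ) ≤ 8 * (Y : ℝ) ^ 2 := by exact_mod_cast card_sawFreq_le Y
          linarith
      _ = _ := by field_simp
  have hXX : (P : ℝ) / X ^ 4 + 16 * P / X ^ 2 + 16 * P / X ^ 2 + 22 * P / Y ≤ 24 * P / X := by
    have h1 : 22 * (P : ℝ) / Y ≤ 22 * P / X := by gcongr
    have h2 : 16 * (P : ℝ) / X ^ 2 ≤ 0.5 * P / X := by
      rw [div_le_div_iff₀ (by positivity) hX0]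
      calc 16 * (P : ℝ) * X ≤ (0.5 * 100) * P * X := by gcongr; norm_num
        _ ≤ (0.5 * X) * P * X := by gcongr
        _ = _ := by ring
    have h3 : (P : ℝ) / X ^ 4 ≤ P / X := by
      gcongr
      exact le_self_pow₀ hX1 (by norm_num)
    calc _ ≤ P / X + 0.5 * P / X + 0.5 * P / X + 22 * P / X := by gcongr
      _ = _ := by ring
  constructor
  · intro ha1
    have h1 := norm_fractSum_sub_le hY0 P h a 1
    have e1 : ∑ k ∈ sawFreq Y, sawCoeff Y k * vmSum P 1 (-h) (k * a) = sawSum Y P h a := by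
      refine sum_congr rfl fun k _ => ?_
      rw [vmSum_one_eq, sub_eq_add_neg]
    rw [e1] at h1
    have h2 := hsum (fun k => ‖vmSum P 1 0 (k * a)‖) fun k hk => by
      rw [vmSum_one_eq, add_zero]
      refine H 2 _ 0 hτ1 hτX le_rfl (by
        have : 0 ≤ 2 * X / τ := by positivity
        push_cast; linarith) ?_ ?_
      · rw [abs_zero, zero_div, add_zero]
        exact hlow1 _ (ha1.trans (hka2 k hk))
      · rw [abs_zero, zero_div, add_zero]
        have := hcond 1 0 _ (by rw [abs_zero]; positivity) (hka k hk)
        rwa [abs_zero, zero_div, zero_add, pow_one] at this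
    have h3 : (0 : ℝ) ≤ 16 * P / X ^ 2 := by positivity
    linarith
  · intro j hj hj2 hdich
    rcases hdich with hd | hd
    · have h1 := norm_fractSum_sub_le hY0 P h a j
      have h2 := hsum (fun k => ‖vmSum P j 0 (k * a)‖) fun k hk => by
        refine H j 0 _ hτ1 hτX hj hj2 ?_ (hcond j _ _ (by rw [abs_zero]; positivity) (hka k hk))
        rw [abs_zero, zero_div, zero_add]
        exact hlow j _ (hd.trans (hka2 k hk))
      have h3 := hsum (fun k => ‖sawCoeff Y k * vmSum P j (-h) (k * a)‖) fun k hk => by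
        rw [norm_mul]
        refine (mul_le_of_le_one_left (norm_nonneg _) (norm_sawCoeff_le hk)).trans ?_
        refine H j _ _ hτ1 hτX hj hj2 ?_ (hcond j _ _ (by rw [abs_neg, Nat.abs_cast]; exact hh2)
          (hka k hk))
        have := hlow j _ (hd.trans (hka2 k hk))
        have h0 : 0 ≤ |(-h : ℝ)| / P := by positivity
        linarith
      have h4 := norm_sum_le (sawFreq Y) (fun k => sawCoeff Y k * vmSum P j (-h) (k * a))
      have h5 := norm_le_norm_sub_add (fractSum P h a j)
        (∑ k ∈ sawFreq Y, sawCoeff Y k * vmSum P j (-h) (k * a))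
      linarith
    · have h1 := norm_fractSum_le_of_le (P := P) (h := h) (a := a) (j := j)
        (η := Real.exp (-(c0 * τ))) (by
          rw [hPj, ← Real.exp_add]
          refine hd.trans (le_of_eq ?_)
          congr 1; ring)
      refine h1.trans ?_
      have h2 : Real.exp (-(c0 * τ)) ≤ 1 / X := by
        rw [Real.exp_neg, ← one_div]
        apply one_div_le_one_div_of_le hX0
        rw [one_mul, pow_one] at hexp2
        exact hexp2.trans (Real.exp_le_exp.2 (by gcongr))
      calc 22 * (P : ℝ) * Real.exp (-(c0 * τ)) ≤ 24 * P * (1 / X) := by gcongr; norm_num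
        _ = _ := by ring

theorem norm_vmSum_sub_le {P : ℕ} (hP : 1 ≤ P) (u u' : ℝ) :
    ‖vmSum P 2 u 0 - vmSum P 2 u' 0‖ ≤ 154 * |u - u'| := by
  have hP0 : (0 : ℝ) < P := by exact_mod_cast hP
  unfold vmSum
  rw [← sum_sub_distrib]
  calc _ ≤ ∑ d ∈ Ioc P (4 * P), ArithmeticFunction.vonMangoldt d * (7 * |u - u'| / P) := by
        refine norm_sum_le_of_le _ fun d hd => ?_
        have hd1 : (P : ℝ) ≤ d := by exact_mod_cast (mem_Ioc.1 hd).1.le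
        have hd0 : (0 : ℝ) < d := by linarith
        rw [← mul_sub, norm_mul, Complex.norm_real,
          Real.norm_of_nonneg ArithmeticFunction.vonMangoldt_nonneg]
        refine mul_le_mul_of_nonneg_left ?_ ArithmeticFunction.vonMangoldt_nonneg
        refine (norm_ee_sub_ee_le _ _).trans ?_
        rw [zero_div, add_zero, add_zero, ← sub_div, abs_div, abs_of_pos hd0, ← mul_div_assoc]
        have := Real.pi_lt_d2
        gcongr
        linarith
    _ = (∑ d ∈ Ioc P (4 * P), ArithmeticFunction.vonMangoldt d) * (7 * |u - u'| / P) := by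
        rw [sum_mul]
    _ ≤ 22 * P * (7 * |u - u'| / P) := by gcongr; exact sum_Ioc_vonMangoldt_le P
    _ = _ := by field_simp; ring

theorem vmSum_zero (P : ℕ) : vmSum P 2 0 0 =
    ((∑ d ∈ Ioc P (4 * P), ArithmeticFunction.vonMangoldt d : ℝ) : ℂ) := by
  unfold vmSum
  simp

open Filter in
theorem sawSum_estimates {c0 e : ℝ} (hc0 : 0 < c0) (hc1 : c0 ≤ 1) (he : 0 < e) :
    ∀ᶠ X : ℝ in atTop, ∀ P h a : ℕ, X ^ ((2 : ℝ) / 3 + e) ≤ Real.log P → Real.log P ≤ X →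
      (h : ℝ) ≤ a → (a : ℝ) ≤ Real.exp (2 * X) →
      (Real.exp ((1 + c0) * Real.log P) ≤ (a : ℝ) - h → ‖sawSum ⌈X⌉₊ P h a‖ ≤ P / X) ∧
      (Real.exp ((1 + c0) * Real.log P) ≤ h → (a : ℝ) - h ≤ P / X ^ 6 →
        ‖sawSum ⌈X⌉₊ P h a - sawCoeff ⌈X⌉₊ 1 * vmSum P 2 0 0‖ ≤ P / X) := by
  filter_upwards [eventually_ge_atTop 1000, prime_sum hc0 hc1 he 4,
    eventually_mul_pow_le_exp (show (0 : ℝ) < 2 by norm_num) (show (0 : ℝ) < 1 by norm_num) 9 2]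
    with X hX H hexp1
  intro P h a hτ1 hτX hha ha2
  specialize H P
  have hX0 : 0 < X := by linarith
  have hX1 : 1 ≤ X := by linarith
  rw [Real.rpow_one] at hexp1
  have hτ0 : 0 < Real.log P := lt_of_lt_of_le (by positivity) hτ1
  have hP0 : (0 : ℝ) < P := by
    rcases Nat.eq_zero_or_pos P with h | h
    · simp [h] at hτ0
    · exact_mod_cast h
  have hPn : 1 ≤ P := by exact_mod_cast hP0
  have hP1 : (1 : ℝ) ≤ P := by exact_mod_cast hPn
  have hPe : Real.exp (Real.log P) = (P : ℝ) := Real.exp_log hP0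
  set τ := Real.log P with hτ
  clear_value τ
  set Y := ⌈X⌉₊ with hY
  have hYX : X ≤ Y := Nat.le_ceil X
  have hY1 : (Y : ℝ) ≤ X + 1 := (Nat.ceil_lt_add_one hX0.le).le
  have hY2 : (Y : ℝ) ^ 2 ≤ 2 * X ^ 2 := by
    calc (Y : ℝ) ^ 2 ≤ (X + 1) ^ 2 := by gcongr
      _ ≤ _ := by nlinarith
  have hY0 : 1 ≤ Y := by
    have : (1 : ℝ) ≤ Y := by linarith
    exact_mod_cast this
  clear_value Y
  have hterm : ∀ k ∈ sawFreq Y, Real.exp ((1 + c0) * τ) ≤ |(k : ℝ) * a - h| →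
      ‖sawCoeff Y k * vmSum P 2 (k * a - h) 0‖ ≤ P / X ^ 4 := fun k hk hlow => by
    rw [norm_mul]
    refine (mul_le_of_le_one_left (norm_nonneg _) (norm_sawCoeff_le hk)).trans ?_
    refine H 2 _ 0 hτ1 hτX le_rfl (by
      have : 0 ≤ 2 * X / τ := by positivity
      push_cast; linarith) ?_ ?_
    · rw [abs_zero, zero_div, add_zero, le_div_iff₀ hP0, ← hPe, ← Real.exp_add]
      refine le_trans (le_of_eq ?_) hlow
      congr 1; ring
    · rw [abs_zero, zero_div, add_zero]
      calc |(k : ℝ) * a - h| / P ≤ |(k : ℝ) * a - h| := div_le_self (abs_nonneg _) hP1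
        _ ≤ |(k : ℝ) * a| + |(h : ℝ)| := abs_sub _ _
        _ ≤ 8 * X ^ 2 * Real.exp (2 * X) + X ^ 2 * Real.exp (2 * X) := by
            rw [abs_mul, Nat.abs_cast, Nat.abs_cast]
            have := abs_le_of_mem_sawFreq hk
            gcongr
            · linarith
            · exact (hha.trans ha2).trans
                (le_mul_of_one_le_left (Real.exp_pos _).le (one_le_pow₀ hX1))
        _ = 9 * X ^ 2 * Real.exp (2 * X) := by ring
        _ ≤ Real.exp (2 * X) * Real.exp (2 * X) := by gcongr
        _ = _ := by rw [← Real.exp_add]; congr 1; ring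
  have hcard : ∀ T : Finset ℤ, T ⊆ sawFreq Y → (∀ k ∈ T, Real.exp ((1 + c0) * τ) ≤ |(k : ℝ) * a - h|) →
      ‖∑ k ∈ T, sawCoeff Y k * vmSum P 2 (k * a - h) 0‖ ≤ P / X / 2 := fun T hT hlow => by
    calc _ ≤ ∑ k ∈ T, (P : ℝ) / X ^ 4 := norm_sum_le_of_le _ fun k hk => hterm k (hT hk) (hlow k hk)
      _ = T.card * (P / X ^ 4) := by rw [sum_const, nsmul_eq_mul]
      _ ≤ 16 * X ^ 2 * (P / X ^ 4) := by
          gcongr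
          have h1 : T.card ≤ 8 * Y ^ 2 := (card_le_card hT).trans (card_sawFreq_le Y)
          have h2 : (T.card : ℝ) ≤ 8 * (Y : ℝ) ^ 2 := by exact_mod_cast h1
          linarith
      _ = (16 / X) * (P / X) := by field_simp
      _ ≤ (1 / 2) * (P / X) := by
          refine mul_le_mul_of_nonneg_right ?_ (by positivity)
          rw [div_le_iff₀ hX0]; linarith
      _ = _ := by ring
  have hh0 : (0 : ℝ) ≤ h := by positivity
  have ha0 : (0 : ℝ) ≤ a := by positivity
  have hk1 : ∀ k ∈ sawFreq Y, (a : ℝ) - h ≤ |(k : ℝ) * a - h| := fun k hk => by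
    have hk0 := one_le_abs_of_mem_sawFreq hk
    have h1 := abs_sub_abs_le_abs_sub ((k : ℝ) * a) h
    rw [abs_mul, Nat.abs_cast, Nat.abs_cast] at h1
    have h2 : (a : ℝ) ≤ |(k : ℝ)| * a := le_mul_of_one_le_left ha0 hk0
    linarith
  constructor
  · intro hah
    have h1 := hcard _ (Subset.refl _) fun k hk => hah.trans (hk1 k hk)
    have h0 : (0 : ℝ) ≤ P / X := by positivity
    unfold sawSum
    linarith
  · intro hh1 hah
    have hk2 : ∀ k ∈ (sawFreq Y).erase 1, Real.exp ((1 + c0) * τ) ≤ |(k : ℝ) * a - h| := fun k hk => by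
      rw [mem_erase] at hk
      refine (hh1.trans hha).trans ?_
      have hk0 : k ≠ 0 := by
        have := hk.2
        rw [sawFreq, mem_erase] at this
        exact this.1
      rcases lt_or_ge k 0 with hneg | hpos
      · have h1 : (k : ℝ) ≤ -1 := by exact_mod_cast (by omega : k ≤ -1)
        have h2 : (k : ℝ) * a ≤ -1 * a := by gcongr
        have h3 := neg_le_abs ((k : ℝ) * a - h)
        linarith
      · have h1 : (2 : ℝ) ≤ k := by exact_mod_cast (by omega : 2 ≤ k)
        have h2 : (2 : ℝ) * a ≤ (k : ℝ) * a := by gcongr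
        have h3 := le_abs_self ((k : ℝ) * a - h)
        linarith
    have h1 := hcard _ (erase_subset 1 _) hk2
    have h2 := norm_vmSum_sub_le hPn ((1 : ℤ) * a - h) 0
    have h3 : sawSum Y P h a - sawCoeff Y 1 * vmSum P 2 0 0 =
        ∑ k ∈ (sawFreq Y).erase 1, sawCoeff Y k * vmSum P 2 (k * a - h) 0 +
          sawCoeff Y 1 * (vmSum P 2 ((1 : ℤ) * a - h) 0 - vmSum P 2 0 0) := by
      rw [sawSum, ← add_sum_erase _ _ (one_mem_sawFreq hY0)]
      ring
    rw [h3]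
    refine (norm_add_le _ _).trans ?_
    rw [norm_mul]
    have h4 := mul_le_of_le_one_left (norm_nonneg (vmSum P 2 ((1 : ℤ) * a - h) 0 - vmSum P 2 0 0))
      (norm_sawCoeff_le (one_mem_sawFreq hY0))
    have h5 : |((1 : ℤ) : ℝ) * a - h - 0| ≤ P / X ^ 6 := by
      rw [Int.cast_one, one_mul, sub_zero, abs_of_nonneg (by linarith)]; exact hah
    have h6 : 154 * ((P : ℝ) / X ^ 6) ≤ P / X / 2 := by
      calc 154 * ((P : ℝ) / X ^ 6) ≤ (X / 2) * (P / X ^ 6) := by gcongr; linarith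
        _ = P / X ^ 5 / 2 := by field_simp
        _ ≤ P / X / 2 := by gcongr; exact le_self_pow₀ hX1 (by norm_num)
    have h7 := (h4.trans h2).trans (mul_le_mul_of_nonneg_left h5 (by norm_num))
    linarith

open Filter in
theorem sawSum_sub_estimate : ∀ᶠ X : ℝ in atTop, ∀ P h a a' : ℕ, 1 ≤ P →
    |(a : ℝ) - a'| ≤ P / X ^ 6 → ‖sawSum ⌈X⌉₊ P h a - sawSum ⌈X⌉₊ P h a'‖ ≤ P / X := by
  filter_upwards [eventually_ge_atTop 20000] with X hX P h a a' hP haa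
  have hX0 : 0 < X := by linarith
  have hY1 : (⌈X⌉₊ : ℝ) ≤ X + 1 := (Nat.ceil_lt_add_one hX0.le).le
  have hY2 : (⌈X⌉₊ : ℝ) ^ 2 ≤ 2 * X ^ 2 := by
    calc (⌈X⌉₊ : ℝ) ^ 2 ≤ (X + 1) ^ 2 := by gcongr
      _ ≤ _ := by nlinarith
  unfold sawSum
  rw [← sum_sub_distrib]
  calc _ ≤ ∑ k ∈ sawFreq ⌈X⌉₊, 154 * (8 * X ^ 2 * (P / X ^ 6)) := by
        refine norm_sum_le_of_le _ fun k hk => ?_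
        rw [← mul_sub, norm_mul]
        refine (mul_le_of_le_one_left (norm_nonneg _) (norm_sawCoeff_le hk)).trans ?_
        refine (norm_vmSum_sub_le hP _ _).trans ?_
        rw [show (k : ℝ) * a - h - (k * a' - h) = k * (a - a') by ring, abs_mul]
        have := abs_le_of_mem_sawFreq hk
        gcongr
        linarith
    _ = (sawFreq ⌈X⌉₊).card * (154 * (8 * X ^ 2 * (P / X ^ 6))) := by rw [sum_const, nsmul_eq_mul]
    _ ≤ (16 * X ^ 2) * (154 * (8 * X ^ 2 * (P / X ^ 6))) := by
        gcongr
        have h2 : ((sawFreq ⌈X⌉₊).card : ℝ) ≤ 8 * (⌈X⌉₊ : ℝ) ^ 2 := by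
          exact_mod_cast card_sawFreq_le ⌈X⌉₊
        linarith
    _ = 19712 / X * (P / X) := by field_simp; norm_num
    _ ≤ 1 * (P / X) := by
        refine mul_le_mul_of_nonneg_right ?_ (by positivity)
        rw [div_le_one hX0]; linarith
    _ = _ := one_mul _

open Filter in
/-- A linear relation between fractional parts at primes forces cancellation between the
corresponding exponential sums. -/
theorem norm_sum_sawSum_le {c0 e : ℝ} (hc0 : 0 < c0) (hc1 : c0 ≤ 1) (he : 0 < e) :
    ∀ᶠ X : ℝ in atTop, ∀ (P h J : ℕ) (a : Fin 6 → ℕ) (s : Fin 6 → ℝ),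
      X ^ ((2 : ℝ) / 3 + e) ≤ Real.log P → Real.log P ≤ X →
      1 ≤ J → (J : ℝ) ≤ X / Real.log P + 1 → (∀ i, |s i| ≤ 1) →
      Real.exp ((1 + c0) * Real.log P) ≤ h → (h : ℝ) ≤ Real.exp (2 * X) →
      (∀ i, Real.exp ((1 + c0) * Real.log P) ≤ a i) → (∀ i, (a i : ℝ) ≤ Real.exp (2 * X)) →
      (∀ i, ∀ j ∈ Icc 2 J, Real.exp ((j + c0) * Real.log P) ≤ a i ∨
        (a i : ℝ) ≤ Real.exp ((j - c0) * Real.log P)) →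
      (∀ p ∈ Ioc P (4 * P), p.Prime →
        ∑ j ∈ Icc 1 J, ∑ i, s i * Int.fract ((a i : ℝ) / (p : ℝ) ^ j) = 0) →
      ‖∑ i, (s i : ℂ) * sawSum ⌈X⌉₊ P h (a i)‖ ≤ P / 40 := by
  filter_upwards [eventually_ge_atTop 100, fractSum_estimates hc0 hc1 he,
    eventually_le_rpow (show (0 : ℝ) < 2 / 3 by norm_num) 23040,
    eventually_mul_pow_le_exp (show (0 : ℝ) < 1 / 2 by norm_num) (show (0 : ℝ) < 2 / 3 by norm_num)
      7680 2] with X hX H hX23 hexp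
  intro P h J a s hτ1 hτX hJ1 hJ2 hs hh1 hh2 ha1 ha2 hdich hzero
  have hX0 : 0 < X := by linarith
  have hX1 : 1 ≤ X := by linarith
  have hτ2 : X ^ ((2 : ℝ) / 3) ≤ Real.log P :=
    (Real.rpow_le_rpow_of_exponent_le hX1 (by linarith)).trans hτ1
  have hτ0 : 0 < Real.log P := lt_of_lt_of_le (by positivity) hτ2
  have hP0 : (0 : ℝ) < P := by
    rcases Nat.eq_zero_or_pos P with h | h
    · simp [h] at hτ0
    · exact_mod_cast h
  have hPn : 1 ≤ P := by exact_mod_cast hP0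
  have hest := fun i => H P h (a i) hτ1 hτX hh1 hh2 (ha2 i)
  set E := 24 * (P : ℝ) / X with hE
  have hE0 : 0 ≤ E := by positivity
  clear_value E
  have hXX : X ^ ((1 : ℝ) / 3) * X ^ ((2 : ℝ) / 3) = X := by
    rw [← Real.rpow_add hX0]; norm_num
  have hX13 : 1 ≤ X ^ ((1 : ℝ) / 3) := Real.one_le_rpow hX1 (by norm_num)
  have hJ3 : (J : ℝ) ≤ 2 * X ^ ((1 : ℝ) / 3) := by
    have h1 : X / Real.log P ≤ X ^ ((1 : ℝ) / 3) := by
      rw [div_le_iff₀ hτ0]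
      calc X = X ^ ((1 : ℝ) / 3) * X ^ ((2 : ℝ) / 3) := hXX.symm
        _ ≤ _ := by gcongr
    linarith
  -- the relation, summed over all prime powers
  have e1 : ∑ j ∈ Icc 1 J, ∑ i, (s i : ℂ) * fractSum P h (a i) j =
      ∑ d ∈ Ioc P (4 * P), (ArithmeticFunction.vonMangoldt d : ℂ) * (ee (-h / d) *
        ((∑ j ∈ Icc 1 J, ∑ i, s i * Int.fract ((a i : ℝ) / (d : ℝ) ^ j) : ℝ) : ℂ)) := by
    simp only [fractSum, Complex.ofReal_sum, mul_sum]
    rw [sum_comm (s := Ioc P (4 * P)) (t := Icc 1 J)]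
    refine sum_congr rfl fun j _ => ?_
    rw [sum_comm]
    refine sum_congr rfl fun i _ => sum_congr rfl fun d _ => ?_
    push_cast; ring
  have e2 : ‖∑ j ∈ Icc 1 J, ∑ i, (s i : ℂ) * fractSum P h (a i) j‖ ≤
      4 * √P * Real.log (4 * P) * (J * 6) := by
    rw [e1]
    calc _ ≤ ∑ d ∈ Ioc P (4 * P), (if ¬ d.Prime then ArithmeticFunction.vonMangoldt d * (J * 6) else 0) := by
          refine norm_sum_le_of_le _ fun d hd => ?_
          by_cases hp : d.Prime
          · rw [hzero d hd hp]; simp [hp]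
          · rw [if_pos hp, norm_mul, norm_mul, norm_ee, one_mul, Complex.norm_real, Complex.norm_real,
              Real.norm_of_nonneg ArithmeticFunction.vonMangoldt_nonneg]
            refine mul_le_mul_of_nonneg_left ?_ ArithmeticFunction.vonMangoldt_nonneg
            calc _ ≤ ∑ j ∈ Icc 1 J, (6 : ℝ) := by
                  refine norm_sum_le_of_le _ fun j _ => ?_
                  calc _ ≤ ∑ i : Fin 6, (1 : ℝ) := by
                        refine norm_sum_le_of_le _ fun i _ => ?_
                        rw [norm_mul, Real.norm_eq_abs, Real.norm_of_nonneg (Int.fract_nonneg _)]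
                        exact mul_le_one₀ (hs i) (Int.fract_nonneg _) (Int.fract_lt_one _).le
                    _ = 6 := by simp
              _ = J * 6 := by simp
      _ = (∑ d ∈ Ioc P (4 * P) with ¬ d.Prime, ArithmeticFunction.vonMangoldt d) * (J * 6) := by
          rw [← sum_filter, sum_mul]
      _ ≤ _ := by gcongr; exact sum_Ioc_not_prime_vonMangoldt_le hPn
  have e3 : ∑ i, (s i : ℂ) * sawSum ⌈X⌉₊ P h (a i) =
      ∑ j ∈ Icc 1 J, ∑ i, (s i : ℂ) * fractSum P h (a i) j -
      (∑ i, (s i : ℂ) * (fractSum P h (a i) 1 - sawSum ⌈X⌉₊ P h (a i)) +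
       ∑ j ∈ Icc 2 J, ∑ i, (s i : ℂ) * fractSum P h (a i) j) := by
    have : Icc 1 J = insert 1 (Icc 2 J) := by ext; simp; omega
    rw [this, sum_insert (by simp)]
    simp only [mul_sub, sum_sub_distrib]
    ring
  have e4 : ‖∑ i, (s i : ℂ) * (fractSum P h (a i) 1 - sawSum ⌈X⌉₊ P h (a i))‖ ≤ 6 * E := by
    calc _ ≤ ∑ i : Fin 6, E := by
          refine norm_sum_le_of_le _ fun i _ => ?_
          rw [norm_mul, Complex.norm_real]
          exact (mul_le_of_le_one_left (norm_nonneg _) (hs i)).trans ((hest i).1 (ha1 i))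
      _ = 6 * E := by simp
  have e5 : ‖∑ j ∈ Icc 2 J, ∑ i, (s i : ℂ) * fractSum P h (a i) j‖ ≤ (J - 1) * (6 * E) := by
    calc _ ≤ ∑ j ∈ Icc 2 J, (6 * E) := by
          refine norm_sum_le_of_le _ fun j hj => ?_
          calc _ ≤ ∑ i : Fin 6, E := by
                refine norm_sum_le_of_le _ fun i _ => ?_
                rw [norm_mul, Complex.norm_real]
                rw [mem_Icc] at hj
                refine (mul_le_of_le_one_left (norm_nonneg _) (hs i)).trans
                  ((hest i).2 j hj.1 ?_ (hdich i j (mem_Icc.2 hj)))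
                have h1 : (j : ℝ) ≤ J := by exact_mod_cast hj.2
                have h2 : X / Real.log P ≤ 2 * X / Real.log P := by gcongr; linarith
                linarith
            _ = 6 * E := by simp
      _ = (J - 1) * (6 * E) := by
          rw [sum_const, Nat.card_Icc, nsmul_eq_mul, Nat.cast_sub (by omega)]
          push_cast; ring
  have e6 : J * (6 * E) ≤ P / 80 := by
    calc J * (6 * E) ≤ 2 * X ^ ((1 : ℝ) / 3) * (6 * E) := by gcongr
      _ = 23040 * X ^ ((1 : ℝ) / 3) / X * (P / 80) := by rw [hE]; field_simp; ring
      _ ≤ 1 * (P / 80) := by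
          refine mul_le_mul_of_nonneg_right ?_ (by positivity)
          rw [div_le_one hX0]
          calc 23040 * X ^ ((1 : ℝ) / 3) ≤ X ^ ((2 : ℝ) / 3) * X ^ ((1 : ℝ) / 3) := by gcongr
            _ = X := by rw [mul_comm]; exact hXX
      _ = _ := one_mul _
  have e7 : 4 * √P * Real.log (4 * P) * (J * 6) ≤ P / 80 := by
    have h1 : Real.log (4 * P) ≤ 2 * X := by
      rw [Real.log_mul (by norm_num) hP0.ne']
      have : Real.log 4 ≤ 4 - 1 := Real.log_le_sub_one_of_pos (by norm_num)
      linarith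
    have h2 : (J : ℝ) ≤ 2 * X := by
      refine hJ3.trans ?_
      have : X ^ ((1 : ℝ) / 3) ≤ X ^ (1 : ℝ) := Real.rpow_le_rpow_of_exponent_le hX1 (by norm_num)
      rw [Real.rpow_one] at this
      linarith
    have h3 : 7680 * X ^ 2 ≤ √P := by
      apply Real.le_sqrt_of_sq_le
      calc (7680 * X ^ 2) ^ 2 ≤ (Real.exp (1 / 2 * X ^ ((2 : ℝ) / 3))) ^ 2 := by gcongr
        _ = Real.exp (X ^ ((2 : ℝ) / 3)) := by rw [← Real.exp_nat_mul]; congr 1; push_cast; ring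
        _ ≤ Real.exp (Real.log P) := Real.exp_le_exp.2 hτ2
        _ = P := Real.exp_log hP0
    calc 4 * √P * Real.log (4 * P) * (J * 6) ≤ 4 * √P * (2 * X) * (2 * X * 6) := by gcongr
      _ = √P * (7680 * X ^ 2) / 80 := by ring
      _ ≤ √P * √P / 80 := by gcongr
      _ = _ := by rw [Real.mul_self_sqrt hP0.le]
  rw [e3]
  refine (norm_sub_le _ _).trans ?_
  have e8 := norm_add_le (∑ i, (s i : ℂ) * (fractSum P h (a i) 1 - sawSum ⌈X⌉₊ P h (a i)))
    (∑ j ∈ Icc 2 J, ∑ i, (s i : ℂ) * fractSum P h (a i) j)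
  linarith

/-- The numbers entering Kummer's formula for two equal binomial coefficients. -/
def kummerArg (n m n' m' : ℕ) : Fin 6 → ℕ := ![m', n' - m', n, n', m, n - m]

/-- The signs attached to `kummerArg`. -/
def kummerSign : Fin 6 → ℝ := ![1, 1, 1, -1, -1, -1]

theorem sum_kummerSign_mul_fract {p n m n' m' J : ℕ} (hp : p.Prime) (hmn : m ≤ n) (hmn' : m' ≤ n')
    (h : n.choose m = n'.choose m') (hJ : n < p ^ (J + 1)) (hJ' : n' < p ^ (J + 1)) :
    ∑ j ∈ Icc 1 J, ∑ i, kummerSign i * Int.fract ((kummerArg n m n' m' i : ℝ) / (p : ℝ) ^ j) = 0 := by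
  have h1 := sum_fract_eq_padicValNat_choose hp hmn hJ
  have h2 := sum_fract_eq_padicValNat_choose hp hmn' hJ'
  rw [h, ← h2, ← sub_eq_zero, ← sum_sub_distrib] at h1
  rw [← neg_eq_zero, ← h1, ← sum_neg_distrib]
  refine sum_congr rfl fun j _ => ?_
  simp [Fin.sum_univ_six, kummerArg, kummerSign]
  ring

open MeasureTheory in
theorem volume_near_integer_le {A α c : ℝ} (hA : 0 < A) (hα : 2 ≤ α * A) (hc0 : 0 < c) (hc1 : c ≤ 1) :
    volume {u | u ∈ Set.Icc A (2 * A) ∧ ∃ j : ℤ, |α * u - j| < c} ≤ ENNReal.ofReal (6 * c * A) := by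
  have hα0 : 0 < α := by
    by_contra! h
    nlinarith
  set β := α * A with hβ
  calc volume {u | u ∈ Set.Icc A (2 * A) ∧ ∃ j : ℤ, |α * u - j| < c}
      ≤ volume (⋃ j ∈ Icc ⌈β - 1⌉ ⌊2 * β + 1⌋, Metric.ball ((j : ℝ) / α) (c / α)) := by
        refine measure_mono ?_
        rintro u ⟨⟨hu1, hu2⟩, j, hj⟩
        have h1 : β ≤ α * u := by rw [hβ]; gcongr
        have h2 : α * u ≤ 2 * β := by
          calc α * u ≤ α * (2 * A) := by gcongr
            _ = _ := by rw [hβ]; ring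
        rw [abs_lt] at hj
        simp only [Set.mem_iUnion]
        refine ⟨j, mem_Icc.2 ⟨Int.ceil_le.2 (by linarith), Int.le_floor.2 (by linarith)⟩, ?_⟩
        rw [Metric.mem_ball, Real.dist_eq, show u - j / α = (α * u - j) / α by field_simp, abs_div,
          abs_of_pos hα0]
        gcongr
        exact abs_lt.2 hj
    _ ≤ ∑ j ∈ Icc ⌈β - 1⌉ ⌊2 * β + 1⌋, volume (Metric.ball ((j : ℝ) / α) (c / α)) :=
        measure_biUnion_finset_le _ _
    _ = ENNReal.ofReal (∑ j ∈ Icc ⌈β - 1⌉ ⌊2 * β + 1⌋, 2 * (c / α)) := by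
        rw [ENNReal.ofReal_sum_of_nonneg (fun _ _ => by positivity)]
        simp only [Real.volume_ball]
    _ ≤ _ := by
        refine ENNReal.ofReal_le_ofReal ?_
        rw [sum_const, nsmul_eq_mul, Int.card_Icc]
        have h1 := Int.le_ceil (β - 1)
        have h2 := Int.floor_le (2 * β + 1)
        have h3 : (((⌊2 * β + 1⌋ + 1 - ⌈β - 1⌉).toNat : ℤ) : ℝ) ≤ β + 3 := by
          rw [Int.toNat_eq_max]
          push_cast
          refine max_le (by linarith) (by linarith)
        rw [Int.cast_natCast] at h3
        calc _ ≤ (β + 3) * (2 * (c / α)) := by gcongr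
          _ ≤ (3 * β) * (2 * (c / α)) := by gcongr; linarith
          _ = _ := by rw [hβ]; field_simp; ring

theorem exists_scale_far_from_integers {T : ℝ} (hT : 0 < T) (α : Fin 6 → ℝ) (hα : ∀ i, 4 * T ≤ α i) :
    ∃ τ, T ≤ τ ∧ τ ≤ 2 * T ∧ ∀ i, ∀ j : ℤ, 1 / 40 * τ ≤ |α i - j * τ| := by
  set A := 1 / (2 * T) with hA
  have hA0 : 0 < A := by positivity
  obtain ⟨u, ⟨hu1, hu2⟩, hu⟩ : ∃ u ∈ Set.Icc A (2 * A), ∀ i, ∀ j : ℤ, 1 / 40 ≤ |α i * u - j| := by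
    by_contra! H
    have h1 : Set.Icc A (2 * A) ⊆ ⋃ i, {u | u ∈ Set.Icc A (2 * A) ∧ ∃ j : ℤ, |α i * u - j| < 1 / 40} := by
      intro u hu
      obtain ⟨i, j, hj⟩ := H u hu
      exact Set.mem_iUnion.2 ⟨i, hu, j, hj⟩
    have h2 := (MeasureTheory.measure_mono (μ := MeasureTheory.volume) h1).trans
      (MeasureTheory.measure_iUnion_fintype_le _ _)
    have h3 := h2.trans (sum_le_sum fun i _ => volume_near_integer_le hA0 (by
      have := mul_le_mul_of_nonneg_right (hα i) hA0.le
      have h4 : 4 * T * A = 2 := by rw [hA]; field_simp; norm_num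
      linarith) (by norm_num : (0 : ℝ) < 1 / 40) (by norm_num))
    rw [← ENNReal.ofReal_sum_of_nonneg (fun _ _ => by positivity), Real.volume_Icc,
      ENNReal.ofReal_le_ofReal_iff (by positivity)] at h3
    simp at h3
    linarith
  have hu0 : 0 < u := hA0.trans_le hu1
  refine ⟨1 / u, ?_, ?_, fun i j => ?_⟩
  · rw [le_div_iff₀ hu0]
    calc T * u ≤ T * (2 * A) := by gcongr
      _ = 1 := by rw [hA]; field_simp
  · rw [div_le_iff₀ hu0]
    calc 1 = 2 * T * A := by rw [hA]; field_simp
      _ ≤ _ := by gcongr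
  · have h1 : α i - j * (1 / u) = (α i * u - j) * (1 / u) := by field_simp
    rw [h1, abs_mul, abs_of_pos (show 0 < 1 / u by positivity)]
    gcongr
    exact hu i j

theorem exists_nat_scale {T X : ℝ} (hT : 1 ≤ T) (hX : 1 ≤ X) (hTX : 1000 * X ≤ Real.exp T)
    (α : Fin 6 → ℝ) (hα : ∀ i, 4 * T ≤ α i) :
    ∃ P : ℕ, T ≤ Real.log P ∧ Real.log P ≤ 3 * T ∧ ∀ i, ∀ j : ℕ, (j : ℝ) ≤ 2 * X →
      (j + 1 / 50) * Real.log P ≤ α i ∨ α i ≤ (j - 1 / 50) * Real.log P := by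
  obtain ⟨τ, hτ1, hτ2, hτ⟩ := exists_scale_far_from_integers (by linarith) α hα
  have hE : 1000 * X ≤ Real.exp τ := hTX.trans (Real.exp_le_exp.2 hτ1)
  have h1 : τ ≤ Real.log ⌈Real.exp τ⌉₊ := by
    rw [Real.le_log_iff_exp_le (lt_of_lt_of_le (Real.exp_pos _) (Nat.le_ceil _))]
    exact Nat.le_ceil _
  have h2 : Real.log ⌈Real.exp τ⌉₊ ≤ τ + 1 / (1000 * X) := by
    rw [Real.log_le_iff_le_exp (lt_of_lt_of_le (Real.exp_pos _) (Nat.le_ceil _)), Real.exp_add]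
    refine (Nat.ceil_lt_add_one (Real.exp_pos _).le).le.trans ?_
    have h3 := Real.add_one_le_exp (1 / (1000 * X))
    calc Real.exp τ + 1 ≤ Real.exp τ * (1 / (1000 * X) + 1) := by
          rw [mul_add, mul_one, mul_one_div, add_comm]
          gcongr
          rwa [le_div_iff₀ (by positivity), one_mul]
      _ ≤ _ := by gcongr
  have h0 : 1 / (1000 * X) ≤ 1 / 1000 := by
    apply one_div_le_one_div_of_le (by norm_num); linarith
  refine ⟨⌈Real.exp τ⌉₊, by linarith, by linarith, fun i j hj => ?_⟩
  set σ := Real.log ⌈Real.exp τ⌉₊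
  clear_value σ
  have h3 := hτ i j
  rw [Int.cast_natCast] at h3
  have h4 : (j : ℝ) * σ ≤ j * τ + 1 / 500 := by
    calc (j : ℝ) * σ ≤ j * (τ + 1 / (1000 * X)) := by gcongr
      _ = j * τ + j * (1 / (1000 * X)) := by ring
      _ ≤ j * τ + 2 * X * (1 / (1000 * X)) := by gcongr
      _ = _ := by field_simp; ring
  have h5 : (j : ℝ) * τ ≤ j * σ := by gcongr
  rcases le_abs'.1 h3 with h | h
  · right; linarith
  · left; linarith

open Filter in
/-- For equal binomial coefficients there is a scale `P` at which the exponential sums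
attached to the six arguments nearly cancel. -/
theorem exists_scale_sum_sawSum_small {e : ℝ} (he : 0 < e) :
    ∀ᶠ X : ℝ in atTop, ∀ (n m n' m' h : ℕ) (T : ℝ), m ≤ n → m' ≤ n' → n.choose m = n'.choose m' →
      (n : ℝ) ≤ Real.exp X → (n' : ℝ) ≤ Real.exp X → X ^ ((2 : ℝ) / 3 + e) ≤ T → 3 * T ≤ X →
      (∀ i, Real.exp (4 * T) ≤ kummerArg n m n' m' i) →
      Real.exp (4 * T) ≤ h → (h : ℝ) ≤ Real.exp X →
      ∃ P : ℕ, T ≤ Real.log P ∧ Real.log P ≤ 3 * T ∧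
        ‖∑ i, (kummerSign i : ℂ) * sawSum ⌈X⌉₊ P h (kummerArg n m n' m' i)‖ ≤ P / 40 := by
  filter_upwards [eventually_ge_atTop 1,
    norm_sum_sawSum_le (show (0 : ℝ) < 1 / 50 by norm_num) (by norm_num) he,
    eventually_mul_pow_le_exp one_pos (show (0 : ℝ) < 2 / 3 + e by linarith) 1000 1] with X hX H hexp
  intro n m n' m' h T hmn hmn' hch hn hn' hT hTX ha hh hhX
  have hX0 : 0 < X := by linarith
  have hT1 : 1 ≤ T := (Real.one_le_rpow hX (by linarith)).trans hT
  rw [one_mul, pow_one] at hexp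
  have hexp' : 1000 * X ≤ Real.exp T := hexp.trans (Real.exp_le_exp.2 hT)
  have ha0 : ∀ i, (0 : ℝ) < kummerArg n m n' m' i := fun i => (Real.exp_pos _).trans_le (ha i)
  obtain ⟨P, hP1, hP2, hP3⟩ := exists_nat_scale hT1 hX hexp'
    (fun i => Real.log (kummerArg n m n' m' i)) fun i => by
      rw [Real.le_log_iff_exp_le (ha0 i)]; exact ha i
  refine ⟨P, hP1, hP2, ?_⟩
  have hτ0 : 0 < Real.log P := by linarith
  have hP0 : (0 : ℝ) < P := by
    rcases Nat.eq_zero_or_pos P with h | h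
    · simp [h] at hτ0
    · exact_mod_cast h
  have hX2 : Real.exp X ≤ Real.exp (2 * X) := Real.exp_le_exp.2 (by linarith)
  have hT4 : Real.exp ((1 + 1 / 50) * Real.log P) ≤ Real.exp (4 * T) := Real.exp_le_exp.2 (by linarith)
  have hfl : X / Real.log P < (⌊X / Real.log P⌋₊ + 1 : ℕ) := by
    push_cast; exact Nat.lt_floor_add_one _
  have hfl' : (⌊X / Real.log P⌋₊ : ℝ) ≤ X / Real.log P := Nat.floor_le (by positivity)
  have hdiv : X / Real.log P ≤ X := div_le_self hX0.le (by linarith)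
  set J := ⌊X / Real.log P⌋₊ + 1 with hJ
  have hJr : (J : ℝ) ≤ X / Real.log P + 1 := by rw [hJ]; push_cast; linarith
  have hJ1 : 1 ≤ J := by omega
  clear_value J
  refine H P h J (kummerArg n m n' m') kummerSign (hT.trans hP1) (hP2.trans hTX) hJ1 hJr ?_
    (hT4.trans hh) (hhX.trans hX2) (fun i => hT4.trans (ha i)) ?_ ?_ ?_
  · intro i
    fin_cases i <;> simp [kummerSign]
  · intro i
    refine le_trans ?_ hX2
    have h1 : kummerArg n m n' m' i ≤ n ∨ kummerArg n m n' m' i ≤ n' := by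
      fin_cases i <;> simp [kummerArg] <;> omega
    rcases h1 with h1 | h1
    · exact (Nat.cast_le.2 h1).trans hn
    · exact (Nat.cast_le.2 h1).trans hn'
  · intro i j hj
    rw [mem_Icc] at hj
    have hjJ : (j : ℝ) ≤ J := by exact_mod_cast hj.2
    rw [← Real.le_log_iff_exp_le (ha0 i), ← Real.log_le_iff_le_exp (ha0 i)]
    exact hP3 i j (by linarith)
  · intro p hp hpp
    have hpow : ∀ k : ℕ, (k : ℝ) ≤ Real.exp X → k < p ^ (J + 1) := fun k hk => by
      rw [mem_Ioc] at hp
      have h1 : (P : ℝ) ≤ p := by exact_mod_cast hp.1.le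
      have h2 : (k : ℝ) < (p : ℝ) ^ (J + 1) := by
        calc (k : ℝ) ≤ Real.exp X := hk
          _ < Real.exp (J * Real.log P) := by
            rw [div_lt_iff₀ hτ0] at hfl
            exact Real.exp_lt_exp.2 hfl
          _ ≤ Real.exp ((J + 1 : ℕ) * Real.log P) := by
            gcongr; simp
          _ = (P : ℝ) ^ (J + 1) := by rw [Real.exp_nat_mul, Real.exp_log hP0]
          _ ≤ _ := by gcongr
      exact_mod_cast h2
    exact sum_kummerSign_mul_fract hpp hmn hmn' hch (hpow n hn) (hpow n' hn')

open Filter in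
/-- The resonant main term is too large to be cancelled. -/
theorem lt_norm_resonance : ∀ᶠ X : ℝ in atTop, ∀ (P : ℕ), X ^ ((2 : ℝ) / 3) ≤ Real.log P →
    Real.log P ≤ X → ∀ κ w : ℂ, 1 ≤ ‖κ‖ →
      ‖w - κ * (sawCoeff ⌈X⌉₊ 1 * vmSum P 2 0 0)‖ ≤ 6 * (P / X) → (P : ℝ) / 40 < ‖w‖ := by
  filter_upwards [eventually_ge_atTop 100,
    eventually_mul_pow_le_exp (show (0 : ℝ) < 1 / 2 by norm_num) (show (0 : ℝ) < 2 / 3 by norm_num)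
      100 1] with X hX hexp
  intro P hτ1 hτX κ w hκ hw
  have hX0 : 0 < X := by linarith
  have hτ0 : 0 < Real.log P := lt_of_lt_of_le (by positivity) hτ1
  have hP0 : (0 : ℝ) < P := by
    rcases Nat.eq_zero_or_pos P with h | h
    · simp [h] at hτ0
    · exact_mod_cast h
  have hPn : 1 ≤ P := by exact_mod_cast hP0
  have h3 : 100 * X ≤ √P := by
    apply Real.le_sqrt_of_sq_le
    rw [pow_one] at hexp
    calc (100 * X) ^ 2 ≤ (Real.exp (1 / 2 * X ^ ((2 : ℝ) / 3))) ^ 2 := by gcongr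
      _ = Real.exp (X ^ ((2 : ℝ) / 3)) := by rw [← Real.exp_nat_mul]; congr 1; push_cast; ring
      _ ≤ Real.exp (Real.log P) := Real.exp_le_exp.2 hτ1
      _ = P := Real.exp_log hP0
  have hlog : Real.log (4 * P) ≤ 2 * X := by
    rw [Real.log_mul (by norm_num) hP0.ne']
    have : Real.log 4 ≤ 4 - 1 := Real.log_le_sub_one_of_pos (by norm_num)
    linarith
  have hΛ : (P : ℝ) ≤ ∑ d ∈ Ioc P (4 * P), ArithmeticFunction.vonMangoldt d := by
    refine le_sum_Ioc_vonMangoldt hPn ?_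
    have h4 : √(P : ℝ) * √P = P := Real.mul_self_sqrt hP0.le
    have h5 : 4 * √(P : ℝ) * Real.log (4 * P) ≤ 4 * √P * (2 * X) := by gcongr
    nlinarith
  have hc : 1 / 10 ≤ ‖sawCoeff ⌈X⌉₊ 1‖ := norm_sawCoeff_one_ge (Nat.one_le_ceil_iff.2 hX0)
  have hmain : 1 * (1 / 10 * (P : ℝ)) ≤ ‖κ * (sawCoeff ⌈X⌉₊ 1 * vmSum P 2 0 0)‖ := by
    rw [norm_mul, norm_mul, vmSum_zero, Complex.norm_real]
    have := hΛ.trans (Real.le_norm_self _)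
    gcongr
  have h6 := norm_sub_norm_le (κ * (sawCoeff ⌈X⌉₊ 1 * vmSum P 2 0 0)) w
  rw [norm_sub_rev] at h6
  have h7 : (P : ℝ) / X ≤ P / 100 := by gcongr
  linarith

open Filter in
/-- Resonance at `h = m'`: the difference `m - m'` is small unless `n' - 2 * m'` is of
intermediate size. -/
theorem sub_lt_of_choose_eq_of_gap {e : ℝ} (he : 0 < e) :
    ∀ᶠ X : ℝ in atTop, ∀ (n m n' m' : ℕ) (T : ℝ), 2 * m ≤ n → 2 * m' ≤ n' → n ≤ n' → m' ≤ m →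
      n.choose m = n'.choose m' →
      (n : ℝ) ≤ Real.exp X → (n' : ℝ) ≤ Real.exp X → X ^ ((2 : ℝ) / 3 + e) ≤ T → 3 * T ≤ X →
      Real.exp (4 * T) ≤ m' →
      ((n' : ℝ) - 2 * m' ≤ Real.exp T / X ^ 6 ∨ Real.exp (4 * T) ≤ (n' : ℝ) - 2 * m') →
      (m : ℝ) - m' < Real.exp (4 * T) := by
  filter_upwards [eventually_ge_atTop 1, exists_scale_sum_sawSum_small he, lt_norm_resonance,
    sawSum_estimates (show (0 : ℝ) < 1 / 50 by norm_num) (by norm_num) he] with X hX H1 H2 H3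
  intro n m n' m' T hmn hmn' hnn hmm hch hn hn' hT hTX hm' hgap
  by_contra! hbig
  have hX0 : 0 < X := by linarith
  have hT1 : 1 ≤ T := (Real.one_le_rpow hX (by linarith)).trans hT
  have hmnr : 2 * (m : ℝ) ≤ n := by exact_mod_cast hmn
  have hmnr' : 2 * (m' : ℝ) ≤ n' := by exact_mod_cast hmn'
  have hnnr : (n : ℝ) ≤ n' := by exact_mod_cast hnn
  have hmmr : (m' : ℝ) ≤ m := by exact_mod_cast hmm
  have hc1 : ((n' - m' : ℕ) : ℝ) = n' - m' := Nat.cast_sub (by omega)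
  have hc2 : ((n - m : ℕ) : ℝ) = n - m := Nat.cast_sub (by omega)
  have hm'0 : (0 : ℝ) ≤ m' := by positivity
  obtain ⟨P, hP1, hP2, hP3⟩ := H1 n m n' m' m' T (by omega) (by omega) hch hn hn' hT hTX (by
    intro i
    refine hm'.trans ?_
    fin_cases i <;> simp only [kummerArg] <;> simp <;> omega) hm' (by linarith)
  have hP0 : (0 : ℝ) < P := by
    rcases Nat.eq_zero_or_pos P with h | h
    · simp [h] at hP1; linarith
    · exact_mod_cast h
  have hX2 : Real.exp X ≤ Real.exp (2 * X) := Real.exp_le_exp.2 (by linarith)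
  have hT4 : Real.exp ((1 + 1 / 50) * Real.log P) ≤ Real.exp (4 * T) := Real.exp_le_exp.2 (by linarith)
  have hTP : Real.exp T ≤ P := (Real.le_log_iff_exp_le hP0).1 hP1
  have hPX : Real.exp T / X ^ 6 ≤ P / X ^ 6 := by gcongr
  have est := fun a => H3 P m' a (hT.trans hP1) (hP2.trans hTX)
  have hlow := H2 P ((Real.rpow_le_rpow_of_exponent_le hX (by linarith)).trans (hT.trans hP1))
    (hP2.trans hTX)
  have small : ∀ a : ℕ, (a : ℝ) ≤ Real.exp X → Real.exp (4 * T) ≤ (a : ℝ) - m' →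
      ‖sawSum ⌈X⌉₊ P m' a‖ ≤ P / X := fun a ha1 ha2 => by
    have := Real.exp_pos (4 * T)
    exact (est a (by linarith) (ha1.trans hX2)).1 (hT4.trans ha2)
  have res : ∀ a : ℕ, (a : ℝ) ≤ Real.exp X → (m' : ℝ) ≤ a → (a : ℝ) - m' ≤ Real.exp T / X ^ 6 →
      ‖sawSum ⌈X⌉₊ P m' a - sawCoeff ⌈X⌉₊ 1 * vmSum P 2 0 0‖ ≤ P / X := fun a ha1 ha2 ha3 =>
    (est a ha2 (ha1.trans hX2)).2 (hT4.trans hm') (ha3.trans hPX)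
  have b1 := res m' (by linarith) le_rfl (by rw [sub_self]; positivity)
  have b3 := small n hn (by linarith)
  have b4 := small n' hn' (by linarith)
  have b5 := small m (by linarith) hbig
  have b6 := small (n - m) (by linarith) (by linarith)
  have hPX0 : 0 ≤ (P : ℝ) / X := by positivity
  simp [Fin.sum_univ_six, kummerArg, kummerSign] at hP3
  set S := sawSum ⌈X⌉₊ P m'
  set V := sawCoeff ⌈X⌉₊ 1 * vmSum P 2 0 0
  have hdec : ∀ z1 z2 z3 z4 z5 z6 : ℂ,
      ‖z1 + z2 + z3 - z4 - z5 - z6‖ ≤ ‖z1‖ + ‖z2‖ + ‖z3‖ + ‖z4‖ + ‖z5‖ + ‖z6‖ :=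
    fun z1 z2 z3 z4 z5 z6 => by
      have h1 := norm_add_le z1 z2
      have h2 := norm_add_le (z1 + z2) z3
      have h3 := norm_sub_le (z1 + z2 + z3) z4
      have h4 := norm_sub_le (z1 + z2 + z3 - z4) z5
      have h5 := norm_sub_le (z1 + z2 + z3 - z4 - z5) z6
      linarith
  rcases hgap with hg | hg
  · have b2 := res (n' - m') (by linarith) (by linarith) (by linarith)
    refine absurd hP3 (not_le.2 (hlow 2 _ (by simp) ?_))
    refine le_trans (le_of_eq ?_) ((hdec (S m' - V) (S (n' - m') - V) (S n) (S n') (S m) (S (n - m))).trans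
      (by linarith only [b1, b2, b3, b4, b5, b6]))
    congr 1; ring
  · have b2 := small (n' - m') (by linarith) (by linarith)
    refine absurd hP3 (not_le.2 (hlow 1 _ (by simp) ?_))
    refine le_trans (le_of_eq ?_) ((hdec (S m' - V) (S (n' - m')) (S n) (S n') (S m) (S (n - m))).trans
      (by linarith only [b1, b2, b3, b4, b5, b6]))
    congr 1; ring

open Filter in
/-- Resonance at `h = n - m`: if `m - m'` is small then so is `n' - n`. -/
theorem sub_lt_of_choose_eq_of_close {e : ℝ} (he : 0 < e) :
    ∀ᶠ X : ℝ in atTop, ∀ (n m n' m' : ℕ) (T : ℝ), 2 * m ≤ n → 2 * m' ≤ n' → n ≤ n' → m' ≤ m →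
      n.choose m = n'.choose m' →
      (n : ℝ) ≤ Real.exp X → (n' : ℝ) ≤ Real.exp X → X ^ ((2 : ℝ) / 3 + e) ≤ T → 3 * T ≤ X →
      Real.exp (4 * T) ≤ m' → (m : ℝ) - m' ≤ Real.exp T / X ^ 6 →
      (n' : ℝ) - n < Real.exp (4 * T) := by
  filter_upwards [eventually_ge_atTop 1, exists_scale_sum_sawSum_small he, lt_norm_resonance,
    sawSum_estimates (show (0 : ℝ) < 1 / 50 by norm_num) (by norm_num) he,
    sawSum_sub_estimate] with X hX H1 H2 H3 H4
  intro n m n' m' T hmn hmn' hnn hmm hch hn hn' hT hTX hm' hclose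
  by_contra! hbig
  have hX0 : 0 < X := by linarith
  have hT1 : 1 ≤ T := (Real.one_le_rpow hX (by linarith)).trans hT
  have hmnr : 2 * (m : ℝ) ≤ n := by exact_mod_cast hmn
  have hmnr' : 2 * (m' : ℝ) ≤ n' := by exact_mod_cast hmn'
  have hnnr : (n : ℝ) ≤ n' := by exact_mod_cast hnn
  have hmmr : (m' : ℝ) ≤ m := by exact_mod_cast hmm
  have hc1 : ((n' - m' : ℕ) : ℝ) = n' - m' := Nat.cast_sub (by omega)
  have hc2 : ((n - m : ℕ) : ℝ) = n - m := Nat.cast_sub (by omega)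
  have hm'0 : (0 : ℝ) ≤ m' := by positivity
  obtain ⟨P, hP1, hP2, hP3⟩ := H1 n m n' m' (n - m) T (by omega) (by omega) hch hn hn' hT hTX (by
    intro i
    refine hm'.trans ?_
    fin_cases i <;> simp only [kummerArg] <;> simp <;> omega) (by linarith) (by linarith)
  have hP0 : (0 : ℝ) < P := by
    rcases Nat.eq_zero_or_pos P with h | h
    · simp [h] at hP1; linarith
    · exact_mod_cast h
  have hX2 : Real.exp X ≤ Real.exp (2 * X) := Real.exp_le_exp.2 (by linarith)
  have hT4 : Real.exp ((1 + 1 / 50) * Real.log P) ≤ Real.exp (4 * T) := Real.exp_le_exp.2 (by linarith)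
  have hTP : Real.exp T ≤ P := (Real.le_log_iff_exp_le hP0).1 hP1
  have hPX : Real.exp T / X ^ 6 ≤ P / X ^ 6 := by gcongr
  have hlow := H2 P ((Real.rpow_le_rpow_of_exponent_le hX (by linarith)).trans (hT.trans hP1))
    (hP2.trans hTX)
  have small : ∀ a : ℕ, (a : ℝ) ≤ Real.exp X → Real.exp (4 * T) ≤ (a : ℝ) - (n - m : ℕ) →
      ‖sawSum ⌈X⌉₊ P (n - m) a‖ ≤ P / X := fun a ha1 ha2 => by
    have := Real.exp_pos (4 * T)
    exact (H3 P (n - m) a (hT.trans hP1) (hP2.trans hTX) (by linarith)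
      (ha1.trans hX2)).1 (hT4.trans ha2)
  have b1 := (H3 P (n - m) (n - m) (hT.trans hP1) (hP2.trans hTX) le_rfl (by linarith)).2
    (by linarith) (by rw [sub_self]; positivity)
  have b2 := small n hn (by linarith)
  have b3 := small n' hn' (by linarith)
  have b4 := small (n' - m') (by linarith) (by linarith)
  have b5 := H4 P (n - m) m m' (by exact_mod_cast hP0) (by
    rw [abs_of_nonneg (by linarith)]; linarith)
  have hPX0 : 0 ≤ (P : ℝ) / X := by positivity
  simp [Fin.sum_univ_six, kummerArg, kummerSign] at hP3
  set V := sawCoeff ⌈X⌉₊ 1 * vmSum P 2 0 0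
  have hdec : ∀ z1 z2 z3 z4 z5 : ℂ,
      ‖z1 + z2 - z3 - z4 - z5‖ ≤ ‖z1‖ + ‖z2‖ + ‖z3‖ + ‖z4‖ + ‖z5‖ :=
    fun z1 z2 z3 z4 z5 => by
      have h1 := norm_add_le z1 z2
      have h2 := norm_sub_le (z1 + z2) z3
      have h3 := norm_sub_le (z1 + z2 - z3) z4
      have h4 := norm_sub_le (z1 + z2 - z3 - z4) z5
      linarith
  refine absurd hP3 (not_le.2 (hlow (-1) _ (by simp) ?_))
  refine le_trans (le_of_eq ?_) ((hdec (sawSum ⌈X⌉₊ P (n - m) (n' - m')) (sawSum ⌈X⌉₊ P (n - m) n)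
    (sawSum ⌈X⌉₊ P (n - m) n') (sawSum ⌈X⌉₊ P (n - m) m - sawSum ⌈X⌉₊ P (n - m) m')
    (sawSum ⌈X⌉₊ P (n - m) (n - m) - V)).trans (by linarith only [b1, b2, b3, b4, b5, hPX0]))
  congr 1; ring

theorem choose_le_choose_of_le_half {n k l : ℕ} (hkl : k ≤ l) (hl : 2 * l ≤ n) :
    n.choose k ≤ n.choose l := by
  induction l, hkl using Nat.le_induction with
  | base => exact le_rfl
  | succ l _ ih => exact (ih (by omega)).trans (Nat.choose_le_succ_of_lt_half_left (by omega))

theorem le_of_choose_eq_of_lt {n m n' m' : ℕ} (hm : 1 ≤ m) (hmn : 2 * m ≤ n) (hmn' : 2 * m' ≤ n')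
    (hnn : n < n') (h : n.choose m = n'.choose m') : m' ≤ m := by
  by_contra! hlt
  obtain ⟨k, rfl⟩ : ∃ k, m = k + 1 := ⟨m - 1, by omega⟩
  have h1 : (n + 1).choose (k + 1) ≤ n'.choose (k + 1) := Nat.choose_le_choose _ hnn
  have h2 := choose_le_choose_of_le_half hlt.le hmn'
  have h3 : 0 < n.choose k := Nat.choose_pos (by omega)
  rw [Nat.choose_succ_succ'] at h1
  omega

open Filter in
theorem sub_le_exp_of_choose_eq {ε : ℝ} (hε : 0 < ε) (hε' : ε < 1 / 3) :
    ∀ᶠ X : ℝ in atTop, ∀ n m n' m' : ℕ, 1 ≤ m → 2 * m ≤ n → 2 * m' ≤ n' → n < n' →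
      n.choose m = n'.choose m' → (n : ℝ) ≤ Real.exp X → (n' : ℝ) ≤ Real.exp X →
      Real.exp (X ^ ((2 : ℝ) / 3 + ε)) ≤ m' →
      (n' : ℝ) - n ≤ Real.exp (X ^ ((2 : ℝ) / 3 + ε)) := by
  have hε2 : 0 < ε / 2 := by positivity
  filter_upwards [eventually_ge_atTop 1, sub_lt_of_choose_eq_of_gap hε2,
    sub_lt_of_choose_eq_of_close hε2, eventually_le_rpow hε2 84,
    eventually_mul_pow_le_exp one_pos (show (0 : ℝ) < 2 / 3 + ε / 2 by linarith) 1 6]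
    with X hX H1 H2 hX84 hexp
  intro n m n' m' hm1 hmn hmn' hnn hch hn hn' hm'
  have hX0 : 0 < X := by linarith
  have hmm := le_of_choose_eq_of_lt hm1 hmn hmn' hnn hch
  set T := X ^ ((2 : ℝ) / 3 + ε / 2) with hT
  have hT1 : 1 ≤ T := Real.one_le_rpow hX (by linarith)
  have h84 : 84 * T ≤ X ^ ((2 : ℝ) / 3 + ε) := by
    rw [show (2 : ℝ) / 3 + ε = ε / 2 + (2 / 3 + ε / 2) by ring, Real.rpow_add hX0, ← hT]
    gcongr
  have hX' : X ^ ((2 : ℝ) / 3 + ε) ≤ X := by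
    conv_rhs => rw [← Real.rpow_one X]
    exact Real.rpow_le_rpow_of_exponent_le hX (by linarith)
  rw [one_mul, one_mul] at hexp
  have hstep : ∀ k : ℝ, 0 ≤ k → Real.exp (k * T) ≤ Real.exp ((k + 1) * T) / X ^ 6 := fun k hk => by
    rw [le_div_iff₀ (by positivity), add_mul, one_mul, Real.exp_add]
    gcongr
  have hmono : ∀ k : ℝ, k ≤ 84 → Real.exp (k * T) ≤ Real.exp (X ^ ((2 : ℝ) / 3 + ε)) := fun k hk =>
    Real.exp_le_exp.2 (le_trans (by gcongr) h84)
  have hclose : (m : ℝ) - m' < Real.exp (20 * T) := by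
    by_cases hgap : (n' : ℝ) - 2 * m' ≤ Real.exp T / X ^ 6 ∨ Real.exp (4 * T) ≤ (n' : ℝ) - 2 * m'
    · refine (H1 n m n' m' T hmn hmn' hnn.le hmm hch hn hn' le_rfl (by linarith)
        ((hmono 4 (by norm_num)).trans hm') hgap).trans_le ?_
      exact Real.exp_le_exp.2 (by linarith)
    · push Not at hgap
      have h1 := H1 n m n' m' (5 * T) hmn hmn' hnn.le hmm hch hn hn' (by linarith) (by linarith)
        (by rw [← mul_assoc]; exact (hmono _ (by norm_num)).trans hm')
        (Or.inl (hgap.2.le.trans (by have := hstep 4 (by norm_num); norm_num at this; exact this)))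
      rw [← mul_assoc] at h1
      norm_num at h1
      exact h1
  refine (H2 n m n' m' (21 * T) hmn hmn' hnn.le hmm hch hn hn' (by linarith) (by linarith)
    (by rw [← mul_assoc]; exact (hmono _ (by norm_num)).trans hm')
    (hclose.le.trans (by have := hstep 20 (by norm_num); norm_num at this; exact this))).le.trans ?_
  rw [← mul_assoc]
  exact hmono _ (by norm_num)

open Filter in
theorem abs_sub_le_exp_of_choose_eq {ε : ℝ} (hε : 0 < ε) :
    ∀ᶠ X : ℝ in atTop, ∀ n m n' m' : ℕ, 1 ≤ m → 2 * m ≤ n → 1 ≤ m' → 2 * m' ≤ n' →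
      n.choose m = n'.choose m' → (n : ℝ) + n' ≤ Real.exp X →
      Real.exp (X ^ ((2 : ℝ) / 3 + ε)) ≤ min (m : ℝ) m' →
      |(n : ℝ) - n'| ≤ Real.exp (X ^ ((2 : ℝ) / 3 + ε)) := by
  rcases lt_or_ge ε (1 / 3) with hε' | hε'
  · filter_upwards [sub_le_exp_of_choose_eq hε hε'] with X H
    intro n m n' m' hm hmn hm' hmn' hch hnn hmin
    have hn0 : (0 : ℝ) ≤ n := by positivity
    have hn0' : (0 : ℝ) ≤ n' := by positivity
    obtain ⟨h1, h2⟩ := le_min_iff.1 hmin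
    rcases lt_trichotomy n n' with h | h | h
    · rw [abs_sub_comm, abs_of_pos (sub_pos.2 (by exact_mod_cast h))]
      exact H n m n' m' hm hmn hmn' h hch (by linarith) (by linarith) h2
    · rw [h, sub_self, abs_zero]
      positivity
    · rw [abs_of_pos (sub_pos.2 (by exact_mod_cast h))]
      exact H n' m' n m hm' hmn' hmn h hch.symm (by linarith) (by linarith) h1
  · filter_upwards [eventually_ge_atTop 1] with X hX
    intro n m n' m' _ _ _ _ _ hnn _
    have h1 : X ≤ X ^ ((2 : ℝ) / 3 + ε) := by
      conv_lhs => rw [← Real.rpow_one X]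
      exact Real.rpow_le_rpow_of_exponent_le hX (by linarith)
    refine le_trans ?_ (hnn.trans (Real.exp_le_exp.2 h1))
    have hn0 : (0 : ℝ) ≤ n := by positivity
    have hn0' : (0 : ℝ) ≤ n' := by positivity
    rw [abs_le]
    constructor <;> linarith

/-- Distance estimate, second part: for every `ε > 0` there is a constant `C(ε)` such that
any two solutions `(n,m)`, `(n',m')` of `C(n,m) = C(n',m') = t` in the left half of
Pascal's triangle with `min(m, m') ≥ exp((log(n+n'))^(2/3+ε))` satisfy
`|n - n'| ≤ C(ε) · exp((log(n+n'))^(2/3+ε))`. -/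
theorem stmt_5 (ε : ℝ) (hε : 0 < ε) :
    ∃ C : ℝ, ∀ t n m n' m' : ℕ, 2 ≤ t →
      1 ≤ m → 2 * m ≤ n → 1 ≤ m' → 2 * m' ≤ n' →
      Nat.choose n m = t → Nat.choose n' m' = t →
      Real.exp ((Real.log ((n : ℝ) + (n' : ℝ))) ^ ((2 : ℝ) / 3 + ε)) ≤
        min (m : ℝ) (m' : ℝ) →
      |(n : ℝ) - (n' : ℝ)| ≤
        C * Real.exp ((Real.log ((n : ℝ) + (n' : ℝ))) ^ ((2 : ℝ) / 3 + ε)) := by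
  obtain ⟨X₀, hX₀⟩ := Filter.eventually_atTop.1 (abs_sub_le_exp_of_choose_eq hε)
  refine ⟨max 1 (Real.exp X₀), fun t n m n' m' _ hm hmn hm' hmn' hnm hnm' hmin => ?_⟩
  have hn : (2 : ℝ) ≤ n := by exact_mod_cast (by omega : 2 ≤ n)
  have hn' : (2 : ℝ) ≤ n' := by exact_mod_cast (by omega : 2 ≤ n')
  have hexp : Real.exp (Real.log ((n : ℝ) + n')) = n + n' := Real.exp_log (by linarith)
  have hlog : 0 ≤ Real.log ((n : ℝ) + n') := Real.log_nonneg (by linarith)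
  set X := Real.log ((n : ℝ) + n')
  rcases le_total X₀ X with h | h
  · refine (hX₀ X h n m n' m' hm hmn hm' hmn' (hnm.trans hnm'.symm) hexp.ge hmin).trans ?_
    exact le_mul_of_one_le_left (Real.exp_pos _).le (le_max_left _ _)
  · calc |(n : ℝ) - n'| ≤ n + n' := by rw [abs_le]; constructor <;> linarith
      _ = Real.exp X := hexp.symm
      _ ≤ Real.exp X₀ := Real.exp_le_exp.2 h
      _ ≤ max 1 (Real.exp X₀) := le_max_right _ _
      _ ≤ _ := le_mul_of_one_le_right (by positivity)
          (Real.one_le_exp (Real.rpow_nonneg hlog _))
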